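/- Let P and P' be convex polytopes in ℝ³ with non-empty interior such that g_P = g_{P'}. Then the pairs (P, −P) and (P', −P') are synisothetic. -/

import Mathlib

open MeasureTheory Pointwise

/-- The covariogram of a set `K ⊆ ℝ³`: `g_K(x) = λ₃(K ∩ (K + x))`. -/
noncomputable def covariogram (K : Set (EuclideanSpace ℝ (Fin 3)))
    (x : EuclideanSpace ℝ (Fin 3)) : ℝ :=
  (volume (K ∩ ((x + ·) '' K))).toReal

/-- A (compact) convex polytope: the convex hull of a finite set. -/
def IsPolytope (P : Set (EuclideanSpace ℝ (Fin 3))) : Prop :=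
  ∃ S : Finset (EuclideanSpace ℝ (Fin 3)),
    P = convexHull ℝ (S : Set (EuclideanSpace ℝ (Fin 3)))

/-- The exposed face of `P` in direction `w`: `P_w = {x ∈ P : x·w = h_P(w)}`. -/
def exposedFace (P : Set (EuclideanSpace ℝ (Fin 3)))
    (w : EuclideanSpace ℝ (Fin 3)) : Set (EuclideanSpace ℝ (Fin 3)) :=
  {x ∈ P | ∀ y ∈ P, @inner ℝ _ _ w y ≤ @inner ℝ _ _ w x}

/-- The support cone of `P` at a face `F`:
`cone(P,F) = {μ(y − x) : y ∈ P, μ ≥ 0}` for `x ∈ relint F`. -/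
def supportCone (P F : Set (EuclideanSpace ℝ (Fin 3))) :
    Set (EuclideanSpace ℝ (Fin 3)) :=
  {v | ∃ x ∈ intrinsicInterior ℝ F, ∃ y ∈ P, ∃ μ : ℝ, 0 ≤ μ ∧ v = μ • (y - x)}

/-- `F` is a proper face of the polytope `P`: an exposed face in some unit direction. -/
def IsProperFace (P F : Set (EuclideanSpace ℝ (Fin 3))) : Prop :=
  ∃ w : EuclideanSpace ℝ (Fin 3), ‖w‖ = 1 ∧ F = exposedFace P w

/-- The face `F` of `P` and the face `G` of `Q` are isothetic:
`G` is a translate of `F` and `cone(P,F) = cone(Q,G)`. -/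
def Isothetic (P F Q G : Set (EuclideanSpace ℝ (Fin 3))) : Prop :=
  (∃ t : EuclideanSpace ℝ (Fin 3), G = (t + ·) '' F) ∧ supportCone P F = supportCone Q G

/-- The pairs `(P₁, P₂)` and `(Q₁, Q₂)` are synisothetic: every proper face of `P₁` or of
`P₂` is isothetic to some proper face of `Q₁` or of `Q₂`, and conversely. -/
def Synisothetic (P₁ P₂ Q₁ Q₂ : Set (EuclideanSpace ℝ (Fin 3))) : Prop :=
  (∀ F, IsProperFace P₁ F →
    ∃ G, (IsProperFace Q₁ G ∧ Isothetic P₁ F Q₁ G) ∨ (IsProperFace Q₂ G ∧ Isothetic P₁ F Q₂ G)) ∧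
  (∀ F, IsProperFace P₂ F →
    ∃ G, (IsProperFace Q₁ G ∧ Isothetic P₂ F Q₁ G) ∨ (IsProperFace Q₂ G ∧ Isothetic P₂ F Q₂ G)) ∧
  (∀ G, IsProperFace Q₁ G →
    ∃ F, (IsProperFace P₁ F ∧ Isothetic Q₁ G P₁ F) ∨ (IsProperFace P₂ F ∧ Isothetic Q₁ G P₂ F)) ∧
  (∀ G, IsProperFace Q₂ G →
    ∃ F, (IsProperFace P₁ F ∧ Isothetic Q₂ G P₁ F) ∨ (IsProperFace P₂ F ∧ Isothetic Q₂ G P₂ F))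

open scoped InnerProductSpace

section

/-- Euclidean three-space. -/
abbrev E3 := EuclideanSpace ℝ (Fin 3)

/-- support function of a finite set -/
noncomputable def hs (V : Finset E3) (w : E3) : ℝ :=
  if h : V.Nonempty then V.sup' h (fun v => ⟪w, v⟫_ℝ) else 0

/-- face of a finite set in direction `w` -/
noncomputable def fc (V : Finset E3) (w : E3) : Finset E3 :=
  V.filter (fun v => ⟪w, v⟫_ℝ = hs V w)

lemma le_hs {V : Finset E3} {v : E3} (hv : v ∈ V) (w : E3) : ⟪w, v⟫_ℝ ≤ hs V w := by
  have h : V.Nonempty := ⟨v, hv⟩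
  rw [hs, dif_pos h]
  exact Finset.le_sup' (fun v => ⟪w, v⟫_ℝ) hv

lemma exists_hs {V : Finset E3} (h : V.Nonempty) (w : E3) : ∃ v ∈ V, ⟪w, v⟫_ℝ = hs V w := by
  rw [hs, dif_pos h]
  obtain ⟨v, hv, e⟩ := Finset.exists_mem_eq_sup' h (fun v => ⟪w, v⟫_ℝ)
  exact ⟨v, hv, e.symm⟩

lemma hs_le {V : Finset E3} (h : V.Nonempty) {w : E3} {r : ℝ} (hr : ∀ v ∈ V, ⟪w, v⟫_ℝ ≤ r) :
    hs V w ≤ r := by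
  obtain ⟨v, hv, e⟩ := exists_hs h w
  rw [← e]; exact hr v hv

lemma hs_eq {V : Finset E3} {w : E3} {r : ℝ} (hr : ∀ v ∈ V, ⟪w, v⟫_ℝ ≤ r)
    {v : E3} (hv : v ∈ V) (e : ⟪w, v⟫_ℝ = r) : hs V w = r :=
  le_antisymm (hs_le ⟨v, hv⟩ hr) (e ▸ le_hs hv w)

lemma mem_fc {V : Finset E3} {w v : E3} : v ∈ fc V w ↔ v ∈ V ∧ ⟪w, v⟫_ℝ = hs V w := by
  simp [fc]

lemma fc_subset (V : Finset E3) (w : E3) : fc V w ⊆ V := Finset.filter_subset _ _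

lemma fc_nonempty {V : Finset E3} (h : V.Nonempty) (w : E3) : (fc V w).Nonempty := by
  obtain ⟨v, hv, e⟩ := exists_hs h w
  exact ⟨v, mem_fc.2 ⟨hv, e⟩⟩

lemma hs_smul {V : Finset E3} (h : V.Nonempty) {t : ℝ} (ht : 0 < t) (w : E3) :
    hs V (t • w) = t * hs V w := by
  obtain ⟨v, hv, e⟩ := exists_hs h w
  refine hs_eq (fun x hx => ?_) hv ?_
  · rw [real_inner_smul_left]; exact mul_le_mul_of_nonneg_left (le_hs hx w) ht.le
  · rw [real_inner_smul_left, e]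

lemma fc_smul {V : Finset E3} (h : V.Nonempty) {t : ℝ} (ht : 0 < t) (w : E3) :
    fc V (t • w) = fc V w := by
  ext v
  rw [mem_fc, mem_fc, hs_smul h ht, real_inner_smul_left]
  simp [ht.ne']

lemma hs_zero (V : Finset E3) : hs V 0 = 0 := by
  by_cases h : V.Nonempty
  · obtain ⟨v, hv, e⟩ := exists_hs h 0
    rw [← e]; simp
  · simp [hs, h]

lemma hs_mono {V W : Finset E3} (h : V.Nonempty) (hVW : V ⊆ W) (w : E3) : hs V w ≤ hs W w :=
  hs_le h fun _ hv => le_hs (hVW hv) w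

/-- if `w` is constant on V -/
lemma hs_const {V : Finset E3} {w v : E3} (hv : v ∈ V) (hc : ∀ x ∈ V, ⟪w, x⟫_ℝ = ⟪w, v⟫_ℝ) :
    hs V w = ⟪w, v⟫_ℝ := hs_eq (fun x hx => (hc x hx).le) hv rfl

lemma fc_const {V : Finset E3} {w : E3} (hc : ∀ x ∈ V, ∀ y ∈ V, ⟪w, x⟫_ℝ = ⟪w, y⟫_ℝ) :
    fc V w = V := by
  ext v
  rw [mem_fc]
  refine ⟨fun h => h.1, fun h => ⟨h, (hs_const h fun x hx => hc x hx v h).symm⟩⟩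

/-- adding a direction constant on V -/
lemma hs_add_const {V : Finset E3} (h : V.Nonempty) {z v : E3} (hv : v ∈ V)
    (hc : ∀ x ∈ V, ⟪z, x⟫_ℝ = ⟪z, v⟫_ℝ) (w : E3) : hs V (z + w) = ⟪z, v⟫_ℝ + hs V w := by
  obtain ⟨u, hu, e⟩ := exists_hs h w
  refine hs_eq (fun x hx => ?_) hu ?_
  · rw [inner_add_left, hc x hx]; linarith [le_hs hx w]
  · rw [inner_add_left, hc u hu, e]

lemma fc_add_const {V : Finset E3} {z : E3}
    (hc : ∀ x ∈ V, ∀ y ∈ V, ⟪z, x⟫_ℝ = ⟪z, y⟫_ℝ) (w : E3) : fc V (z + w) = fc V w := by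
  ext v
  rw [mem_fc, mem_fc]
  refine and_congr_right fun hv => ?_
  rw [hs_add_const ⟨v, hv⟩ hv (fun x hx => hc x hx v hv) w, inner_add_left]
  constructor <;> intro h <;> linarith

lemma hs_continuous (V : Finset E3) : Continuous (hs V) := by
  by_cases h : V.Nonempty
  · have : hs V = fun w => V.sup' h (fun v => ⟪w, v⟫_ℝ) := by
      funext w; rw [hs, dif_pos h]
    rw [this]
    apply Continuous.finset_sup'_apply
    intro v _; fun_prop
  · have : hs V = fun _ => 0 := by
      funext w; rw [hs, dif_neg h]
    rw [this]; exact continuous_const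

/-- the local structure of support functions -/
lemma hs_local {V : Finset E3} (h : V.Nonempty) (w : E3) :
    ∃ δ > 0, ∀ η : E3, ‖η‖ < δ → hs V (w + η) = hs V w + hs (fc V w) η ∧
      fc V (w + η) = fc (fc V w) η := by
  have key : ∃ δ > 0, ∀ η : E3, ‖η‖ < δ → ∀ v ∈ V, v ∉ fc V w →
      ⟪w + η, v⟫_ℝ < hs V w + hs (fc V w) η := by
    have h1 : ∀ v ∈ V, v ∉ fc V w → ∀ᶠ η : E3 in nhds 0,
        ⟪w + η, v⟫_ℝ < hs V w + hs (fc V w) η := by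
      intro v hv hv'
      have hlt : ⟪w + 0, v⟫_ℝ < hs V w + hs (fc V w) 0 := by
        rw [hs_zero, add_zero, add_zero]
        refine lt_of_le_of_ne (le_hs hv w) fun e => hv' (mem_fc.2 ⟨hv, e⟩)
      have c1 : Continuous fun η : E3 => ⟪w + η, v⟫_ℝ := by fun_prop
      have c2 : Continuous fun η : E3 => hs V w + hs (fc V w) η :=
        continuous_const.add (hs_continuous _)
      exact c1.continuousAt.eventually_lt c2.continuousAt hlt
    have h2 : ∀ᶠ η : E3 in nhds 0, ∀ v ∈ V, v ∉ fc V w →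
        ⟪w + η, v⟫_ℝ < hs V w + hs (fc V w) η := by
      rw [Filter.eventually_all_finset]
      intro v hv
      by_cases hv' : v ∈ fc V w
      · exact Filter.Eventually.of_forall fun _ hn => absurd hv' hn
      · filter_upwards [h1 v hv hv'] with η hη _ using hη
    obtain ⟨δ, hδ, H⟩ := Metric.eventually_nhds_iff.1 h2
    exact ⟨δ, hδ, fun η hη => H (by simpa using hη)⟩
  obtain ⟨δ, hδ, H⟩ := key
  refine ⟨δ, hδ, fun η hη => ?_⟩
  have e1 : hs V (w + η) = hs V w + hs (fc V w) η := by
    obtain ⟨u, hu, e⟩ := exists_hs (fc_nonempty h w) η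
    refine hs_eq (fun x hx => ?_) (fc_subset _ _ hu) ?_
    · by_cases hx' : x ∈ fc V w
      · rw [inner_add_left, (mem_fc.1 hx').2]; linarith [le_hs hx' η]
      · exact (H η hη x hx hx').le
    · rw [inner_add_left, (mem_fc.1 hu).2, e]
  refine ⟨e1, ?_⟩
  ext v
  rw [mem_fc, mem_fc, e1]
  constructor
  · rintro ⟨hv, e⟩
    by_cases hv' : v ∈ fc V w
    · refine ⟨hv', ?_⟩
      rw [inner_add_left, (mem_fc.1 hv').2] at e; linarith
    · exact absurd e (H η hη v hv hv').ne
  · rintro ⟨hv, e⟩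
    refine ⟨fc_subset _ _ hv, ?_⟩
    rw [inner_add_left, (mem_fc.1 hv).2, e]

/-- local affinity at a point -/
def LocAff (f : E3 → ℝ) (w : E3) : Prop :=
  ∃ c : E3, ∃ δ > 0, ∀ η : E3, ‖η‖ < δ → f (w + η) = f w + ⟪c, η⟫_ℝ

lemma inner_small_eq {c c' : E3} {δ : ℝ} (hδ : 0 < δ)
    (h : ∀ η : E3, ‖η‖ < δ → ⟪c, η⟫_ℝ = ⟪c', η⟫_ℝ) : c = c' := by
  have h3 : ∀ v : E3, ⟪c, v⟫_ℝ = ⟪c', v⟫_ℝ := by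
    intro v
    have hp : 0 < δ / (‖v‖ + 1) := by positivity
    have := h ((δ / (‖v‖ + 1)) • v) (by
      rw [norm_smul, Real.norm_eq_abs, abs_of_pos hp, div_mul_eq_mul_div, div_lt_iff₀ (by positivity)]
      nlinarith [norm_nonneg v])
    rw [real_inner_smul_right, real_inner_smul_right] at this
    exact mul_left_cancel₀ hp.ne' this
  exact ext_inner_right ℝ h3

/-- a positively homogeneous function that is locally affine on a connected open set is linear
there -/
lemma locAff_linear {f : E3 → ℝ} {U : Set E3} (hU : IsPreconnected U) (hUo : IsOpen U)
    (hf : ∀ w ∈ U, LocAff f w) (hh : ∀ (t : ℝ) (w : E3), 0 < t → f (t • w) = t * f w) :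
    ∃ c : E3, ∀ w ∈ U, f w = ⟪c, w⟫_ℝ := by
  classical
  rcases U.eq_empty_or_nonempty with rfl | ⟨w0, hw0⟩
  · exact ⟨0, by simp⟩
  choose! c δ hδ H using hf
  have step : ∀ w ∈ U, ∀ z, ‖z‖ < δ w → w + z ∈ U → c (w + z) = c w := by
    intro w hw z hz hwz
    have hpos : 0 < min (δ (w + z)) (δ w - ‖z‖) := lt_min (hδ _ hwz) (by linarith)
    refine inner_small_eq hpos fun η hη => ?_
    have h1 := H _ hwz η (lt_of_lt_of_le hη (min_le_left _ _))
    have h2 := H _ hw (z + η) (by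
      have := lt_of_lt_of_le hη (min_le_right (δ (w + z)) (δ w - ‖z‖))
      linarith [norm_add_le z η])
    have h3 := H _ hw z hz
    rw [← add_assoc, h1, h3, inner_add_right] at h2
    linarith
  have opn : ∀ p : E3 → Prop, IsOpen {w | w ∈ U ∧ p (c w)} := by
    intro p
    rw [Metric.isOpen_iff]
    rintro w ⟨hw, hp⟩
    obtain ⟨r, hr, hrU⟩ := Metric.isOpen_iff.1 hUo w hw
    refine ⟨min r (δ w), lt_min hr (hδ w hw), fun x hx => ?_⟩
    have hx' : dist x w < min r (δ w) := hx
    have hxU : x ∈ U := hrU (lt_of_lt_of_le hx' (min_le_left _ _))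
    have e : x = w + (x - w) := by abel
    have hxc : c x = c w := by
      rw [e]
      refine step w hw _ ?_ (by rwa [← e])
      rw [← dist_eq_norm]; exact lt_of_lt_of_le hx' (min_le_right _ _)
    exact ⟨hxU, by rw [hxc]; exact hp⟩
  have hsub : U ⊆ {w | w ∈ U ∧ c w = c w0} := by
    refine hU.subset_left_of_subset_union (opn (fun x => x = c w0)) (opn (fun x => x ≠ c w0)) ?_ ?_
      ⟨w0, hw0, hw0, rfl⟩
    · rw [Set.disjoint_left]; rintro x ⟨_, h1⟩ ⟨_, h2⟩; exact h2 h1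
    · intro x hx
      by_cases h : c x = c w0
      · exact Or.inl ⟨hx, h⟩
      · exact Or.inr ⟨hx, h⟩
  refine ⟨c w0, fun w hw => ?_⟩
  have hc : c w = c w0 := (hsub hw).2
  set s : ℝ := δ w / (2 * (‖w‖ + 1)) with hs
  have hspos : 0 < s := by have := hδ w hw; positivity
  have hsm : ‖s • w‖ < δ w := by
    rw [norm_smul, Real.norm_eq_abs, abs_of_pos hspos, hs, div_mul_eq_mul_div,
      div_lt_iff₀ (by positivity)]
    have := hδ w hw
    nlinarith [norm_nonneg w]
  have h1 := H w hw _ hsm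
  have e : w + s • w = (1 + s) • w := by rw [add_smul, one_smul]
  rw [e, hh _ _ (by linarith), real_inner_smul_right, hc] at h1
  have : s * f w = s * ⟪c w0, w⟫_ℝ := by linarith
  exact mul_left_cancel₀ hspos.ne' this

end

section

/-- orthonormal triples -/
structure ON (n b a : E3) : Prop where
  n1 : ⟪n, n⟫_ℝ = 1
  b1 : ⟪b, b⟫_ℝ = 1
  a1 : ⟪a, a⟫_ℝ = 1
  nb : ⟪n, b⟫_ℝ = 0
  na : ⟪n, a⟫_ℝ = 0
  ba : ⟪b, a⟫_ℝ = 0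

namespace ON
variable {n b a : E3}
lemma bn (h : ON n b a) : ⟪b, n⟫_ℝ = 0 := by rw [real_inner_comm]; exact h.nb
lemma an (h : ON n b a) : ⟪a, n⟫_ℝ = 0 := by rw [real_inner_comm]; exact h.na
lemma ab (h : ON n b a) : ⟪a, b⟫_ℝ = 0 := by rw [real_inner_comm]; exact h.ba

lemma orthonormal (h : ON n b a) : Orthonormal ℝ ![n, b, a] := by
  rw [orthonormal_iff_ite]
  intro i j
  fin_cases i <;> fin_cases j
  · exact h.n1
  · exact h.nb
  · exact h.na
  · exact h.bn
  · exact h.b1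
  · exact h.ba
  · exact h.an
  · exact h.ab
  · exact h.a1

lemma expand (h : ON n b a) (v : E3) : v = ⟪n, v⟫_ℝ • n + ⟪b, v⟫_ℝ • b + ⟪a, v⟫_ℝ • a := by
  have hb := h.orthonormal
  let B := OrthonormalBasis.mk hb (by
    have := (basisOfOrthonormalOfCardEqFinrank hb (by simp)).span_eq
    rw [coe_basisOfOrthonormalOfCardEqFinrank] at this
    exact this.ge)
  have := B.sum_repr v
  simp only [Fin.sum_univ_three, B.repr_apply_apply] at this
  simp [B] at this
  exact this.symm

lemma negnb (h : ON n b a) : ON (-n) (-b) a := by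
  constructor <;> simp only [inner_neg_left, inner_neg_right, neg_neg, neg_zero, h.n1, h.b1, h.a1, h.nb, h.na, h.ba]

lemma negb (h : ON n b a) : ON n (-b) a := by
  constructor <;> simp only [inner_neg_left, inner_neg_right, neg_neg, neg_zero, h.n1, h.b1, h.a1, h.nb, h.na, h.ba]

lemma nega (h : ON n b a) : ON n b (-a) := by
  constructor <;> simp only [inner_neg_left, inner_neg_right, neg_neg, neg_zero, h.n1, h.b1, h.a1, h.nb, h.na, h.ba]

lemma swap (h : ON n b a) : ON n a b := ⟨h.n1, h.a1, h.b1, h.na, h.nb, h.ab⟩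

lemma rot (h : ON n b a) (t : ℝ) :
    ON (Real.cos t • n + Real.sin t • b) (-Real.sin t • n + Real.cos t • b) a := by
  have hsc := Real.sin_sq_add_cos_sq t
  constructor <;> simp only [inner_add_left, inner_add_right, real_inner_smul_left,
    real_inner_smul_right, h.n1, h.b1, h.a1, h.nb, h.na, h.ba, h.bn] <;> nlinarith
end ON

lemma exists_on {n w : E3} (hn : ⟪n, n⟫_ℝ = 1) (hw : ∀ t : ℝ, w ≠ t • n) :
    ∃ b a : E3, ∃ β : ℝ, ON n b a ∧ 0 < β ∧ w = ⟪n, w⟫_ℝ • n + β • b := by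
  set z := w - ⟪n, w⟫_ℝ • n with hz
  have hz0 : z ≠ 0 := fun h => hw _ (sub_eq_zero.1 h)
  have hzn : 0 < ‖z‖ := norm_pos_iff.2 hz0
  have hnz : ⟪n, z⟫_ℝ = 0 := by
    rw [hz, inner_sub_right, real_inner_smul_right, hn]; ring
  set b := (‖z‖)⁻¹ • z with hb
  have hb1 : ⟪b, b⟫_ℝ = 1 := by
    rw [hb, real_inner_smul_left, real_inner_smul_right, real_inner_self_eq_norm_sq]; field_simp
  have hnb : ⟪n, b⟫_ℝ = 0 := by rw [hb, real_inner_smul_right, hnz, mul_zero]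
  obtain ⟨y, hy, hy0⟩ : ∃ y ∈ (Submodule.span ℝ {n, b})ᗮ, y ≠ 0 := by
    apply Submodule.exists_mem_ne_zero_of_ne_bot
    intro hbot
    have h1 := Submodule.finrank_add_finrank_orthogonal (Submodule.span ℝ ({n, b} : Set E3))
    rw [hbot] at h1
    have h2 : Module.finrank ℝ (Submodule.span ℝ ({n, b} : Set E3)) ≤ 2 := by
      classical
      have := finrank_span_finset_le_card (R := ℝ) ({n, b} : Finset E3)
      rw [Finset.coe_pair] at this
      exact this.trans Finset.card_le_two
    simp at h1
    omega
  have hyn : ⟪n, y⟫_ℝ = 0 := hy n (Submodule.subset_span (by simp))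
  have hyb : ⟪b, y⟫_ℝ = 0 := hy b (Submodule.subset_span (by simp))
  have hyp : 0 < ‖y‖ := norm_pos_iff.2 hy0
  refine ⟨b, (‖y‖)⁻¹ • y, ‖z‖, ⟨hn, hb1, ?_, hnb, ?_, ?_⟩, hzn, ?_⟩
  · rw [real_inner_smul_left, real_inner_smul_right, real_inner_self_eq_norm_sq]; field_simp
  · rw [real_inner_smul_right, hyn, mul_zero]
  · rw [real_inner_smul_right, hyb, mul_zero]
  · rw [hb, smul_smul, mul_inv_cancel₀ hzn.ne', one_smul, hz]; abel

/-- width -/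
noncomputable def wd (a : E3) (V : Finset E3) : ℝ := hs V a + hs V (-a)

lemma wd_neg (a : E3) (V : Finset E3) : wd (-a) V = wd a V := by simp [wd, add_comm]

lemma wd_nonneg {a : E3} {V : Finset E3} (h : V.Nonempty) : 0 ≤ wd a V := by
  obtain ⟨v, hv⟩ := h
  have h1 := le_hs hv a
  have h2 := le_hs hv (-a)
  rw [inner_neg_left] at h2
  unfold wd; linarith

lemma wd_eq_zero {a : E3} {V : Finset E3} (h : V.Nonempty) :
    wd a V = 0 ↔ ∀ x ∈ V, ∀ y ∈ V, ⟪a, x⟫_ℝ = ⟪a, y⟫_ℝ := by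
  constructor
  · intro h0
    have key : ∀ x ∈ V, ⟪a, x⟫_ℝ = hs V a := by
      intro x hx
      have h1 := le_hs hx a
      have h2 := le_hs hx (-a)
      rw [inner_neg_left] at h2
      unfold wd at h0; linarith
    intro x hx y hy; rw [key x hx, key y hy]
  · intro hc
    obtain ⟨v, hv⟩ := h
    rw [wd, hs_const hv fun x hx => hc x hx v hv, hs_const hv, inner_neg_left]
    · ring
    · intro x hx; rw [inner_neg_left, inner_neg_left, hc x hx v hv]

/-- a set is planar, orthogonal to n -/
def Planar (n : E3) (V : Finset E3) : Prop := ∀ x ∈ V, ∀ y ∈ V, ⟪n, x⟫_ℝ = ⟪n, y⟫_ℝ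

lemma planar_fc (n : E3) (V : Finset E3) : Planar n (fc V n) := fun x hx y hy => by
  rw [(mem_fc.1 hx).2, (mem_fc.1 hy).2]

lemma Planar.mono {n : E3} {V W : Finset E3} (h : Planar n W) (hV : V ⊆ W) : Planar n V :=
  fun x hx y hy => h x (hV hx) y (hV hy)

lemma Planar.neg {n : E3} {V : Finset E3} (h : Planar n V) : Planar (-n) V :=
  fun x hx y hy => by rw [inner_neg_left, inner_neg_left, h x hx y hy]

/-- support function of a segment -/
lemma hs_segment {n b a : E3} (h : ON n b a) {V : Finset E3} (hV : V.Nonempty)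
    (h1 : Planar n V) (h2 : Planar b V) :
    ∃ c : E3, ∀ η : E3, hs V η = ⟪c, η⟫_ℝ + wd a V / 2 * |⟪a, η⟫_ℝ| := by
  obtain ⟨v, hv⟩ := id hV
  have key : ∀ x ∈ V, ∀ η, ⟪η, x⟫_ℝ = ⟪η, v⟫_ℝ + (⟪a, x⟫_ℝ - ⟪a, v⟫_ℝ) * ⟪a, η⟫_ℝ := by
    intro x hx η
    have e : x - v = (⟪a, x⟫_ℝ - ⟪a, v⟫_ℝ) • a := by
      have := h.expand (x - v)
      rwa [inner_sub_right, inner_sub_right, inner_sub_right, h1 x hx v hv, h2 x hx v hv, sub_self,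
        sub_self, zero_smul, zero_smul, zero_add, zero_add] at this
    have e2 : ⟪η, x - v⟫_ℝ = (⟪a, x⟫_ℝ - ⟪a, v⟫_ℝ) * ⟪a, η⟫_ℝ := by
      rw [e, real_inner_smul_right, real_inner_comm η a]
    rw [inner_sub_right] at e2; linarith
  obtain ⟨p, hp, ep⟩ := exists_hs hV a
  obtain ⟨q, hq, eq⟩ := exists_hs hV (-a)
  have hpm : ∀ x ∈ V, ⟪a, x⟫_ℝ ≤ ⟪a, p⟫_ℝ := fun x hx => ep ▸ le_hs hx a
  have hqm : ∀ x ∈ V, ⟪a, q⟫_ℝ ≤ ⟪a, x⟫_ℝ := fun x hx => by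
    have := le_hs hx (-a)
    rw [← eq, inner_neg_left, inner_neg_left] at this; linarith
  refine ⟨(1 / 2 : ℝ) • (p + q), fun η => ?_⟩
  have ew : wd a V = ⟪a, p⟫_ℝ - ⟪a, q⟫_ℝ := by
    rw [wd, ← ep, ← eq, inner_neg_left]; ring
  rw [ew, real_inner_smul_left, inner_add_left, real_inner_comm η p, real_inner_comm η q]
  have kp := key p hp η
  have kq := key q hq η
  rcases le_total 0 ⟪a, η⟫_ℝ with h0 | h0
  · rw [abs_of_nonneg h0]
    refine hs_eq (v := p) (fun x hx => ?_) hp ?_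
    · rw [key x hx, kp, kq]
      nlinarith [mul_nonneg (sub_nonneg.2 (hpm x hx)) h0]
    · rw [kp, kq]; ring
  · rw [abs_of_nonpos h0]
    refine hs_eq (v := q) (fun x hx => ?_) hq ?_
    · rw [key x hx, kp, kq]
      nlinarith [mul_nonneg (sub_nonneg.2 (hqm x hx)) (neg_nonneg.2 h0)]
    · rw [kp, kq]; ring

lemma fc_dir {n b : E3} {V : Finset E3} (hV : V.Nonempty) (hp : Planar n V) (α : ℝ) {β : ℝ}
    (hβ : 0 < β) : fc V (α • n + β • b) = fc V b := by
  rw [fc_add_const, fc_smul hV hβ]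
  intro x hx y hy
  rw [real_inner_smul_left, real_inner_smul_left, hp x hx y hy]

/-- local affinity of the difference from equality of edge lengths -/
lemma locAff_of_wd {n b a w : E3} (h : ON n b a) {V V' : Finset E3} (hV : V.Nonempty)
    (hV' : V'.Nonempty) (hp : Planar n V) (hp' : Planar n V') {α β : ℝ} (hβ : 0 < β)
    (hw : w = α • n + β • b) (hwd : wd a (fc V b) = wd a (fc V' (-b))) :
    LocAff (fun η => hs V η - hs V' (-η)) w := by
  obtain ⟨δ, hδ, H⟩ := hs_local hV w
  obtain ⟨δ', hδ', H'⟩ := hs_local hV' (-w)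
  obtain ⟨c, hc⟩ := hs_segment h (fc_nonempty hV b) (hp.mono (fc_subset _ _)) (planar_fc b V)
  obtain ⟨c', hc'⟩ := hs_segment h.negb (fc_nonempty hV' (-b)) (hp'.mono (fc_subset _ _))
    (planar_fc (-b) V')
  have e1 : fc V w = fc V b := by rw [hw, fc_dir hV hp α hβ]
  have e2 : fc V' (-w) = fc V' (-b) := by
    have : -w = (-α) • n + β • (-b) := by rw [hw]; module
    rw [this, fc_dir hV' hp' _ hβ]
  refine ⟨c + c', min δ δ', lt_min hδ hδ', fun η hη => ?_⟩
  have h1 := (H η (lt_of_lt_of_le hη (min_le_left _ _))).1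
  have h2 := (H' (-η) (by rw [norm_neg]; exact lt_of_lt_of_le hη (min_le_right _ _))).1
  rw [e1, hc] at h1
  rw [e2, hc'] at h2
  have e3 : -(w + η) = -w + -η := by abel
  simp only []
  rw [h1, e3, h2, inner_add_left, inner_neg_right, inner_neg_right, abs_neg, hwd]
  ring

/-- centrally symmetric, in terms of support functions -/
def CSym (V : Finset E3) : Prop := ∃ c : E3, ∀ η : E3, hs V η - hs V (-η) = ⟪c, η⟫_ℝ

lemma wd_of_sym {n b a : E3} (h : ON n b a) {V : Finset E3} (hV : V.Nonempty)
    (hp : Planar n V) (hs' : CSym V) : wd a (fc V b) = wd a (fc V (-b)) := by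
  obtain ⟨δ, hδ, H⟩ := hs_local hV b
  obtain ⟨δ', hδ', H'⟩ := hs_local hV (-b)
  obtain ⟨c, hc⟩ := hs_segment h (fc_nonempty hV b) (hp.mono (fc_subset _ _)) (planar_fc b V)
  obtain ⟨c', hc'⟩ := hs_segment h.negb (fc_nonempty hV (-b)) (hp.mono (fc_subset _ _))
    (planar_fc (-b) V)
  obtain ⟨d, hd⟩ := hs'
  set t := min δ δ' / 2 with ht
  have htp : 0 < t := by have := lt_min hδ hδ'; positivity
  have han : ‖a‖ = 1 := by
    have := h.a1; rw [real_inner_self_eq_norm_sq] at this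
    nlinarith [norm_nonneg a]
  have key : ∀ s : ℝ, |s| = t → ⟪d, s • a⟫_ℝ = ⟪c, s • a⟫_ℝ + ⟪c', s • a⟫_ℝ +
      (wd a (fc V b) - wd a (fc V (-b))) / 2 * t := by
    intro s hs
    have hn : ‖s • a‖ < min δ δ' := by
      rw [norm_smul, han, Real.norm_eq_abs, hs, mul_one]; rw [ht]; linarith [lt_min hδ hδ']
    have h1 := (H (s • a) (lt_of_lt_of_le hn (min_le_left _ _))).1
    have h2 := (H' (-(s • a)) (by rw [norm_neg]; exact lt_of_lt_of_le hn (min_le_right _ _))).1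
    have h3 := hd (b + s • a)
    have h4 := hd b
    have e3 : -(b + s • a) = -b + -(s • a) := by abel
    rw [e3, h1, h2, hc, hc', inner_neg_right, inner_neg_right, abs_neg, inner_add_right] at h3
    have ea : |⟪a, s • a⟫_ℝ| = t := by rw [real_inner_smul_right, h.a1, mul_one, hs]
    rw [ea] at h3
    linarith
  have k1 := key t (abs_of_pos htp)
  have k2 := key (-t) (by rw [abs_neg]; exact abs_of_pos htp)
  rw [neg_smul, inner_neg_right, inner_neg_right, inner_neg_right] at k2
  have : (wd a (fc V b) - wd a (fc V (-b))) * t = 0 := by linarith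
  rcases mul_eq_zero.1 this with h0 | h0
  · linarith
  · exact absurd h0 htp.ne'

end

section

lemma locAff_of_planar {n : E3} (hn : ⟪n, n⟫_ℝ = 1) {V V' : Finset E3} (hV : V.Nonempty)
    (hV' : V'.Nonempty) (hp : Planar n V) (hp' : Planar n V') {w : E3} (hw : ∀ t : ℝ, w ≠ t • n)
    (H : ∀ b a : E3, ON n b a → (∃ β : ℝ, 0 < β ∧ w = ⟪n, w⟫_ℝ • n + β • b) →
      wd a (fc V b) = wd a (fc V' (-b))) :
    LocAff (fun η => hs V η - hs V' (-η)) w := by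
  obtain ⟨b, a, β, h, hβ, e⟩ := exists_on hn hw
  exact locAff_of_wd h hV hV' hp hp' hβ e (H b a h ⟨β, hβ, e⟩)

lemma diff_homog {V V' : Finset E3} (hV : V.Nonempty) (hV' : V'.Nonempty) (t : ℝ) (w : E3)
    (ht : 0 < t) : hs V (t • w) - hs V' (-(t • w)) = t * (hs V w - hs V' (-w)) := by
  rw [← smul_neg, hs_smul hV ht, hs_smul hV' ht]; ring

lemma diff_cont (V V' : Finset E3) : Continuous fun η => hs V η - hs V' (-η) :=
  (hs_continuous V).sub ((hs_continuous V').comp continuous_neg)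

/-- passing to the closure of an open cone -/
lemma closure_cone {f : E3 → ℝ} (hf : Continuous f) {c z w : E3}
    (h : ∀ s : ℝ, 0 < s → f (w + s • z) = ⟪c, w + s • z⟫_ℝ) : f w = ⟪c, w⟫_ℝ := by
  have c1 : Filter.Tendsto (fun s : ℝ => f (w + s • z)) (nhdsWithin 0 (Set.Ioi 0)) (nhds (f w)) := by
    have : Continuous fun s : ℝ => f (w + s • z) := by fun_prop
    have := this.tendsto 0
    simp only [zero_smul, add_zero] at this
    exact this.mono_left nhdsWithin_le_nhds
  have c2 : Filter.Tendsto (fun s : ℝ => ⟪c, w + s • z⟫_ℝ) (nhdsWithin 0 (Set.Ioi 0))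
      (nhds ⟪c, w⟫_ℝ) := by
    have : Continuous fun s : ℝ => ⟪c, w + s • z⟫_ℝ := by fun_prop
    have := this.tendsto 0
    simp only [zero_smul, add_zero] at this
    exact this.mono_left nhdsWithin_le_nhds
  refine tendsto_nhds_unique c1 (c2.congr' ?_)
  filter_upwards [self_mem_nhdsWithin] with s hs using (h s hs).symm

lemma planar_sym_core {n : E3} (hn : ⟪n, n⟫_ℝ = 1) {V : Finset E3} (hV : V.Nonempty)
    (hp : Planar n V) {p1 p2 z1 z2 : E3} (hp1 : ⟪n, p1⟫_ℝ = 0) (hp2 : ⟪n, p2⟫_ℝ = 0)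
    (h11 : ⟪p1, z1⟫_ℝ = 0) (h21 : ⟪p2, z1⟫_ℝ = 1) (h12 : ⟪p1, z2⟫_ℝ = 1) (h22 : ⟪p2, z2⟫_ℝ = 0)
    (H : ∀ b a : E3, ON n b a → ⟪p1, b⟫_ℝ ≠ 0 → ⟪p2, b⟫_ℝ ≠ 0 →
      wd a (fc V b) = wd a (fc V (-b))) : CSym V := by
  set f : E3 → ℝ := fun η => hs V η - hs V (-η) with hf
  have hodd : ∀ η, f (-η) = - f η := by intro η; simp only [hf, neg_neg]; ring
  have hcont : Continuous f := diff_cont V V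
  have hLA : ∀ w, ⟪p1, w⟫_ℝ ≠ 0 → ⟪p2, w⟫_ℝ ≠ 0 → LocAff f w := by
    intro w hw1 hw2
    apply locAff_of_planar hn hV hV hp hp
    · rintro t rfl; rw [real_inner_smul_right, real_inner_comm, hp1, mul_zero] at hw1
      exact hw1 rfl
    · rintro b a h ⟨β, hβ, e⟩
      apply H b a h
      · intro h0; apply hw1
        rw [e, inner_add_right, real_inner_smul_right, real_inner_smul_right, real_inner_comm n p1, hp1,
          h0]; ring
      · intro h0; apply hw2
        rw [e, inner_add_right, real_inner_smul_right, real_inner_smul_right, real_inner_comm n p2, hp2,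
          h0]; ring
  -- quadrant
  have quad : ∀ (s : ℝ), s ≠ 0 → ∃ c : E3, ∀ w, 0 ≤ ⟪p1, w⟫_ℝ → 0 ≤ s * ⟪p2, w⟫_ℝ →
      f w = ⟪c, w⟫_ℝ := by
    intro s hs
    have hconv : Convex ℝ {w : E3 | 0 < ⟪p1, w⟫_ℝ ∧ 0 < s * ⟪p2, w⟫_ℝ} := by
      intro x hx y hy α β hα hβ hαβ
      simp only [Set.mem_setOf_eq, inner_add_right, real_inner_smul_right] at hx hy ⊢
      have hco : ∀ {A B : ℝ}, 0 < A → 0 < B → 0 < α * A + β * B := by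
        intro A B hA hB
        rcases hα.eq_or_lt with h | h
        · have : β = 1 := by linarith
          rw [← h, this]; linarith
        · have := mul_pos h hA
          have := mul_nonneg hβ hB.le
          linarith
      refine ⟨hco hx.1 hy.1, ?_⟩
      have := hco hx.2 hy.2
      linarith
    have hopen : IsOpen {w : E3 | 0 < ⟪p1, w⟫_ℝ ∧ 0 < s * ⟪p2, w⟫_ℝ} := by
      have c1 : Continuous fun w : E3 => ⟪p1, w⟫_ℝ := by fun_prop
      have c2 : Continuous fun w : E3 => s * ⟪p2, w⟫_ℝ := by fun_prop
      exact (isOpen_lt continuous_const c1).inter (isOpen_lt continuous_const c2)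
    obtain ⟨c, hc⟩ := locAff_linear hconv.isPreconnected hopen (fun w hw => hLA w hw.1.ne' (by
      intro h; simp [h] at hw)) (fun t w ht => diff_homog hV hV t w ht)
    refine ⟨c, fun w h1 h2 => ?_⟩
    apply closure_cone hcont (z := z2 + s • z1)
    intro t ht
    apply hc
    have hs2 : 0 < s * s := mul_self_pos.2 hs
    simp only [Set.mem_setOf_eq, inner_add_right, real_inner_smul_right, h11, h12, h21, h22]
    constructor
    · linarith
    · nlinarith [mul_pos ht hs2]
  obtain ⟨c, hc⟩ := quad 1 one_ne_zero
  obtain ⟨d, hd⟩ := quad (-1) (by norm_num)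
  simp only [one_mul, neg_one_mul, Left.nonneg_neg_iff] at hc hd
  have hc' : ∀ w, ⟪p1, w⟫_ℝ ≤ 0 → ⟪p2, w⟫_ℝ ≤ 0 → f w = ⟪c, w⟫_ℝ := by
    intro w h1 h2
    have := hc (-w) (by rw [inner_neg_right]; linarith) (by rw [inner_neg_right]; linarith)
    rw [hodd, inner_neg_right] at this; linarith
  have hd' : ∀ w, ⟪p1, w⟫_ℝ ≤ 0 → 0 ≤ ⟪p2, w⟫_ℝ → f w = ⟪d, w⟫_ℝ := by
    intro w h1 h2
    have := hd (-w) (by rw [inner_neg_right]; linarith) (by rw [inner_neg_right]; linarith)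
    rw [hodd, inner_neg_right] at this; linarith
  have k1 : ∀ w, ⟪p1, w⟫_ℝ = 0 → ⟪c, w⟫_ℝ = ⟪d, w⟫_ℝ := by
    intro w h
    rcases le_total 0 ⟪p2, w⟫_ℝ with h2 | h2
    · rw [← hc w h.ge h2, ← hd' w h.le h2]
    · rw [← hc' w h.le h2, ← hd w h.ge h2]
  have k2 : ∀ w, ⟪p2, w⟫_ℝ = 0 → ⟪c, w⟫_ℝ = ⟪d, w⟫_ℝ := by
    intro w h
    rcases le_total 0 ⟪p1, w⟫_ℝ with h2 | h2
    · rw [← hc w h2 h.ge, ← hd w h2 h.le]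
    · rw [← hc' w h2 h.le, ← hd' w h2 h.ge]
  have k : ∀ w, ⟪c, w⟫_ℝ = ⟪d, w⟫_ℝ := by
    intro w
    have e : w = ⟪p2, w⟫_ℝ • z1 + (w - ⟪p2, w⟫_ℝ • z1) := by abel
    rw [e, inner_add_right, inner_add_right, k1 _ (by rw [real_inner_smul_right, h11, mul_zero]),
      k2 _ (by rw [inner_sub_right, real_inner_smul_right, h21]; ring)]
  refine ⟨c, fun w => ?_⟩
  change f w = _
  rcases le_total 0 ⟪p1, w⟫_ℝ with h1 | h1 <;> rcases le_total 0 ⟪p2, w⟫_ℝ with h2 | h2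
  · exact hc w h1 h2
  · rw [hd w h1 h2, k]
  · rw [hd' w h1 h2, k]
  · exact hc' w h1 h2

/-- a planar set whose opposite edges have the same length, with exceptions along two lines, is
symmetric -/
lemma planar_sym {n : E3} (hn : ⟪n, n⟫_ℝ = 1) {V : Finset E3} (hV : V.Nonempty)
    (hp : Planar n V) {p1 p2 : E3} (hp1 : ⟪n, p1⟫_ℝ = 0) (hp2 : ⟪n, p2⟫_ℝ = 0)
    (h1 : p1 ≠ 0) (h2 : p2 ≠ 0)
    (H : ∀ b a : E3, ON n b a → ⟪p1, b⟫_ℝ ≠ 0 → ⟪p2, b⟫_ℝ ≠ 0 →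
      wd a (fc V b) = wd a (fc V (-b))) : CSym V := by
  have hw : ∀ t : ℝ, p1 ≠ t • n := by
    rintro t rfl
    rw [real_inner_smul_right, hn, mul_one] at hp1
    simp [hp1] at h1
  obtain ⟨b, a, β, h, hβ, e⟩ := exists_on hn hw
  rw [hp1, zero_smul, zero_add] at e
  have e2 := h.expand p2
  rw [hp2, zero_smul, zero_add] at e2
  set x := ⟪b, p2⟫_ℝ
  set y := ⟪a, p2⟫_ℝ
  by_cases hy : y = 0
  · have hx : x ≠ 0 := by
      rintro hx; rw [hx, hy] at e2; simp at e2; exact h2 e2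
    refine planar_sym_core hn hV hp hp1 h.na (z1 := a) (z2 := β⁻¹ • b) ?_ h.a1 ?_ ?_ ?_
    · rw [e, real_inner_smul_left, h.ba, mul_zero]
    · rw [e, real_inner_smul_left, real_inner_smul_right, h.b1]; field_simp
    · rw [real_inner_smul_right, h.ab, mul_zero]
    · intro b' a' h' hb1 _
      apply H b' a' h' hb1
      intro h0
      apply hb1
      rw [e2, hy, zero_smul, add_zero, real_inner_smul_left] at h0
      rw [e, real_inner_smul_left, (mul_eq_zero.1 h0).resolve_left hx, mul_zero]
  · refine planar_sym_core hn hV hp hp1 hp2 (z1 := y⁻¹ • a) (z2 := β⁻¹ • (b - (x / y) • a)) ?_ ?_ ?_ ?_ H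
    · rw [e, real_inner_smul_left, real_inner_smul_right, h.ba]; ring
    · rw [e2]
      simp only [inner_add_left, real_inner_smul_left, real_inner_smul_right, h.ba, h.a1]
      field_simp; ring
    · rw [e]
      simp only [inner_sub_right, real_inner_smul_left, real_inner_smul_right, h.ba, h.b1]
      field_simp; ring
    · rw [e2]
      simp only [inner_add_left, inner_sub_right, real_inner_smul_left, real_inner_smul_right, h.ba,
        h.b1, h.ab, h.a1]
      field_simp; ring

lemma rank_quot (n : E3) : 1 < Module.rank ℝ (E3 ⧸ Submodule.span ℝ {n}) := by
  have h1 := Submodule.finrank_quotient_add_finrank (Submodule.span ℝ ({n} : Set E3))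
  have h2 : Module.finrank ℝ (Submodule.span ℝ ({n} : Set E3)) ≤ 1 := by
    classical
    have := finrank_span_finset_le_card (R := ℝ) ({n} : Finset E3)
    rw [Finset.coe_singleton] at this
    exact this
  have h3 : Module.finrank ℝ E3 = 3 := by simp
  rw [← Module.finrank_eq_rank]
  exact_mod_cast (by omega : 1 < Module.finrank ℝ (E3 ⧸ Submodule.span ℝ {n}))

/-- rotation invariance of edge lengths -/
lemma wd_rot {S : Finset E3} (hS : S.Nonempty)
    (H : ∀ n : E3, ⟪n, n⟫_ℝ = 1 → CSym (fc S n)) {n b a : E3} (h : ON n b a) :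
    wd a (fc (fc S n) b) = wd a (fc (fc S (-n)) (-b)) := by
  set N : ℝ → E3 := fun t => Real.cos t • n + Real.sin t • b with hN
  set B : ℝ → E3 := fun t => -Real.sin t • n + Real.cos t • b with hB
  set Λ : ℝ → ℝ := fun t => wd a (fc (fc S (N t)) (B t)) with hΛ
  have hon : ∀ t, ON (N t) (B t) a := fun t => h.rot t
  have hadd : ∀ t s, N (t + s) = Real.cos s • N t + Real.sin s • B t := by
    intro t s
    simp only [hN, hB, Real.cos_add, Real.sin_add]; module
  have haddB : ∀ t s, B (t + s) = -Real.sin s • N t + Real.cos s • B t := by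
    intro t s
    simp only [hN, hB, Real.cos_add, Real.sin_add]; module
  have hloc : IsLocallyConstant Λ := by
    rw [IsLocallyConstant.iff_eventually_eq]
    intro t
    obtain ⟨δ, hδ, HH⟩ := hs_local hS (N t)
    have ev : ∀ᶠ s : ℝ in nhds 0, 0 < Real.cos s ∧ |Real.tan s| < δ := by
      apply Filter.Eventually.and
      · exact (continuousAt_const (y := (0:ℝ))).eventually_lt Real.continuous_cos.continuousAt (by simp)
      · have : ContinuousAt (fun s => |Real.tan s|) 0 :=
          (Real.continuousAt_tan.2 (by simp)).abs
        exact this.eventually_lt continuousAt_const (by simpa using hδ)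
    have ev2 : ∀ᶠ y : ℝ in nhds t, 0 < Real.cos (y - t) ∧ |Real.tan (y - t)| < δ := by
      have : Filter.Tendsto (fun y : ℝ => y - t) (nhds t) (nhds 0) := by
        have hc : Continuous fun y : ℝ => y - t := by fun_prop
        have := hc.tendsto t
        simpa using this
      exact this.eventually ev
    filter_upwards [ev2] with y hy
    set s := y - t with hs
    have ey : y = t + s := by rw [hs]; ring
    have hbn : ‖B t‖ = 1 := by
      have := (hon t).b1; rw [real_inner_self_eq_norm_sq] at this
      nlinarith [norm_nonneg (B t)]
    have e1 : N y = Real.cos s • (N t + Real.tan s • B t) := by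
      rw [ey, hadd, smul_add (Real.cos s) (N t), smul_smul (Real.cos s) (Real.tan s), mul_comm (Real.cos s),
        Real.tan_mul_cos hy.1.ne']
    have e2 : fc S (N y) = fc (fc S (N t)) (Real.tan s • B t) := by
      rw [e1, fc_smul hS hy.1]
      exact (HH _ (by rw [norm_smul, hbn, mul_one]; exact hy.2)).2
    simp only [hΛ]
    rw [e2]
    have hne := fc_nonempty hS (N t)
    have pl : ∀ c : E3, Planar (B t) (fc (fc S (N t)) c) →
        fc (fc (fc S (N t)) c) (B y) = fc (fc S (N t)) c := by
      intro c hc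
      apply fc_const
      intro x hx x' hx'
      have := ((planar_fc (N t) S).mono (fc_subset _ c)) x hx x' hx'
      rw [ey, haddB, inner_add_left, inner_add_left, real_inner_smul_left, real_inner_smul_left,
        real_inner_smul_left, real_inner_smul_left, this, hc x hx x' hx']
    rcases lt_trichotomy (Real.tan s) 0 with h0 | h0 | h0
    · have e3 : fc (fc S (N t)) (Real.tan s • B t) = fc (fc S (N t)) (-(B t)) := by
        have : Real.tan s • B t = (-Real.tan s) • (-(B t)) := by module
        rw [this, fc_smul hne (by linarith)]
      rw [e3, pl]
      · exact (wd_of_sym (hon t) hne (planar_fc _ _) (H _ (hon t).n1)).symm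
      · have := (planar_fc (-(B t)) (fc S (N t))).neg
        rwa [neg_neg] at this
    · have hs0 : Real.sin s = 0 := by
        rw [Real.tan_eq_sin_div_cos, div_eq_zero_iff] at h0
        exact h0.resolve_right hy.1.ne'
      have hBy : B y = Real.cos s • B t := by rw [ey, haddB, hs0]; simp
      have : fc (fc S (N t)) (Real.tan s • B t) = fc S (N t) := by
        rw [h0, zero_smul]; exact fc_const (by simp)
      rw [this, hBy, fc_smul hne hy.1]
    · rw [fc_smul hne h0, pl _ (planar_fc _ _)]
  have := hloc.apply_eq_of_isPreconnected isPreconnected_univ (Set.mem_univ (0 : ℝ))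
    (Set.mem_univ Real.pi)
  simpa [hΛ, hN, hB] using this

theorem csym_of_faces {S : Finset E3} (hS : S.Nonempty)
    (H : ∀ n : E3, ⟪n, n⟫_ℝ = 1 → CSym (fc S n)) : CSym S := by
  have key : ∀ n : E3, ⟪n, n⟫_ℝ = 1 →
      ∃ c : E3, ∀ η, hs (fc S n) η - hs (fc S (-n)) (-η) = ⟪c, η⟫_ℝ := by
    intro n hn
    have hne := fc_nonempty hS n
    have hne' := fc_nonempty hS (-n)
    have hp' : Planar n (fc S (-n)) := by
      have := (planar_fc (-n) S).neg
      rwa [neg_neg] at this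
    obtain ⟨c, hc⟩ := locAff_linear (f := fun η => hs (fc S n) η - hs (fc S (-n)) (-η))
      (U := ((Submodule.span ℝ {n} : Submodule ℝ E3) : Set E3)ᶜ)
      (isConnected_compl_of_one_lt_codim (rank_quot n)).isPreconnected
      (Submodule.closed_of_finiteDimensional _).isOpen_compl
      (fun w hw => locAff_of_planar hn hne hne' (planar_fc _ _) hp' (by
        rintro t rfl
        exact hw (Submodule.smul_mem _ _ (Submodule.mem_span_singleton_self n))) (by
          intro b a h _
          exact wd_rot hS H h))
      (fun t w ht => diff_homog hne hne' t w ht)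
    refine ⟨c, fun w => ?_⟩
    by_cases hw : w ∈ (Submodule.span ℝ {n} : Submodule ℝ E3)
    · obtain ⟨z, hz⟩ : ∃ z : E3, z ∉ (Submodule.span ℝ {n} : Submodule ℝ E3) := by
        obtain ⟨z, hz⟩ := (isConnected_compl_of_one_lt_codim (rank_quot n)).nonempty
        exact ⟨z, hz⟩
      apply closure_cone (diff_cont _ _) (z := z)
      intro s hs
      apply hc
      intro hmem
      apply hz
      have := Submodule.sub_mem _ hmem hw
      rw [add_sub_cancel_left] at this
      exact (Submodule.smul_mem_iff _ hs.ne').1 this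
    · exact hc w hw
  obtain ⟨c, hc⟩ := locAff_linear (f := fun η => hs S η - hs S (-η)) (U := ({0} : Set E3)ᶜ)
    (isConnected_compl_singleton_of_one_lt_rank (by
      rw [← Module.finrank_eq_rank]; simp) 0).isPreconnected isOpen_compl_singleton
    (by
      intro w hw
      have hw0 : w ≠ 0 := hw
      have hwn : 0 < ‖w‖ := norm_pos_iff.2 hw0
      have hn1 : ⟪(‖w‖)⁻¹ • w, (‖w‖)⁻¹ • w⟫_ℝ = 1 := by
        rw [real_inner_smul_left, real_inner_smul_right, real_inner_self_eq_norm_sq]; field_simp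
      obtain ⟨c, hc⟩ := key _ hn1
      rw [← smul_neg, fc_smul hS (inv_pos.2 hwn), fc_smul hS (inv_pos.2 hwn)] at hc
      obtain ⟨δ, hδ, H1⟩ := hs_local hS w
      obtain ⟨δ', hδ', H2⟩ := hs_local hS (-w)
      refine ⟨c, min δ δ', lt_min hδ hδ', fun η hη => ?_⟩
      have h1 := (H1 η (lt_of_lt_of_le hη (min_le_left _ _))).1
      have h2 := (H2 (-η) (by rw [norm_neg]; exact lt_of_lt_of_le hη (min_le_right _ _))).1
      have e : -(w + η) = -w + -η := by abel
      simp only []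
      rw [e, h1, h2, ← hc]; ring)
    (fun t w ht => diff_homog hS hS t w ht)
  refine ⟨c, fun w => ?_⟩
  by_cases hw : w = 0
  · simp [hw]
  · exact hc w hw

end

section

noncomputable instance ratModE3 : Module ℚ E3 := Module.compHom E3 (algebraMap ℚ ℝ)

example (k : Type) [CommRing k] [IsDomain k] : IsDomain (AddMonoidAlgebra k E3) := inferInstance
example (k : Type) [CommRing k] [IsDomain k] : IsDomain (AddMonoidAlgebra k ℝ) := inferInstance

section toolkit
variable {k : Type*} [CommRing k] {M : Type*} [AddCommGroup M]

/-- the part of `x` on the level `L = d` -/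
noncomputable def topAt (L : M → ℝ) (d : ℝ) (x : AddMonoidAlgebra k M) : AddMonoidAlgebra k M :=
  .ofCoeff (x.coeff.filter fun v => L v = d)

lemma topAt_add (L : M → ℝ) (d : ℝ) (x y : AddMonoidAlgebra k M) :
    topAt L d (x + y) = topAt L d x + topAt L d y := by
  apply AddMonoidAlgebra.coeff_injective
  simp [topAt, Finsupp.filter_add]

lemma topAt_coeff (L : M → ℝ) (d : ℝ) (x : AddMonoidAlgebra k M) (v : M) [Decidable (L v = d)] :
    (topAt L d x).coeff v = if L v = d then x.coeff v else 0 := by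
  classical
  simp only [topAt, Finsupp.filter_apply]
  split_ifs <;> rfl

lemma topAt_self {L : M → ℝ} {d : ℝ} {x : AddMonoidAlgebra k M}
    (h : ∀ v ∈ x.coeff.support, L v = d) : topAt L d x = x := by
  classical
  ext v
  rw [topAt_coeff]
  split_ifs with h1
  · rfl
  · by_contra h2
    exact h1 (h v (Finsupp.mem_support_iff.2 (Ne.symm h2)))

lemma topAt_zero_of_lt {L : M → ℝ} {d : ℝ} {x : AddMonoidAlgebra k M}
    (h : ∀ v ∈ x.coeff.support, L v < d) : topAt L d x = 0 := by
  classical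
  ext v
  rw [topAt_coeff]
  split_ifs with h1
  · by_contra h2
    exact (h v (Finsupp.mem_support_iff.2 h2)).ne h1
  · rfl

lemma topAt_decomp {L : M → ℝ} {d : ℝ} {x : AddMonoidAlgebra k M}
    (h : ∀ v ∈ x.coeff.support, L v ≤ d) : ∃ r : AddMonoidAlgebra k M, x = topAt L d x + r ∧
      (∀ v ∈ r.coeff.support, L v < d) := by
  classical
  refine ⟨x - topAt L d x, by ring, fun v hv => ?_⟩
  rw [Finsupp.mem_support_iff, AddMonoidAlgebra.coeff_sub, Finsupp.sub_apply, topAt_coeff] at hv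
  split_ifs at hv with h1
  · simp at hv
  · rw [sub_zero] at hv
    exact lt_of_le_of_ne (h v (Finsupp.mem_support_iff.2 hv)) h1

lemma topAt_supp {L : M → ℝ} {d : ℝ} {x : AddMonoidAlgebra k M} {v : M} :
    v ∈ (topAt L d x).coeff.support ↔ v ∈ x.coeff.support ∧ L v = d := by
  classical
  rw [Finsupp.mem_support_iff, topAt_coeff, Finsupp.mem_support_iff]
  split_ifs with h <;> simp [h]

lemma exists_of_supp_mul {x y : AddMonoidAlgebra k M} {v : M} (h : v ∈ (x * y).coeff.support) :
    ∃ p ∈ x.coeff.support, ∃ q ∈ y.coeff.support, v = p + q := by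
  classical
  have := AddMonoidAlgebra.support_coeff_mul_subset x y h
  obtain ⟨p, hp, q, hq, e⟩ := Finset.mem_add.1 this
  exact ⟨p, hp, q, hq, e.symm⟩

lemma topAt_mul {L : M → ℝ} (hL : ∀ u v, L (u + v) = L u + L v) {d e : ℝ}
    {x y : AddMonoidAlgebra k M} (hx : ∀ v ∈ x.coeff.support, L v ≤ d)
    (hy : ∀ v ∈ y.coeff.support, L v ≤ e) :
    topAt L (d + e) (x * y) = topAt L d x * topAt L e y := by
  obtain ⟨r, hr, hr'⟩ := topAt_decomp hx
  obtain ⟨s, hs, hs'⟩ := topAt_decomp hy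
  have e1 : x * y = topAt L d x * topAt L e y + (topAt L d x * s + r * y) := by
    calc x * y = (topAt L d x + r) * y := by rw [← hr]
      _ = topAt L d x * y + r * y := by ring
      _ = topAt L d x * (topAt L e y + s) + r * y := by rw [← hs]
      _ = _ := by ring
  have p1 : topAt L (d + e) (topAt L d x * topAt L e y) = topAt L d x * topAt L e y := by
    apply topAt_self
    intro v hv
    obtain ⟨p, hp, q, hq, rfl⟩ := exists_of_supp_mul hv
    rw [hL, (topAt_supp.1 hp).2, (topAt_supp.1 hq).2]
  have p2 : topAt L (d + e) (topAt L d x * s) = 0 := by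
    apply topAt_zero_of_lt
    intro v hv
    obtain ⟨p, hp, q, hq, rfl⟩ := exists_of_supp_mul hv
    rw [hL]; linarith [hs' q hq, (topAt_supp.1 hp).2]
  have p3 : topAt L (d + e) (r * y) = 0 := by
    apply topAt_zero_of_lt
    intro v hv
    obtain ⟨p, hp, q, hq, rfl⟩ := exists_of_supp_mul hv
    rw [hL]; linarith [hr' p hp, hy q hq]
  rw [e1, topAt_add, topAt_add, p1, p2, p3, add_zero, add_zero]

lemma supp_nonempty {x : AddMonoidAlgebra k M} (hx : x ≠ 0) : x.coeff.support.Nonempty := by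
  rw [Finsupp.support_nonempty_iff]
  rwa [Ne, AddMonoidAlgebra.coeff_eq_zero]

lemma ne_zero_of_supp {x : AddMonoidAlgebra k M} {v : M} (h : v ∈ x.coeff.support) : x ≠ 0 := by
  rintro rfl; simp at h

/-- sum formula for `liftNC` -/
lemma liftNC_eq_sum {R : Type*} [CommRing R] (f : k →+ R) (g : Multiplicative M → R)
    (x : AddMonoidAlgebra k M) : AddMonoidAlgebra.liftNC f g x =
      x.coeff.sum fun v r => f r * g (Multiplicative.ofAdd v) := by
  classical
  induction x using AddMonoidAlgebra.induction_linear with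
  | zero => simp
  | add x y hx hy =>
    rw [map_add, hx, hy, AddMonoidAlgebra.coeff_add, Finsupp.sum_add_index']
    · simp
    · intro v r s; rw [map_add, add_mul]
  | single v r =>
    rw [AddMonoidAlgebra.liftNC_single, AddMonoidAlgebra.coeff_single, Finsupp.sum_single_index]
    simp

/-- Leibniz rule -/
lemma leibniz {R : Type*} [CommRing R] (f : k →+* R) (g : Multiplicative M →* R) (l : M →+ R)
    (x y : AddMonoidAlgebra k M) :
    AddMonoidAlgebra.liftNC (f : k →+ R) (fun v => l v.toAdd * g v) (x * y) =
      AddMonoidAlgebra.liftNC (f : k →+ R) (fun v => l v.toAdd * g v) x *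
        AddMonoidAlgebra.liftNC (f : k →+ R) g y +
      AddMonoidAlgebra.liftNC (f : k →+ R) g x *
        AddMonoidAlgebra.liftNC (f : k →+ R) (fun v => l v.toAdd * g v) y := by
  induction x using AddMonoidAlgebra.induction_linear with
  | zero => simp
  | add x x' hx hx' => simp only [add_mul, map_add, hx, hx']; ring
  | single v r =>
    induction y using AddMonoidAlgebra.induction_linear with
    | zero => simp
    | add y y' hy hy' => simp only [mul_add, map_add, hy, hy']; ring
    | single w s =>
      simp only [AddMonoidAlgebra.single_mul_single, AddMonoidAlgebra.liftNC_single, ofAdd_add,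
        map_mul, toAdd_mul, map_add, toAdd_ofAdd, AddMonoidHom.coe_coe]
      ring

lemma leibniz2 {R : Type*} [CommRing R] (f : k →+* R) (l : M →+ R)
    (x y : AddMonoidAlgebra k M) :
    AddMonoidAlgebra.liftNC (f : k →+ R) (fun v => l v.toAdd ^ 2) (x * y) =
      AddMonoidAlgebra.liftNC (f : k →+ R) (fun v => l v.toAdd ^ 2) x *
        AddMonoidAlgebra.liftNC (f : k →+ R) (fun _ => 1) y +
      2 * (AddMonoidAlgebra.liftNC (f : k →+ R) (fun v => l v.toAdd) x *
        AddMonoidAlgebra.liftNC (f : k →+ R) (fun v => l v.toAdd) y) +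
      AddMonoidAlgebra.liftNC (f : k →+ R) (fun _ => 1) x *
        AddMonoidAlgebra.liftNC (f : k →+ R) (fun v => l v.toAdd ^ 2) y := by
  induction x using AddMonoidAlgebra.induction_linear with
  | zero => simp
  | add x x' hx hx' => simp only [add_mul, map_add, hx, hx']; ring
  | single v r =>
    induction y using AddMonoidAlgebra.induction_linear with
    | zero => simp
    | add y y' hy hy' => simp only [mul_add, map_add, hy, hy']; ring
    | single w s =>
      simp only [AddMonoidAlgebra.single_mul_single, AddMonoidAlgebra.liftNC_single, ofAdd_add,
        map_mul, toAdd_mul, map_add, toAdd_ofAdd, AddMonoidHom.coe_coe]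
      ring

variable [IsDomain k]

/-- factors of a one-level element have one level -/
lemma mono_of_mul {x y : AddMonoidAlgebra k ℝ} (h0 : x * y ≠ 0) {l : ℝ}
    (h : ∀ v ∈ (x * y).coeff.support, v = l) :
    ∃ p q : ℝ, p + q = l ∧ (∀ v ∈ x.coeff.support, v = p) ∧ (∀ v ∈ y.coeff.support, v = q) ∧
      p ∈ x.coeff.support ∧ q ∈ y.coeff.support := by
  have hx := left_ne_zero_of_mul h0
  have hy := right_ne_zero_of_mul h0
  have key : ∀ L : ℝ → ℝ, (∀ u v, L (u + v) = L u + L v) → ∀ p ∈ x.coeff.support,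
      ∀ q ∈ y.coeff.support, (∀ v ∈ x.coeff.support, L v ≤ L p) →
      (∀ v ∈ y.coeff.support, L v ≤ L q) → L p + L q = L l := by
    intro L hL p hp q hq hp' hq'
    have h1 := topAt_mul hL hp' hq'
    have h2 : topAt L (L p) x * topAt L (L q) y ≠ 0 :=
      mul_ne_zero (ne_zero_of_supp (topAt_supp.2 ⟨hp, rfl⟩)) (ne_zero_of_supp (topAt_supp.2 ⟨hq, rfl⟩))
    rw [← h1] at h2
    obtain ⟨v, hv⟩ := supp_nonempty h2
    obtain ⟨hv1, hv2⟩ := topAt_supp.1 hv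
    rw [h v hv1] at hv2; exact hv2.symm
  have hxn := supp_nonempty hx
  have hyn := supp_nonempty hy
  have k1 := key (fun v => v) (fun _ _ => rfl) _ (Finset.max'_mem _ hxn) _ (Finset.max'_mem _ hyn)
    (fun v hv => Finset.le_max' _ v hv) (fun v hv => Finset.le_max' _ v hv)
  have k2 := key (fun v => -v) (fun _ _ => neg_add _ _) _ (Finset.min'_mem _ hxn) _
    (Finset.min'_mem _ hyn) (fun v hv => neg_le_neg (Finset.min'_le _ v hv))
    (fun v hv => neg_le_neg (Finset.min'_le _ v hv))
  have k1 : _ + _ = l := k1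
  have k2 : -_ + -_ = -l := k2
  have l1 := Finset.min'_le _ _ (Finset.max'_mem _ hxn)
  have l2 := Finset.min'_le _ _ (Finset.max'_mem _ hyn)
  refine ⟨_, _, k1, fun v hv => ?_, fun v hv => ?_, Finset.max'_mem _ hxn, Finset.max'_mem _ hyn⟩
  · have := Finset.le_max' _ v hv
    have := Finset.min'_le _ v hv
    linarith
  · have := Finset.le_max' _ v hv
    have := Finset.min'_le _ v hv
    linarith

end toolkit

section e3
variable {k : Type*} [CommRing k]

/-- support -/
noncomputable abbrev sp (x : AddMonoidAlgebra k E3) : Finset E3 := x.coeff.support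

/-- the face part of an element of the group algebra -/
noncomputable def tp (w : E3) (x : AddMonoidAlgebra k E3) : AddMonoidAlgebra k E3 :=
  topAt (fun v => ⟪w, v⟫_ℝ) (hs (sp x) w) x

lemma sp_tp (w : E3) (x : AddMonoidAlgebra k E3) : sp (tp w x) = fc (sp x) w := by
  ext v; rw [mem_fc]; exact topAt_supp

lemma tp_coeff {w v : E3} {x : AddMonoidAlgebra k E3} (h : v ∈ fc (sp x) w) :
    (tp w x).coeff v = x.coeff v := by
  classical
  rw [tp, topAt_coeff, if_pos (mem_fc.1 h).2]

lemma tp_ne_zero {w : E3} {x : AddMonoidAlgebra k E3} (h : x ≠ 0) : tp w x ≠ 0 := by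
  obtain ⟨v, hv⟩ := fc_nonempty (supp_nonempty h) w
  rw [← sp_tp] at hv
  exact ne_zero_of_supp hv

variable [IsDomain k]

lemma hs_mul {x y : AddMonoidAlgebra k E3} (hx : x ≠ 0) (hy : y ≠ 0) (w : E3) :
    hs (sp (x * y)) w = hs (sp x) w + hs (sp y) w := by
  have h1 := topAt_mul (L := fun v => ⟪w, v⟫_ℝ) (fun _ _ => inner_add_right _ _ _)
    (fun v (hv : v ∈ sp x) => le_hs hv w) (fun v (hv : v ∈ sp y) => le_hs hv w)
  have h2 : topAt (fun v => ⟪w, v⟫_ℝ) (hs (sp x) w + hs (sp y) w) (x * y) ≠ 0 := by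
    rw [h1]; exact mul_ne_zero (tp_ne_zero hx) (tp_ne_zero hy)
  obtain ⟨v, hv⟩ := supp_nonempty h2
  obtain ⟨hv1, hv2⟩ := topAt_supp.1 hv
  refine hs_eq (fun u hu => ?_) hv1 hv2
  obtain ⟨p, hp, q, hq, rfl⟩ := exists_of_supp_mul hu
  rw [inner_add_right]
  exact add_le_add (le_hs hp w) (le_hs hq w)

lemma tp_mul {x y : AddMonoidAlgebra k E3} (hx : x ≠ 0) (hy : y ≠ 0) (w : E3) :
    tp w (x * y) = tp w x * tp w y := by
  rw [tp, hs_mul hx hy]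
  exact topAt_mul (L := fun v => ⟪w, v⟫_ℝ) (fun _ _ => inner_add_right _ _ _)
    (fun v (hv : v ∈ sp x) => le_hs hv w) (fun v (hv : v ∈ sp y) => le_hs hv w)

lemma wd_mul {x y : AddMonoidAlgebra k E3} (hx : x ≠ 0) (hy : y ≠ 0) (w : E3) :
    wd w (sp (x * y)) = wd w (sp x) + wd w (sp y) := by
  simp only [wd, hs_mul hx hy]; ring

/-- singletons from zero widths -/
lemma eq_singleton_of_wd {V : Finset E3} (hV : V.Nonempty) (h : ∀ a, wd a V = 0) :
    ∃ v, V = {v} := by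
  obtain ⟨v, hv⟩ := hV
  refine ⟨v, Finset.eq_singleton_iff_unique_mem.2 ⟨hv, fun x hx => ?_⟩⟩
  refine ext_inner_left ℝ fun a => (wd_eq_zero ⟨v, hv⟩).1 (h a) x hx v hv

lemma hs_singleton (v w : E3) : hs {v} w = ⟪w, v⟫_ℝ :=
  hs_eq (v := v) (by simp) (by simp) rfl

lemma hs_unit {x y : AddMonoidAlgebra k E3} (h : x * y = 1) :
    ∃ v, sp x = {v} := by
  have h0 : x * y ≠ 0 := by rw [h]; exact one_ne_zero
  have hx := left_ne_zero_of_mul h0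
  have hy := right_ne_zero_of_mul h0
  apply eq_singleton_of_wd (supp_nonempty hx)
  intro a
  have h1 := wd_mul hx hy a
  have h2 : wd a (sp (x * y)) = 0 := by
    rw [h]
    have : sp (1 : AddMonoidAlgebra k E3) = {0} := by
      simp [sp, AddMonoidAlgebra.one_def, Finsupp.support_single_ne_zero]
    rw [this, wd, hs_singleton, hs_singleton]; simp
  have := wd_nonneg (a := a) (supp_nonempty hx)
  have := wd_nonneg (a := a) (supp_nonempty hy)
  linarith
end e3

end

section

section ufd
variable {k : Type*} [CommRing k] [IsDomain k]

/-- the monomial -/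
noncomputable def mo (v : E3) : AddMonoidAlgebra k E3 := AddMonoidAlgebra.single v 1

lemma mo_mul (v w : E3) : (mo v : AddMonoidAlgebra k E3) * mo w = mo (v + w) := by
  simp [mo, AddMonoidAlgebra.single_mul_single]

lemma mo_zero : (mo 0 : AddMonoidAlgebra k E3) = 1 := rfl

/-- the involution -/
noncomputable def dag (σ : k →+* k) : AddMonoidAlgebra k E3 →+* AddMonoidAlgebra k E3 :=
  AddMonoidAlgebra.liftNCRingHom (AddMonoidAlgebra.singleZeroRingHom.comp σ)
    { toFun := fun v => mo (-v.toAdd)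
      map_one' := by simp [mo_zero]
      map_mul' := fun v w => by rw [mo_mul, toAdd_mul, neg_add] } (fun _ _ => Commute.all _ _)

lemma dag_single (σ : k →+* k) (v : E3) (r : k) :
    dag σ (AddMonoidAlgebra.single v r) = AddMonoidAlgebra.single (-v) (σ r) := by
  simp only [dag, AddMonoidAlgebra.liftNCRingHom]
  change AddMonoidAlgebra.liftNC _ _ _ = _
  rw [AddMonoidAlgebra.liftNC_single]
  simp [mo, AddMonoidAlgebra.single_mul_single]

lemma dag_mo (σ : k →+* k) (v : E3) : dag σ (mo v) = mo (-v) := by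
  rw [mo, dag_single, map_one, mo]

lemma dag_dag {σ : k →+* k} (hσ : ∀ r, σ (σ r) = r) (x : AddMonoidAlgebra k E3) :
    dag σ (dag σ x) = x := by
  induction x using AddMonoidAlgebra.induction_linear with
  | zero => simp
  | add x y hx hy => rw [map_add, map_add, hx, hy]
  | single v r => rw [dag_single, dag_single, hσ, neg_neg]

lemma dag_coeff {σ : k →+* k} (x : AddMonoidAlgebra k E3) (v : E3) :
    (dag σ x).coeff v = σ (x.coeff (-v)) := by
  classical
  induction x using AddMonoidAlgebra.induction_linear with
  | zero => simp
  | add x y hx hy => simp [hx, hy]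
  | single w r =>
    rw [dag_single]
    simp only [AddMonoidAlgebra.coeff_single, Finsupp.single_apply]
    by_cases h : w = -v
    · subst h; simp
    · rw [if_neg h, if_neg (fun h' => h (by rw [← h', neg_neg])), map_zero]

lemma sp_dag {σ : k →+* k} (hσ : ∀ r, σ (σ r) = r) (x : AddMonoidAlgebra k E3) (v : E3) :
    v ∈ sp (dag σ x) ↔ -v ∈ sp x := by
  rw [Finsupp.mem_support_iff, Finsupp.mem_support_iff, dag_coeff, not_iff_not]
  constructor
  · intro h
    have := congrArg σ h
    rwa [hσ, map_zero] at this
  · intro h; rw [h, map_zero]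

lemma zTorsionFree : Module.IsTorsionFree ℤ E3 := by
  haveI : IsAddTorsionFree E3 := IsAddTorsionFree.of_isTorsionFree ℝ E3
  infer_instance

/-- existence of a finite Z-basis -/
lemma exists_zbasis (F : Finset E3) : ∃ (n : ℕ) (b : Fin n → E3), LinearIndependent ℤ b ∧
    ∀ v ∈ F, v ∈ Submodule.span ℤ (Set.range b) := by
  classical
  let G := Submodule.span ℤ (F : Set E3)
  haveI : Module.Finite ℤ G := Module.Finite.span_of_finite ℤ F.finite_toSet
  haveI : Module.IsTorsionFree ℤ E3 := zTorsionFree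
  haveI : Module.Free ℤ G := inferInstance
  let bb := Module.finBasis ℤ G
  refine ⟨_, fun i => (bb i : E3), ?_, fun v hv => ?_⟩
  · exact bb.linearIndependent.map' G.subtype (Submodule.ker_subtype G)
  · have h1 : v ∈ G := Submodule.subset_span hv
    have h2 : (⟨v, h1⟩ : G) ∈ Submodule.span ℤ (Set.range bb) := by rw [bb.span_eq]; trivial
    have h3 := Submodule.mem_map_of_mem (f := G.subtype) h2
    rw [Submodule.map_span, ← Set.range_comp] at h3
    exact h3

/-- the embedding of polynomials -/
noncomputable def emb {n : ℕ} (b : Fin n → E3) : MvPolynomial (Fin n) k →+* AddMonoidAlgebra k E3 :=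
  MvPolynomial.eval₂Hom AddMonoidAlgebra.singleZeroRingHom (fun i => mo (b i))

lemma emb_monomial {n : ℕ} (b : Fin n → E3) (d : Fin n →₀ ℕ) (r : k) :
    emb b (MvPolynomial.monomial d r) = AddMonoidAlgebra.single (∑ i, d i • b i) r := by
  have h1 : ∀ (j : ℕ) (v : E3), (mo v : AddMonoidAlgebra k E3) ^ j = mo (j • v) := by
    intro j v
    induction j with
    | zero => simp [mo_zero]
    | succ j ih => rw [pow_succ, ih, mo_mul, add_smul, one_smul]
  have h2 : ∀ (s : Finset (Fin n)) , ∏ i ∈ s, (mo (d i • b i) : AddMonoidAlgebra k E3) =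
      mo (∑ i ∈ s, d i • b i) := by
    intro s
    classical
    induction s using Finset.induction_on with
    | empty => simp [mo_zero]
    | insert i s hi ih => rw [Finset.prod_insert hi, Finset.sum_insert hi, ih, mo_mul]
  rw [emb, MvPolynomial.coe_eval₂Hom, MvPolynomial.eval₂_monomial, Finsupp.prod_fintype _ _ (by simp)]
  simp only [h1, h2]
  simp [mo, AddMonoidAlgebra.single_mul_single]

lemma emb_coeff {n : ℕ} {b : Fin n → E3} (hb : LinearIndependent ℤ b) (x : MvPolynomial (Fin n) k)
    (d : Fin n →₀ ℕ) : (emb b x).coeff (∑ i, d i • b i) = x.coeff d := by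
  classical
  induction x using MvPolynomial.induction_on' with
  | add p q hp hq => simp [hp, hq]
  | monomial e r =>
    rw [emb_monomial, AddMonoidAlgebra.coeff_single, MvPolynomial.coeff_monomial,
      Finsupp.single_apply]
    congr 1
    rw [eq_iff_iff]
    constructor
    · intro h
      have h2 : ∑ i, ((e i : ℤ) - (d i : ℤ)) • b i = 0 := by
        simp only [sub_smul, natCast_zsmul, Finset.sum_sub_distrib, h, sub_self]
      have h3 := Fintype.linearIndependent_iff.1 hb _ h2
      ext i
      have := h3 i
      omega
    · rintro rfl; rfl

lemma emb_inj {n : ℕ} {b : Fin n → E3} (hb : LinearIndependent ℤ b) :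
    Function.Injective (emb b : MvPolynomial (Fin n) k →+* AddMonoidAlgebra k E3) := by
  intro x y h
  ext d
  rw [← emb_coeff hb, ← emb_coeff hb, h]

lemma emb_clear {n : ℕ} (b : Fin n → E3) (y : AddMonoidAlgebra k E3)
    (hy : ∀ v ∈ sp y, v ∈ Submodule.span ℤ (Set.range b)) :
    ∃ (v : E3) (m m0 : MvPolynomial (Fin n) k), y * mo v = emb b m ∧ mo v = emb b m0 := by
  classical
  have hs : ∀ j : ℕ, (mo (j • ∑ i, b i) : AddMonoidAlgebra k E3) =
      emb b (MvPolynomial.monomial (Finsupp.equivFunOnFinite.symm fun _ => j) 1) := by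
    intro j
    rw [emb_monomial, mo, Finset.smul_sum]; rfl
  suffices h : ∀ s : Finset E3, s ⊆ sp y → ∃ (j : ℕ) (m : MvPolynomial (Fin n) k),
      (∑ v ∈ s, AddMonoidAlgebra.single v (y.coeff v)) * mo (j • ∑ i, b i) = emb b m by
    obtain ⟨j, m, h⟩ := h _ (le_refl _)
    refine ⟨j • ∑ i, b i, m, _, ?_, hs j⟩
    rw [← h]
    congr 1
    apply AddMonoidAlgebra.coeff_injective
    rw [AddMonoidAlgebra.coeff_sum]
    simp only [AddMonoidAlgebra.coeff_single]
    exact (Finsupp.sum_single y.coeff).symm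
  intro s
  induction s using Finset.induction_on with
  | empty => intro _; exact ⟨0, 0, by simp⟩
  | insert v s hv ih =>
    intro hsub
    obtain ⟨j, m, hm⟩ := ih (fun x hx => hsub (Finset.mem_insert_of_mem hx))
    obtain ⟨c, hc⟩ := (Submodule.mem_span_range_iff_exists_fun ℤ).1
      (hy v (hsub (Finset.mem_insert_self _ _)))
    let J : ℕ := ∑ i, (c i).natAbs
    have hJ : ∀ i, 0 ≤ c i + J := by
      intro i
      have : (c i).natAbs ≤ J := Finset.single_le_sum (f := fun i => (c i).natAbs)
        (fun _ _ => Nat.zero_le _) (Finset.mem_univ i)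
      omega
    have e1 : (AddMonoidAlgebra.single v (y.coeff v)) * mo (J • ∑ i, b i) =
        emb b (MvPolynomial.monomial (Finsupp.equivFunOnFinite.symm fun i => (c i + J).toNat)
          (y.coeff v)) := by
      rw [emb_monomial, mo, AddMonoidAlgebra.single_mul_single, mul_one]
      congr 1
      rw [← hc, Finset.smul_sum, ← Finset.sum_add_distrib]
      refine Finset.sum_congr rfl fun i _ => ?_
      have : (((c i + J).toNat : ℕ) : ℤ) = c i + J := Int.toNat_of_nonneg (hJ i)
      rw [← natCast_zsmul (b i) J, ← add_smul, ← this, natCast_zsmul]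
      rfl
    refine ⟨j + J, MvPolynomial.monomial (Finsupp.equivFunOnFinite.symm fun i => (c i + J).toNat)
          (y.coeff v) * MvPolynomial.monomial (Finsupp.equivFunOnFinite.symm fun _ => j) 1 +
          m * MvPolynomial.monomial (Finsupp.equivFunOnFinite.symm fun _ => J) 1, ?_⟩
    rw [map_add, map_mul, map_mul, ← hm, ← e1, ← hs, ← hs, Finset.sum_insert hv, add_mul,
      mul_assoc, mul_assoc, mo_mul, mo_mul, add_smul, add_comm (J • _)]

/-- Factorization of two elements with the same product with their conjugates. -/
theorem factor_pair [UniqueFactorizationMonoid k] {σ : k →+* k} (hσ : ∀ r, σ (σ r) = r)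
    {a a' : AddMonoidAlgebra k E3} (ha : a ≠ 0) (ha' : a' ≠ 0)
    (h : a * dag σ a = a' * dag σ a') :
    ∃ B C w w' : AddMonoidAlgebra k E3, a = B * C ∧ a' = B * w * dag σ C ∧ w * w' = 1 := by
  classical
  obtain ⟨n, b, hb, hF⟩ := exists_zbasis (sp a ∪ sp a')
  have hneg : ∀ x : AddMonoidAlgebra k E3, (∀ v ∈ sp x, v ∈ Submodule.span ℤ (Set.range b)) →
      ∀ v ∈ sp (dag σ x), v ∈ Submodule.span ℤ (Set.range b) := by
    intro x hx v hv
    rw [sp_dag hσ] at hv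
    simpa using Submodule.neg_mem _ (hx _ hv)
  have hrange : ∀ x : MvPolynomial (Fin n) k, ∀ v ∈ sp (emb b x),
      v ∈ Submodule.span ℤ (Set.range b) := by
    intro x
    induction x using MvPolynomial.induction_on' with
    | add p q hp hq =>
      intro v hv
      rw [map_add] at hv
      rcases Finset.mem_union.1 (Finsupp.support_add hv) with h | h
      · exact hp v h
      · exact hq v h
    | monomial e r =>
      intro v hv
      rw [emb_monomial] at hv
      have := Finset.mem_singleton.1 (Finsupp.support_single_subset hv)
      subst this
      refine Submodule.sum_mem _ fun i _ => ?_
      rw [← natCast_zsmul]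
      exact Submodule.smul_mem _ _ (Submodule.subset_span ⟨i, rfl⟩)
  have hmo : ∀ v : E3, (mo v : AddMonoidAlgebra k E3) * mo (-v) = 1 := by
    intro v; rw [mo_mul, add_neg_cancel, mo_zero]
  have hmon : ∀ v, (mo v : AddMonoidAlgebra k E3) ≠ 0 := fun v h => by
    have := hmo v; rw [h, zero_mul] at this; exact zero_ne_one this
  obtain ⟨v, α, -, hα, -⟩ := emb_clear b a (fun v hv => hF v (Finset.mem_union_left _ hv))
  obtain ⟨v', α', -, hα', -⟩ := emb_clear b a' (fun v hv => hF v (Finset.mem_union_right _ hv))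
  have hα0 : α ≠ 0 := by
    rintro rfl; rw [map_zero] at hα; exact mul_ne_zero ha (hmon v) hα
  have hα0' : α' ≠ 0 := by
    rintro rfl; rw [map_zero] at hα'; exact mul_ne_zero ha' (hmon v') hα'
  obtain ⟨c, d, β, hrel, rfl, rfl⟩ := UniqueFactorizationMonoid.exists_reduced_factors α hα0 α'
  -- elements
  set B := emb b β with hB
  have hβ0 : B ≠ 0 := by
    intro h0; rw [map_mul, ← hB, h0, zero_mul] at hα; exact mul_ne_zero ha (hmon v) hα
  have ea : a = B * (emb b c * mo (-v)) := by
    rw [← mul_assoc, hB, ← map_mul, ← hα, mul_assoc, hmo, mul_one]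
  have ea' : a' = B * (emb b d * mo (-v')) := by
    rw [← mul_assoc, hB, ← map_mul, ← hα', mul_assoc, hmo, mul_one]
  set C := emb b c * mo (-v) with hC
  set D := emb b d * mo (-v') with hD
  have hBd : dag σ B ≠ 0 := fun h0 => hβ0 (by rw [← dag_dag hσ B, h0, map_zero])
  have hCD : C * dag σ C = D * dag σ D := by
    rw [ea, ea', map_mul _ B C, map_mul _ B D] at h
    have : (B * dag σ B) * (C * dag σ C) = (B * dag σ B) * (D * dag σ D) := by
      rw [show (B * dag σ B) * (C * dag σ C) = B * C * (dag σ B * dag σ C) by ring, h]; ring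
    exact mul_left_cancel₀ (mul_ne_zero hβ0 hBd) this
  obtain ⟨p, c', -, hc', -⟩ := emb_clear b _ (hneg _ (hrange c))
  obtain ⟨q, d', -, hd', -⟩ := emb_clear b _ (hneg _ (hrange d))
  -- transfer to polynomials
  have hdagC : dag σ C = emb b c' * mo (v - p) := by
    rw [hC, map_mul, dag_mo, ← hc', mul_assoc, mo_mul, neg_neg, add_sub_cancel]
  have hdagD : dag σ D = emb b d' * mo (v' - q) := by
    rw [hD, map_mul, dag_mo, ← hd', mul_assoc, mo_mul, neg_neg, add_sub_cancel]
  have hpoly : emb b (c * c') * mo (-p) = emb b (d * d') * mo (-q) := by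
    rw [hdagC, hdagD, hC, hD] at hCD
    rw [map_mul, map_mul]
    calc _ = emb b c * mo (-v) * (emb b c' * mo (v - p)) := by
          rw [show (-p : E3) = -v + (v - p) by abel, ← mo_mul]; ring
      _ = _ := by
          rw [hCD, show (-q : E3) = -v' + (v' - q) by abel, ← mo_mul]; ring
  have hpq : p - q ∈ Submodule.span ℤ (Set.range b) ∨ c * c' = 0 := by
    by_cases h0 : c * c' = 0
    · exact Or.inr h0
    · left
      have h1 : emb b (c * c') ≠ 0 := fun h => h0 (emb_inj hb (by rw [h, map_zero]))
      obtain ⟨x, hx⟩ := supp_nonempty h1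
      have h2 : emb b (c * c') = emb b (d * d') * mo (p - q) := by
        calc _ = emb b (c * c') * mo (-p) * mo p := by
              rw [mul_assoc, mo_mul, neg_add_cancel, mo_zero, mul_one]
          _ = _ := by rw [hpoly, mul_assoc, mo_mul, neg_add_eq_sub]
      have hx2 := hx
      rw [h2] at hx2
      obtain ⟨y, hy, z, hz, e⟩ := exists_of_supp_mul hx2
      have hz' := Finset.mem_singleton.1 (Finsupp.support_single_subset hz)
      rw [← hz', show z = x - y by rw [e]; abel]
      exact Submodule.sub_mem _ (hrange _ x hx) (hrange _ y hy)
  have hc0 : C ≠ 0 := by intro h0; exact ha (by rw [ea, h0, mul_zero])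
  have hcc : c * c' ≠ 0 := by
    intro h0
    rcases mul_eq_zero.1 h0 with h1 | h1
    · exact hc0 (by rw [hC, h1, map_zero, zero_mul])
    · have : dag σ C = 0 := by rw [hdagC, h1, map_zero, zero_mul]
      exact hc0 (by rw [← dag_dag hσ C, this, map_zero])
  have hpq := hpq.resolve_right hcc
  obtain ⟨z, m, m0, hm, hm0⟩ := emb_clear b (mo (p - q) : AddMonoidAlgebra k E3) (by
    intro x hx
    rw [Finset.mem_singleton.1 (Finsupp.support_single_subset hx)]; exact hpq)
  have hfin : c * c' * m0 = d * d' * m := by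
    apply emb_inj hb
    rw [map_mul, map_mul _ (d * d'), ← hm, ← hm0]
    calc _ = emb b (c * c') * mo (-p) * mo p * mo z := by
          rw [mul_assoc _ (mo (-p)), mo_mul, neg_add_cancel, mo_zero, mul_one]
      _ = _ := by rw [hpoly, mul_assoc _ (mo (-q)), mo_mul, neg_add_eq_sub, mul_assoc]
  have h1 : d ∣ c' * m0 := by
    refine hrel.symm.dvd_of_dvd_mul_left (y := c) ?_
    exact ⟨d' * m, by rw [← mul_assoc, hfin, mul_assoc]⟩
  have h2 : c ∣ d' * m := by
    refine hrel.dvd_of_dvd_mul_left (y := d) ?_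
    exact ⟨c' * m0, by rw [← mul_assoc, ← hfin, mul_assoc]⟩
  obtain ⟨e1, h1⟩ := h1
  obtain ⟨e2, h2⟩ := h2
  have g1 : dag σ C = D * (emb b e1 * mo (v' + (v - p) - z)) := by
    have := congrArg (emb b) h1
    rw [map_mul, map_mul, ← hm0] at this
    rw [hdagC, hD]
    calc _ = emb b c' * mo z * mo ((v - p) - z) := by rw [mul_assoc, mo_mul, add_sub_cancel]
      _ = emb b d * emb b e1 * (mo (-v') * mo (v' + (v - p) - z)) := by
        rw [this, mo_mul]; congr 2; abel
      _ = _ := by ring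
  have g2 : dag σ D = C * (emb b e2 * mo (v + (v' - q) - ((p - q) + z))) := by
    have := congrArg (emb b) h2
    rw [map_mul, map_mul, ← hm, mo_mul] at this
    rw [hdagD, hC]
    calc _ = emb b d' * mo ((p - q) + z) * mo ((v' - q) - ((p - q) + z)) := by
          rw [mul_assoc, mo_mul, add_sub_cancel]
      _ = emb b c * emb b e2 * (mo (-v) * mo (v + (v' - q) - ((p - q) + z))) := by
        rw [this, mo_mul]; congr 2; abel
      _ = _ := by ring
  set w1 := emb b e1 * mo (v' + (v - p) - z)
  set w2 := emb b e2 * mo (v + (v' - q) - ((p - q) + z))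
  have g3 : D = dag σ C * dag σ w2 := by rw [← map_mul, ← g2, dag_dag hσ]
  have hD0 : D ≠ 0 := fun h0 => ha' (by rw [ea', h0, mul_zero])
  refine ⟨B, C, dag σ w2, w1, ea, ?_, ?_⟩
  · rw [mul_assoc, mul_comm (dag σ w2), ← g3, ea']
  · apply mul_left_cancel₀ hD0
    rw [mul_one]
    nth_rewrite 2 [g3]
    rw [g1]; ring
end ufd

end

section

abbrev R3 := MvPolynomial (Fin 3) ℝ
abbrev RE := AddMonoidAlgebra R3 E3
abbrev GE3 := AddMonoidAlgebra ℝ E3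

/-- linear form as polynomial -/
noncomputable def lin : E3 →+ R3 where
  toFun c := ∑ i, MvPolynomial.C (c i) * MvPolynomial.X i
  map_zero' := by simp
  map_add' c d := by simp [add_mul, Finset.sum_add_distrib]

lemma lin_def (c : E3) : lin c = ∑ i, MvPolynomial.C (c i) * MvPolynomial.X i := rfl

lemma eval_lin (c u : E3) : MvPolynomial.eval (fun i => u i) (lin c) = ⟪c, u⟫_ℝ := by
  rw [lin_def, map_sum, EuclideanSpace.inner_eq_star_dotProduct]
  simp [dotProduct, Fin.sum_univ_three]
  ring

/-- substitution of the curve -/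
noncomputable def psi (n b a : E3) : R3 →+* Polynomial ℝ :=
  MvPolynomial.eval₂Hom Polynomial.C
    (fun i => Polynomial.C (n i) + Polynomial.C (b i) * Polynomial.X +
      Polynomial.C (a i) * Polynomial.X ^ 2)

lemma psi_lin (n b a c : E3) : psi n b a (lin c) = Polynomial.C ⟪n, c⟫_ℝ +
    Polynomial.C ⟪b, c⟫_ℝ * Polynomial.X + Polynomial.C ⟪a, c⟫_ℝ * Polynomial.X ^ 2 := by
  have h : ∀ x : E3, ⟪x, c⟫_ℝ = ∑ i, c i * x i := by
    intro x
    rw [EuclideanSpace.inner_eq_star_dotProduct]; simp [dotProduct]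
  rw [lin_def, map_sum, h, h, h]
  simp only [psi, map_mul, MvPolynomial.coe_eval₂Hom, MvPolynomial.eval₂_C, MvPolynomial.eval₂_X,
    map_sum, Finset.sum_mul, ← Finset.sum_add_distrib]
  refine Finset.sum_congr rfl fun i _ => ?_
  ring

lemma psi_eval (n b a : E3) (r : R3) (ε : ℝ) : (psi n b a r).eval ε =
    MvPolynomial.eval (fun i => (n + ε • b + ε ^ 2 • a) i) r := by
  induction r using MvPolynomial.induction_on with
  | C r => simp [psi]
  | add p q hp hq => simp only [map_add, Polynomial.eval_add, hp, hq]
  | mul_X p i hp =>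
    simp only [map_mul, Polynomial.eval_mul, hp, MvPolynomial.eval_X]
    congr 1
    simp [psi]; ring

/-- the curve homomorphism -/
noncomputable def Psi (n b a : E3) : RE →+* Polynomial GE3 :=
  AddMonoidAlgebra.liftNCRingHom ((Polynomial.mapRingHom (algebraMap ℝ GE3)).comp (psi n b a))
    { toFun := fun v => Polynomial.C (mo v.toAdd)
      map_one' := by simp [mo_zero]
      map_mul' := fun v w => by rw [← map_mul, mo_mul, toAdd_mul] } (fun _ _ => Commute.all _ _)

lemma Psi_single (n b a v : E3) (r : R3) : Psi n b a (AddMonoidAlgebra.single v r) =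
    (psi n b a r).map (algebraMap ℝ GE3) * Polynomial.C (mo v) := by
  change AddMonoidAlgebra.liftNC _ _ _ = _
  rw [AddMonoidAlgebra.liftNC_single]
  rfl

lemma Psi_coeff (n b a v : E3) (x : RE) (j : ℕ) :
    ((Psi n b a x).coeff j).coeff v = (psi n b a (x.coeff v)).coeff j := by
  classical
  induction x using AddMonoidAlgebra.induction_linear with
  | zero => simp
  | add x y hx hy => simp [hx, hy]
  | single w r =>
    rw [Psi_single, Polynomial.coeff_mul_C, Polynomial.coeff_map, AddMonoidAlgebra.coeff_single]
    rw [mo, AddMonoidAlgebra.coe_algebraMap]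
    simp only [Function.comp, AddMonoidAlgebra.single_mul_single, zero_add, mul_one,
      AddMonoidAlgebra.coeff_single, Finsupp.single_apply]
    split_ifs <;> simp

/-- moments over R3 -/
noncomputable def mom (k : ℕ) (x : RE) : R3 := x.coeff.sum fun v r => r * lin v ^ k

lemma mom_eq (k : ℕ) (x : RE) : mom k x = AddMonoidAlgebra.liftNC ((RingHom.id R3 : R3 →+* R3) : R3 →+ R3)
    (fun v => lin v.toAdd ^ k) x := by
  rw [liftNC_eq_sum]; rfl

lemma mom0_mul (x y : RE) : mom 0 (x * y) = mom 0 x * mom 0 y := by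
  have := map_mul (AddMonoidAlgebra.liftNCRingHom (RingHom.id R3) (1 : Multiplicative E3 →* R3)
    (fun _ _ => Commute.all _ _)) x y
  rw [mom_eq, mom_eq, mom_eq]
  simp only [pow_zero]
  exact this

lemma mom1_mul (x y : RE) : mom 1 (x * y) = mom 1 x * mom 0 y + mom 0 x * mom 1 y := by
  have := leibniz (RingHom.id R3) (1 : Multiplicative E3 →* R3) lin x y
  simp only [mom_eq]
  simp only [pow_zero, pow_one]
  simp only [MonoidHom.one_apply, mul_one] at this
  exact this

lemma mom2_mul (x y : RE) : mom 2 (x * y) = mom 2 x * mom 0 y + 2 * (mom 1 x * mom 1 y) +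
    mom 0 x * mom 2 y := by
  have := leibniz2 (RingHom.id R3) lin x y
  simp only [mom_eq]
  simp only [pow_zero, pow_one]
  exact this

/-- No two factors can both have small order. -/
lemma mom_contra {x y : RE} (h0 : mom 0 (x * y) = 0) (h1 : mom 1 (x * y) = 0)
    (h2 : mom 2 (x * y) = 0) : (mom 0 x = 0 ∧ mom 1 x = 0) ∨ (mom 0 y = 0 ∧ mom 1 y = 0) := by
  rw [mom0_mul] at h0
  rw [mom1_mul] at h1
  rw [mom2_mul] at h2
  by_cases hx : mom 0 x = 0
  · by_cases hx1 : mom 1 x = 0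
    · exact Or.inl ⟨hx, hx1⟩
    · right
      rw [hx, zero_mul, add_zero] at h1
      have hy : mom 0 y = 0 := (mul_eq_zero.1 h1).resolve_left hx1
      rw [hx, hy] at h2
      refine ⟨hy, ?_⟩
      have : mom 1 x * mom 1 y = 0 := by simpa using h2
      exact (mul_eq_zero.1 this).resolve_left hx1
  · right
    have hy : mom 0 y = 0 := (mul_eq_zero.1 h0).resolve_left hx
    rw [hy, mul_zero, zero_add] at h1
    exact ⟨hy, (mul_eq_zero.1 h1).resolve_left hx⟩

/-- moments over ℝ -/
noncomputable def rmom (n : E3) (k : ℕ) (x : GE3) : ℝ := x.coeff.sum fun v r => r * ⟪n, v⟫_ℝ ^ k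

structure FlagData (V : Finset E3) (A : RE) (n b a : E3) (m : ℕ) (y : Polynomial GE3) (κ : ℝ)
    (W : GE3) (p1 p2 p3 p4 : E3) : Prop where
  κ0 : κ ≠ 0
  hA : Psi n b a A = Polynomial.X ^ m * y
  hT : y.coeff 0 = κ • (mo p1 - mo p2 - mo p3 + mo p4) + W
  h1 : p1 ∈ fc (fc (fc V n) b) a
  h2 : p2 ∈ fc (fc (fc V n) b) (-a)
  h3 : p3 ∈ fc (fc (fc V n) (-b)) a
  h4 : p4 ∈ fc (fc (fc V n) (-b)) (-a)
  hW : ∀ v ∈ sp W, ⟪n, v⟫_ℝ = -hs V (-n)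
  hW0 : rmom n 0 W = 0
  hv : p3 = p4 → ¬ Polynomial.X ^ (m + 2) ∣ psi n b a (A.coeff p3)

lemma exists_lead {k : Type*} [CommRing k] [IsDomain k] {f : Polynomial k} (hf : f ≠ 0) :
    ∃ m g, f = Polynomial.X ^ m * g ∧ g.coeff 0 ≠ 0 := by
  obtain ⟨g, h1, h2⟩ := Polynomial.exists_eq_pow_rootMultiplicity_mul_and_not_dvd f hf 0
  refine ⟨f.rootMultiplicity 0, g, ?_, ?_⟩
  · simpa using h1
  · intro h
    apply h2
    rw [map_zero, sub_zero]
    exact Polynomial.X_dvd_iff.2 h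

lemma lead_unique {k : Type*} [CommRing k] [IsDomain k] {f g : Polynomial k} {m l : ℕ}
    (h : Polynomial.X ^ m * f = Polynomial.X ^ l * g) (hf : f.coeff 0 ≠ 0) (hg : g.coeff 0 ≠ 0) :
    m = l ∧ f = g := by
  have key : m = l := by
    rcases lt_trichotomy m l with h1 | h1 | h1
    · exfalso
      have := congrArg (fun p => p.coeff m) h
      simp only [Polynomial.coeff_X_pow_mul'] at this
      rw [if_pos le_rfl, if_neg (by omega)] at this
      exact hf (by simpa using this)
    · exact h1
    · exfalso
      have := congrArg (fun p => p.coeff l) h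
      simp only [Polynomial.coeff_X_pow_mul'] at this
      rw [if_pos le_rfl, if_neg (by omega)] at this
      exact hg (by simpa using this.symm)
  subst key
  exact ⟨rfl, mul_left_cancel₀ (pow_ne_zero _ Polynomial.X_ne_zero) h⟩

lemma psi_mom (n b a : E3) (k : ℕ) (x : RE) {m : ℕ} {g : Polynomial GE3}
    (h : Psi n b a x = Polynomial.X ^ m * g) :
    (psi n b a (mom k x)).coeff m = rmom n k (g.coeff 0) := by
  classical
  have hg : ∀ v, ∃ f : Polynomial ℝ, psi n b a (x.coeff v) = Polynomial.X ^ m * f ∧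
      f.coeff 0 = (g.coeff 0).coeff v := by
    intro v
    have h1 : Polynomial.X ^ m ∣ psi n b a (x.coeff v) := by
      rw [Polynomial.X_pow_dvd_iff]
      intro d hd
      rw [← Psi_coeff, h, Polynomial.coeff_X_pow_mul', if_neg (by omega)]; simp
    obtain ⟨f, hf⟩ := h1
    refine ⟨f, hf, ?_⟩
    have h2 := Psi_coeff n b a v x m
    rw [hf, h, Polynomial.coeff_X_pow_mul', Polynomial.coeff_X_pow_mul', if_pos le_rfl] at h2
    simpa using h2.symm
  choose f hf1 hf2 using hg
  have hsub : (g.coeff 0).coeff.support ⊆ x.coeff.support := by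
    intro v hv
    rw [Finsupp.mem_support_iff] at hv ⊢
    intro h0
    have := hf1 v
    rw [h0, map_zero] at this
    have h3 := (mul_eq_zero.1 this.symm).resolve_left (pow_ne_zero _ Polynomial.X_ne_zero)
    rw [← hf2, h3] at hv
    exact hv (by simp)
  rw [mom, rmom, Finsupp.sum, map_sum, Polynomial.finset_sum_coeff, Finsupp.sum,
    Finset.sum_subset hsub]
  · refine Finset.sum_congr rfl fun v _ => ?_
    rw [map_mul, map_pow, psi_lin, hf1, mul_assoc, Polynomial.coeff_X_pow_mul', if_pos le_rfl,
      Nat.sub_self, Polynomial.mul_coeff_zero, hf2]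
    congr 1
    rw [Polynomial.coeff_zero_eq_eval_zero]
    simp
  · intro v _ hv
    rw [Finsupp.notMem_support_iff.1 hv, zero_mul]

/-- the leading parts of the factors -/
lemma flag_factor {V : Finset E3} {A B C : RE} {n b a : E3} {m : ℕ} {y : Polynomial GE3} {κ : ℝ}
    {W : GE3} {p1 p2 p3 p4 : E3} (h : FlagData V A n b a m y κ W p1 p2 p3 p4) (hABC : A = B * C)
    (hy : y.coeff 0 ≠ 0) :
    ∃ S T : GE3, S * T = κ • (mo p1 - mo p2 - mo p3 + mo p4) + W ∧ sp S ⊆ sp B ∧ sp T ⊆ sp C ∧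
      (mom 0 B = 0 → rmom n 0 S = 0) ∧ (mom 1 B = 0 → rmom n 1 S = 0) ∧
      (∀ q s, A.coeff p3 = B.coeff q * C.coeff s → p3 = p4 → q ∈ sp S ∨ s ∈ sp T) := by
  have hA0 : Psi n b a A ≠ 0 := by
    rw [h.hA]
    refine mul_ne_zero (pow_ne_zero _ Polynomial.X_ne_zero) ?_
    rintro rfl; simp at hy
  have hBC : Psi n b a B * Psi n b a C = Polynomial.X ^ m * y := by rw [← map_mul, ← hABC, h.hA]
  have hB0 : Psi n b a B ≠ 0 := fun h0 => hA0 (by rw [hABC, map_mul, h0, zero_mul])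
  have hC0 : Psi n b a C ≠ 0 := fun h0 => hA0 (by rw [hABC, map_mul, h0, mul_zero])
  obtain ⟨mB, B1, hB1, hB2⟩ := exists_lead hB0
  obtain ⟨mC, C1, hC1, hC2⟩ := exists_lead hC0
  have hu := lead_unique (m := mB + mC) (f := B1 * C1) (l := m) (g := y)
    (by rw [← hBC, hB1, hC1]; ring) (by rw [Polynomial.mul_coeff_zero]; exact mul_ne_zero hB2 hC2) hy
  have hsub : ∀ (x : RE) (mx : ℕ) (g : Polynomial GE3), Psi n b a x = Polynomial.X ^ mx * g →
      sp (g.coeff 0) ⊆ sp x := by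
    intro x mx g hx v hv
    rw [Finsupp.mem_support_iff] at hv ⊢
    intro h0
    apply hv
    have h2 := Psi_coeff n b a v x mx
    rw [hx, h0, Polynomial.coeff_X_pow_mul', if_pos le_rfl] at h2
    simpa using h2
  have hdiv : ∀ (x : RE) (mx : ℕ) (g : Polynomial GE3) (v : E3), Psi n b a x = Polynomial.X ^ mx * g →
      v ∉ sp (g.coeff 0) → Polynomial.X ^ (mx + 1) ∣ psi n b a (x.coeff v) := by
    intro x mx g v hx hv
    rw [Finsupp.notMem_support_iff] at hv
    rw [Polynomial.X_pow_dvd_iff]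
    intro d hd
    rw [← Psi_coeff, hx, Polynomial.coeff_X_pow_mul']
    split_ifs with h1
    · rw [show d - mx = 0 by omega, hv]
    · simp
  refine ⟨B1.coeff 0, C1.coeff 0, ?_, hsub _ _ _ hB1, hsub _ _ _ hC1, ?_, ?_, ?_⟩
  · rw [← Polynomial.mul_coeff_zero, hu.2, h.hT]
  · intro h0; rw [← psi_mom n b a 0 B hB1, h0]; simp
  · intro h0; rw [← psi_mom n b a 1 B hB1, h0]; simp
  · intro q s hqs h34
    by_contra hcon
    push Not at hcon
    apply h.hv h34
    rw [hqs, map_mul, ← hu.1, show mB + mC + 2 = (mB + 1) + (mC + 1) by ring, pow_add]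
    exact mul_dvd_mul (hdiv _ _ _ _ hB1 hcon.1) (hdiv _ _ _ _ hC1 hcon.2)

end

section

/-- `X` is the Minkowski sum of `Y` and `Z` -/
def MSum (X Y Z : Finset E3) : Prop := X.Nonempty ∧ Y.Nonempty ∧ Z.Nonempty ∧
  ∀ w, hs X w = hs Y w + hs Z w

lemma MSum.fc {X Y Z : Finset E3} (h : MSum X Y Z) (n : E3) : MSum (fc X n) (fc Y n) (fc Z n) := by
  obtain ⟨hX, hY, hZ, h⟩ := h
  refine ⟨fc_nonempty hX n, fc_nonempty hY n, fc_nonempty hZ n, fun η => ?_⟩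
  obtain ⟨d1, hd1, H1⟩ := hs_local hX n
  obtain ⟨d2, hd2, H2⟩ := hs_local hY n
  obtain ⟨d3, hd3, H3⟩ := hs_local hZ n
  set d := min d1 (min d2 d3) with hd
  have hd0 : 0 < d := lt_min hd1 (lt_min hd2 hd3)
  set t := d / (‖η‖ + 1) with ht
  have hn : 0 < ‖η‖ + 1 := by positivity
  have ht0 : 0 < t := div_pos hd0 hn
  have hsm : ‖t • η‖ < d := by
    rw [norm_smul, Real.norm_of_nonneg ht0.le, ht, div_mul_eq_mul_div, div_lt_iff₀ hn]
    nlinarith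
  have e1 := (H1 (t • η) (hsm.trans_le (min_le_left _ _))).1
  have e2 := (H2 (t • η) (hsm.trans_le ((min_le_right _ _).trans (min_le_left _ _)))).1
  have e3 := (H3 (t • η) (hsm.trans_le ((min_le_right _ _).trans (min_le_right _ _)))).1
  rw [hs_smul (fc_nonempty hX n) ht0] at e1
  rw [hs_smul (fc_nonempty hY n) ht0] at e2
  rw [hs_smul (fc_nonempty hZ n) ht0] at e3
  have e4 := h (n + t • η)
  have e5 := h n
  have : t * hs (_root_.fc X n) η = t * (hs (_root_.fc Y n) η + hs (_root_.fc Z n) η) := by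
    rw [mul_add]; linarith
  exact mul_left_cancel₀ ht0.ne' this

lemma MSum.swap {X Y Z : Finset E3} (h : MSum X Y Z) : MSum X Z Y :=
  ⟨h.1, h.2.2.1, h.2.1, fun w => by rw [h.2.2.2, add_comm]⟩

lemma MSum.wd {X Y Z : Finset E3} (h : MSum X Y Z) (a : E3) : wd a X = wd a Y + wd a Z := by
  simp only [_root_.wd, h.2.2.2]; ring

lemma msum_mul {k : Type*} [CommRing k] [IsDomain k] {x y : AddMonoidAlgebra k E3} (hx : x ≠ 0)
    (hy : y ≠ 0) : MSum (sp (x * y)) (sp x) (sp y) :=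
  ⟨supp_nonempty (mul_ne_zero hx hy), supp_nonempty hx, supp_nonempty hy, hs_mul hx hy⟩

/-- squeeze -/
lemma squeeze {X Y Z X' Y' Z' : Finset E3} (h : MSum X Y Z) (h' : MSum X' Y' Z') (hY : Y' ⊆ Y)
    (hZ : Z' ⊆ Z) {w : E3} (hw : hs X' w = hs X w) :
    hs Y' w = hs Y w ∧ hs Z' w = hs Z w ∧ fc Y' w ⊆ fc Y w ∧ fc Z' w ⊆ fc Z w := by
  have h1 := hs_mono h'.2.1 hY w
  have h2 := hs_mono h'.2.2.1 hZ w
  have h3 := h.2.2.2 w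
  have h4 := h'.2.2.2 w
  have e1 : hs Y' w = hs Y w := by linarith
  have e2 : hs Z' w = hs Z w := by linarith
  refine ⟨e1, e2, fun v hv => ?_, fun v hv => ?_⟩
  · rw [mem_fc] at hv ⊢; exact ⟨hY hv.1, hv.2.trans e1⟩
  · rw [mem_fc] at hv ⊢; exact ⟨hZ hv.1, hv.2.trans e2⟩

lemma mo_coeff {k : Type*} [CommRing k] [DecidableEq E3] (p v : E3) :
    (mo p : AddMonoidAlgebra k E3).coeff v = if p = v then 1 else 0 := by
  rw [mo, AddMonoidAlgebra.coeff_single, Finsupp.single_apply]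

/-- levels of the four points -/
structure Quad (V : Finset E3) (n b a p1 p2 p3 p4 : E3) : Prop where
  n1 : ⟪n, p1⟫_ℝ = hs V n
  n2 : ⟪n, p2⟫_ℝ = hs V n
  n3 : ⟪n, p3⟫_ℝ = hs V n
  n4 : ⟪n, p4⟫_ℝ = hs V n
  b1 : ⟪b, p1⟫_ℝ = hs (fc V n) b
  b2 : ⟪b, p2⟫_ℝ = hs (fc V n) b
  b3 : ⟪b, p3⟫_ℝ = -hs (fc V n) (-b)
  b4 : ⟪b, p4⟫_ℝ = -hs (fc V n) (-b)
  a1 : ⟪a, p1⟫_ℝ = hs (fc (fc V n) b) a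
  a2 : ⟪a, p2⟫_ℝ = -hs (fc (fc V n) b) (-a)
  a3 : ⟪a, p3⟫_ℝ = hs (fc (fc V n) (-b)) a
  a4 : ⟪a, p4⟫_ℝ = -hs (fc (fc V n) (-b)) (-a)

lemma FlagData.quad {V : Finset E3} {A : RE} {n b a : E3} {m : ℕ} {y : Polynomial GE3} {κ : ℝ}
    {W : GE3} {p1 p2 p3 p4 : E3} (h : FlagData V A n b a m y κ W p1 p2 p3 p4) :
    Quad V n b a p1 p2 p3 p4 := by
  obtain ⟨-, -, -, h1, h2, h3, h4, -, -, -⟩ := h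
  simp only [mem_fc, inner_neg_left] at h1 h2 h3 h4
  constructor <;> linarith [h1.1.1.2, h1.1.2, h1.2, h2.1.1.2, h2.1.2, h2.2, h3.1.1.2, h3.1.2, h3.2,
    h4.1.1.2, h4.1.2, h4.2]

lemma sp_quad {κ : ℝ} (hκ : κ ≠ 0) {p1 p2 p3 p4 : E3} (h12 : p1 ≠ p2) (h13 : p1 ≠ p3)
    (h14 : p1 ≠ p4) (h23 : p2 ≠ p3) (h24 : p2 ≠ p4) (h34 : p3 ≠ p4) (v : E3) :
    v ∈ sp (κ • (mo p1 - mo p2 - mo p3 + mo p4) : GE3) ↔ v = p1 ∨ v = p2 ∨ v = p3 ∨ v = p4 := by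
  classical
  rw [Finsupp.mem_support_iff]
  simp only [AddMonoidAlgebra.coeff_smul, AddMonoidAlgebra.coeff_add, AddMonoidAlgebra.coeff_sub,
    Finsupp.smul_apply, Finsupp.add_apply, Finsupp.sub_apply, mo_coeff, smul_eq_mul, ne_eq, mul_eq_zero, hκ, false_or]
  grind

lemma sp_pair {κ : ℝ} (hκ : κ ≠ 0) {p1 p2 : E3} (h12 : p1 ≠ p2) (v : E3) :
    v ∈ sp (κ • (mo p1 - mo p2) : GE3) ↔ v = p1 ∨ v = p2 := by
  classical
  rw [Finsupp.mem_support_iff]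
  simp only [AddMonoidAlgebra.coeff_smul, AddMonoidAlgebra.coeff_add, AddMonoidAlgebra.coeff_sub,
    Finsupp.smul_apply, Finsupp.add_apply, Finsupp.sub_apply, mo_coeff, smul_eq_mul, ne_eq, mul_eq_zero, hκ, false_or]
  grind

lemma Quad.dist {V : Finset E3} {n b a p1 p2 p3 p4 : E3} (h : Quad V n b a p1 p2 p3 p4)
    (hb : 0 < wd b (fc V n)) (ha : 0 < wd a (fc (fc V n) b)) :
    p1 ≠ p2 ∧ p1 ≠ p3 ∧ p1 ≠ p4 ∧ p2 ≠ p3 ∧ p2 ≠ p4 := by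
  have e1 := h.b1; have e2 := h.b2; have e3 := h.b3; have e4 := h.b4
  have f1 := h.a1; have f2 := h.a2
  unfold wd at hb ha
  refine ⟨?_, ?_, ?_, ?_, ?_⟩ <;> rintro rfl <;> linarith

lemma Quad.eq34 {V : Finset E3} {n b a p1 p2 p3 p4 : E3} (h : Quad V n b a p1 p2 p3 p4)
    (hon : ON n b a) : p3 = p4 ↔ wd a (fc (fc V n) (-b)) = 0 := by
  have f3 := h.a3; have f4 := h.a4
  unfold wd
  constructor
  · rintro rfl; linarith
  · intro h0
    rw [hon.expand p3, hon.expand p4, h.n3, h.n4, h.b3, h.b4]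
    congr 2
    linarith

/-- data extracted for the `n`-tops -/
lemma flag_top {V : Finset E3} (hV : V.Nonempty) {A B C : RE} {n b a : E3} {m : ℕ}
    {y : Polynomial GE3} {κ : ℝ} {W : GE3} {p1 p2 p3 p4 : E3}
    (h : FlagData V A n b a m y κ W p1 p2 p3 p4) (hABC : A = B * C) (hA : MSum V (sp B) (sp C))
    (hn : 0 < wd n V) (hb : 0 < wd b (fc V n)) (ha : 0 < wd a (fc (fc V n) b)) :
    ∃ S T : GE3, S * T = κ • (mo p1 - mo p2 - mo p3 + mo p4) + W ∧
      tp n S * tp n T = κ • (mo p1 - mo p2 - mo p3 + mo p4) ∧ tp n S ≠ 0 ∧ tp n T ≠ 0 ∧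
      sp (tp n S) ⊆ fc (sp B) n ∧ sp (tp n T) ⊆ fc (sp C) n ∧
      (∀ q ∈ fc (sp B) n, q ∈ sp S → q ∈ sp (tp n S)) ∧
      (∀ q ∈ fc (sp C) n, q ∈ sp T → q ∈ sp (tp n T)) ∧
      (mom 0 B = 0 → rmom n 0 S = 0) ∧ (mom 1 B = 0 → rmom n 1 S = 0) ∧
      (∀ q s, A.coeff p3 = B.coeff q * C.coeff s → p3 = p4 → q ∈ sp S ∨ s ∈ sp T) := by
  classical
  have hq := h.quad
  obtain ⟨d12, d13, d14, d23, d24⟩ := hq.dist hb ha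
  have hWlt : ∀ v ∈ sp W, ⟪n, v⟫_ℝ < hs V n := by
    intro v hv
    rw [h.hW v hv]; unfold wd at hn; linarith
  have hW1 : W.coeff p1 = 0 := by
    by_contra hc
    have := hWlt p1 (Finsupp.mem_support_iff.2 hc)
    rw [hq.n1] at this; exact lt_irrefl _ this
  set z : GE3 := κ • (mo p1 - mo p2 - mo p3 + mo p4) with hz
  have hzn : ∀ v ∈ sp z, ⟪n, v⟫_ℝ = hs V n := by
    intro v hv
    rw [hz, Finsupp.mem_support_iff] at hv
    simp only [AddMonoidAlgebra.coeff_smul, AddMonoidAlgebra.coeff_add, AddMonoidAlgebra.coeff_sub,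
      Finsupp.smul_apply, Finsupp.add_apply, Finsupp.sub_apply, mo_coeff] at hv
    have h1 := hq.n1; have h2 := hq.n2; have h3 := hq.n3; have h4 := hq.n4
    have : v = p1 ∨ v = p2 ∨ v = p3 ∨ v = p4 := by
      by_contra hc
      push Not at hc
      obtain ⟨c1, c2, c3, c4⟩ := hc
      rw [if_neg c1.symm, if_neg c2.symm, if_neg c3.symm, if_neg c4.symm] at hv
      simp at hv
    rcases this with rfl | rfl | rfl | rfl <;> assumption
  have hp1 : (z + W).coeff p1 ≠ 0 := by
    rw [AddMonoidAlgebra.coeff_add, Finsupp.add_apply, hW1, add_zero, hz]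
    simp only [AddMonoidAlgebra.coeff_smul, AddMonoidAlgebra.coeff_add, AddMonoidAlgebra.coeff_sub,
      Finsupp.smul_apply, Finsupp.add_apply, Finsupp.sub_apply, mo_coeff]
    simp [d12.symm, d13.symm, d14.symm, h.κ0]
  have hy : y.coeff 0 ≠ 0 := by
    rw [h.hT]; intro h0; rw [← hz] at h0; rw [h0] at hp1; simp at hp1
  obtain ⟨S, T, hST, hS, hT, m0, m1, hv⟩ := flag_factor h hABC hy
  rw [← hz] at hST
  have hST0 : S * T ≠ 0 := by rw [hST, hz, ← h.hT]; exact hy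
  have hS0 := left_ne_zero_of_mul hST0
  have hT0 := right_ne_zero_of_mul hST0
  have htop : hs (sp (S * T)) n = hs V n := by
    rw [hST]
    refine hs_eq (v := p1) (fun v hv => ?_) (Finsupp.mem_support_iff.2 hp1) hq.n1
    rcases Finset.mem_union.1 (Finsupp.support_add hv) with h1 | h1
    · exact (hzn v h1).le
    · exact (hWlt v h1).le
  have sq := squeeze hA (msum_mul hS0 hT0) hS hT htop
  refine ⟨S, T, hST, ?_, tp_ne_zero hS0, tp_ne_zero hT0, ?_, ?_, ?_, ?_, m0, m1, hv⟩
  · rw [← tp_mul hS0 hT0, tp, htop, hST, topAt_add, topAt_self hzn, topAt_zero_of_lt hWlt, add_zero]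
  · rw [sp_tp]; exact sq.2.2.1
  · rw [sp_tp]; exact sq.2.2.2
  · intro q hq1 hq2
    rw [sp_tp, mem_fc, sq.1]; exact ⟨hq2, (mem_fc.1 hq1).2⟩
  · intro q hq1 hq2
    rw [sp_tp, mem_fc, sq.2.1]; exact ⟨hq2, (mem_fc.1 hq1).2⟩

/-- heights agree with those of `F` -/
lemma quad_hs {V : Finset E3} {n b a p1 p2 p3 p4 : E3} {κ : ℝ} (hκ : κ ≠ 0)
    (hq : Quad V n b a p1 p2 p3 p4) (hb : 0 < wd b (fc V n)) (ha : 0 < wd a (fc (fc V n) b)) :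
    hs (sp (κ • (mo p1 - mo p2 - mo p3 + mo p4) : GE3)) b = hs (fc V n) b ∧
    hs (fc (sp (κ • (mo p1 - mo p2 - mo p3 + mo p4) : GE3)) b) a = hs (fc (fc V n) b) a ∧
    hs (fc (sp (κ • (mo p1 - mo p2 - mo p3 + mo p4) : GE3)) b) (-a) = hs (fc (fc V n) b) (-a) := by
  obtain ⟨d12, d13, d14, d23, d24⟩ := hq.dist hb ha
  have hsp : ∀ v, v ∈ sp (κ • (mo p1 - mo p2 - mo p3 + mo p4) : GE3) → v = p1 ∨ v = p2 ∨
      (⟪b, v⟫_ℝ < hs (fc V n) b) := by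
    intro v hv
    have hb' := hb; unfold wd at hb'
    have e3 := hq.b3; have e4 := hq.b4
    by_cases h34 : p3 = p4
    · subst h34
      rw [sub_add_cancel, sp_pair hκ d12] at hv
      tauto
    · rw [sp_quad hκ d12 d13 d14 d23 d24 h34] at hv
      rcases hv with rfl | rfl | rfl | rfl
      · tauto
      · tauto
      · right; right; linarith
      · right; right; linarith
  have hm1 : p1 ∈ sp (κ • (mo p1 - mo p2 - mo p3 + mo p4) : GE3) := by
    by_cases h34 : p3 = p4
    · subst h34; rw [sub_add_cancel, sp_pair hκ d12]; tauto
    · rw [sp_quad hκ d12 d13 d14 d23 d24 h34]; tauto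
  have hm2 : p2 ∈ sp (κ • (mo p1 - mo p2 - mo p3 + mo p4) : GE3) := by
    by_cases h34 : p3 = p4
    · subst h34; rw [sub_add_cancel, sp_pair hκ d12]; tauto
    · rw [sp_quad hκ d12 d13 d14 d23 d24 h34]; tauto
  have k1 : hs (sp (κ • (mo p1 - mo p2 - mo p3 + mo p4) : GE3)) b = hs (fc V n) b := by
    refine hs_eq (fun v hv => ?_) hm1 hq.b1
    rcases hsp v hv with rfl | rfl | h
    · exact hq.b1.le
    · exact hq.b2.le
    · exact h.le
  have hf : ∀ v ∈ fc (sp (κ • (mo p1 - mo p2 - mo p3 + mo p4) : GE3)) b, v = p1 ∨ v = p2 := by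
    intro v hv
    rw [mem_fc, k1] at hv
    rcases hsp v hv.1 with h | h | h
    · exact Or.inl h
    · exact Or.inr h
    · linarith [hv.2]
  have hf1 : p1 ∈ fc (sp (κ • (mo p1 - mo p2 - mo p3 + mo p4) : GE3)) b := by
    rw [mem_fc, k1]; exact ⟨hm1, hq.b1⟩
  have hf2 : p2 ∈ fc (sp (κ • (mo p1 - mo p2 - mo p3 + mo p4) : GE3)) b := by
    rw [mem_fc, k1]; exact ⟨hm2, hq.b2⟩
  have f1 := hq.a1; have f2 := hq.a2
  unfold wd at ha
  refine ⟨k1, hs_eq (fun v hv => ?_) hf1 hq.a1, hs_eq (fun v hv => ?_) hf2 ?_⟩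
  · rcases hf v hv with rfl | rfl <;> linarith
  · rw [inner_neg_left]
    rcases hf v hv with rfl | rfl <;> linarith
  · rw [inner_neg_left]; linarith

lemma Quad.neg {V : Finset E3} {n b a p1 p2 p3 p4 : E3} (h : Quad V n b a p1 p2 p3 p4) :
    Quad V n (-b) a p3 p4 p1 p2 := by
  obtain ⟨h1, h2, h3, h4, h5, h6, h7, h8, h9, h10, h11, h12⟩ := h
  constructor <;> (try simp only [inner_neg_left, neg_neg]) <;> linarith

lemma quad_neg_eq (κ : ℝ) (p1 p2 p3 p4 : E3) : (κ • (mo p1 - mo p2 - mo p3 + mo p4) : GE3) =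
    (-κ) • (mo p3 - mo p4 - mo p1 + mo p2) := by
  module

end

section

/-- exponential character -/
noncomputable def ech (ξ : ℂ) (a : E3) : Multiplicative E3 →* ℂ where
  toFun v := Complex.exp (ξ * (⟪a, v.toAdd⟫_ℝ : ℝ))
  map_one' := by simp
  map_mul' v w := by
    rw [toAdd_mul, inner_add_right, ← Complex.exp_add]; congr 1; push_cast; ring

noncomputable def eev (ξ : ℂ) (a : E3) : GE3 →+* ℂ :=
  AddMonoidAlgebra.liftNCRingHom Complex.ofRealHom (ech ξ a) (fun _ _ => Commute.all _ _)

noncomputable def lch (ξ : ℂ) (a b : E3) : Multiplicative E3 →* AddMonoidAlgebra ℂ ℝ where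
  toFun v := AddMonoidAlgebra.single ⟪b, v.toAdd⟫_ℝ (ech ξ a v)
  map_one' := by simp [AddMonoidAlgebra.one_def]
  map_mul' v w := by
    rw [AddMonoidAlgebra.single_mul_single, toAdd_mul, inner_add_right, map_mul]

/-- level homomorphism -/
noncomputable def lev (ξ : ℂ) (a b : E3) : GE3 →+* AddMonoidAlgebra ℂ ℝ :=
  AddMonoidAlgebra.liftNCRingHom (AddMonoidAlgebra.singleZeroRingHom.comp Complex.ofRealHom)
    (lch ξ a b) (fun _ _ => Commute.all _ _)

lemma eev_single (ξ : ℂ) (a v : E3) (r : ℝ) : eev ξ a (AddMonoidAlgebra.single v r) =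
    (r : ℂ) * Complex.exp (ξ * (⟪a, v⟫_ℝ : ℝ)) := by
  change AddMonoidAlgebra.liftNC _ _ _ = _
  rw [AddMonoidAlgebra.liftNC_single]; rfl

lemma lev_single (ξ : ℂ) (a b v : E3) (r : ℝ) : lev ξ a b (AddMonoidAlgebra.single v r) =
    AddMonoidAlgebra.single ⟪b, v⟫_ℝ ((r : ℂ) * Complex.exp (ξ * (⟪a, v⟫_ℝ : ℝ))) := by
  change AddMonoidAlgebra.liftNC _ _ _ = _
  rw [AddMonoidAlgebra.liftNC_single]
  change AddMonoidAlgebra.single 0 (r : ℂ) * AddMonoidAlgebra.single ⟪b, v⟫_ℝ _ = _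
  rw [AddMonoidAlgebra.single_mul_single, zero_add]; rfl

lemma topAt_single {k M : Type*} [CommRing k] [AddCommGroup M] (L : M → ℝ) (d : ℝ) (v : M) (r : k)
    [Decidable (L v = d)] :
    topAt L d (AddMonoidAlgebra.single v r) = if L v = d then AddMonoidAlgebra.single v r else 0 := by
  split_ifs with h
  · apply topAt_self
    intro w hw
    rw [AddMonoidAlgebra.coeff_single] at hw
    rw [Finset.mem_singleton.1 (Finsupp.support_single_subset hw), h]
  · classical
    ext w
    rw [topAt_coeff, AddMonoidAlgebra.coeff_single, Finsupp.single_apply]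
    split_ifs with h1 h2
    · subst h2; exact absurd h1 h
    · simp
    · simp

lemma lev_coeff (ξ : ℂ) (a b : E3) (l : ℝ) (x : GE3) : (lev ξ a b x).coeff l =
    eev ξ a (topAt (fun v => ⟪b, v⟫_ℝ) l x) := by
  classical
  induction x using AddMonoidAlgebra.induction_linear with
  | zero => rw [topAt_zero_of_lt (by simp)]; simp
  | add x y hx hy => simp [hx, hy, topAt_add]
  | single w r =>
    rw [lev_single, topAt_single, AddMonoidAlgebra.coeff_single, Finsupp.single_apply]
    split_ifs
    · rw [eev_single]
    · simp

lemma eev_mo (ξ : ℂ) (a v : E3) : eev ξ a (mo v) = Complex.exp (ξ * (⟪a, v⟫_ℝ : ℝ)) := by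
  rw [mo, eev_single]; simp

lemma lev_mo (ξ : ℂ) (a b v : E3) : lev ξ a b (mo v) = AddMonoidAlgebra.single ⟪b, v⟫_ℝ
    (Complex.exp (ξ * (⟪a, v⟫_ℝ : ℝ))) := by
  rw [mo, lev_single]; simp

lemma lev_supp {ξ : ℂ} {a b : E3} {l : ℝ} {x : GE3} (h : (lev ξ a b x).coeff l ≠ 0) :
    ∃ v ∈ sp x, ⟪b, v⟫_ℝ = l := by
  rw [lev_coeff] at h
  have h0 : topAt (fun v => ⟪b, v⟫_ℝ) l x ≠ 0 := by
    intro h0; rw [h0, map_zero] at h; exact h rfl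
  obtain ⟨v, hv⟩ := supp_nonempty h0
  exact ⟨v, topAt_supp.1 hv⟩

/-- the two-edge argument -/
lemma two_edges {x y : GE3} {κ : ℝ} (hκ : κ ≠ 0) {p1 p2 p3 p4 a b : E3} {β1 β2 l1 l2 : ℝ}
    (b1 : ⟪b, p1⟫_ℝ = β1) (b2 : ⟪b, p2⟫_ℝ = β1) (b3 : ⟪b, p3⟫_ℝ = β2) (b4 : ⟪b, p4⟫_ℝ = β2)
    (hβ : β2 < β1) (hl1 : ⟪a, p1⟫_ℝ = ⟪a, p2⟫_ℝ + l1) (hl2 : ⟪a, p3⟫_ℝ = ⟪a, p4⟫_ℝ + l2)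
    (h2 : 0 < l2) (h21 : l2 < l1) (hxy : x * y = κ • (mo p1 - mo p2 - mo p3 + mo p4)) :
    wd b (sp x) = 0 ∨ wd b (sp y) = 0 := by
  classical
  by_contra hcon
  push Not at hcon
  have hl10 : (l1 : ℂ) ≠ 0 := by exact_mod_cast (h2.trans h21).ne'
  set ξ : ℂ := 2 * Real.pi * Complex.I / l1 with hξ
  have hpi : (2 * Real.pi * Complex.I : ℂ) ≠ 0 := Complex.two_pi_I_ne_zero
  have e12 : Complex.exp (ξ * (⟪a, p1⟫_ℝ : ℝ)) = Complex.exp (ξ * (⟪a, p2⟫_ℝ : ℝ)) := by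
    rw [hl1]; push_cast
    rw [mul_add, Complex.exp_add]
    have : ξ * (l1 : ℂ) = 2 * Real.pi * Complex.I := by rw [hξ]; field_simp
    rw [this, Complex.exp_two_pi_mul_I, mul_one]
  have e34 : Complex.exp (ξ * (⟪a, p3⟫_ℝ : ℝ)) ≠ Complex.exp (ξ * (⟪a, p4⟫_ℝ : ℝ)) := by
    rw [hl2]; push_cast
    rw [mul_add, Complex.exp_add]
    intro h
    have h3 : Complex.exp (ξ * (l2 : ℂ)) = 1 :=
      mul_left_cancel₀ (Complex.exp_ne_zero _) (h.trans (mul_one _).symm)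
    rw [Complex.exp_eq_one_iff] at h3
    obtain ⟨N, hN⟩ := h3
    have h4 : (l2 : ℂ) = N * l1 := by
      rw [hξ] at hN
      field_simp at hN
      have h5 : (2 * Real.pi * Complex.I : ℂ) * l2 = (2 * Real.pi * Complex.I : ℂ) * (N * l1) := by
        linear_combination (2 * Real.pi * Complex.I : ℂ) * hN
      exact mul_left_cancel₀ hpi h5
    have h5 : l2 = N * l1 := by exact_mod_cast h4
    have h6 : (0 : ℝ) < N := by
      by_contra hc; push Not at hc; nlinarith
    have h7 : (N : ℝ) < 1 := by
      by_contra hc; push Not at hc; nlinarith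
    have h8 : 0 < N := by exact_mod_cast h6
    have h9 : N < 1 := by exact_mod_cast h7
    omega
  have hlz : lev ξ a b (x * y) = AddMonoidAlgebra.single β2 ((κ : ℂ) *
      (Complex.exp (ξ * (⟪a, p4⟫_ℝ : ℝ)) - Complex.exp (ξ * (⟪a, p3⟫_ℝ : ℝ)))) := by
    have hs : ∀ z : GE3, κ • z = AddMonoidAlgebra.single 0 κ * z := by
      intro z; ext v; simp
    rw [hxy, hs, map_mul, lev_single, map_add, map_sub, map_sub, lev_mo, lev_mo, lev_mo, lev_mo, b1, b2,
      b3, b4, e12, sub_self, zero_sub, neg_add_eq_sub, ← AddMonoidAlgebra.single_sub,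
      AddMonoidAlgebra.single_mul_single]
    simp
  have hne : (κ : ℂ) * (Complex.exp (ξ * (⟪a, p4⟫_ℝ : ℝ)) - Complex.exp (ξ * (⟪a, p3⟫_ℝ : ℝ))) ≠ 0 :=
    mul_ne_zero (by exact_mod_cast hκ) (sub_ne_zero.2 e34.symm)
  have hne' : lev ξ a b x * lev ξ a b y ≠ 0 := by
    rw [← map_mul, hlz]; simpa using hne
  obtain ⟨p, q, hpq, hp, hq, hp', hq'⟩ := mono_of_mul hne' (l := β2) (by
    rw [← map_mul, hlz]
    intro v hv
    rw [AddMonoidAlgebra.coeff_single] at hv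
    exact Finset.mem_singleton.1 (Finsupp.support_single_subset hv))
  have hxy0 : x * y ≠ 0 := by
    intro h0; rw [← map_mul, h0, map_zero] at hne'; exact hne' rfl
  have hx0 := left_ne_zero_of_mul hxy0
  have hy0 := right_ne_zero_of_mul hxy0
  -- heights of z
  have hspz : ∀ v ∈ sp (x * y), v = p1 ∨ v = p2 ∨ v = p3 ∨ v = p4 := by
    intro v hv
    rw [hxy, Finsupp.mem_support_iff] at hv
    simp only [AddMonoidAlgebra.coeff_smul, AddMonoidAlgebra.coeff_add, AddMonoidAlgebra.coeff_sub,
      Finsupp.smul_apply, Finsupp.add_apply, Finsupp.sub_apply, mo_coeff] at hv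
    by_contra hc
    push Not at hc
    obtain ⟨c1, c2, c3, c4⟩ := hc
    rw [if_neg c1.symm, if_neg c2.symm, if_neg c3.symm, if_neg c4.symm] at hv
    simp at hv
  have hbot : hs (sp (x * y)) (-b) ≤ -β2 := by
    apply hs_le (supp_nonempty hxy0)
    intro v hv
    rw [inner_neg_left]
    rcases hspz v hv with rfl | rfl | rfl | rfl <;> linarith
  rw [hs_mul hx0 hy0] at hbot
  have hpl : -hs (sp x) (-b) ≤ p := by
    obtain ⟨v, hv, e⟩ := lev_supp (Finsupp.mem_support_iff.1 hp')
    have := le_hs hv (-b); rw [inner_neg_left] at this; linarith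
  have hql : -hs (sp y) (-b) ≤ q := by
    obtain ⟨v, hv, e⟩ := lev_supp (Finsupp.mem_support_iff.1 hq')
    have := le_hs hv (-b); rw [inner_neg_left] at this; linarith
  have ex : eev ξ a (tp b x) = 0 := by
    rw [tp, ← lev_coeff]
    by_contra h0
    have := hp _ (Finsupp.mem_support_iff.2 h0)
    apply hcon.1; unfold wd; linarith
  have ey : eev ξ a (tp b y) = 0 := by
    rw [tp, ← lev_coeff]
    by_contra h0
    have := hq _ (Finsupp.mem_support_iff.2 h0)
    apply hcon.2; unfold wd; linarith
  have hd12 : p1 ≠ p2 := by rintro rfl; linarith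
  have htop : tp b (x * y) = κ • (mo p1 - mo p2) := by
    have hh : hs (sp (x * y)) b = β1 := by
      refine hs_eq (v := p1) (fun v hv => ?_) ?_ b1
      · rcases hspz v hv with rfl | rfl | rfl | rfl <;> linarith
      · rw [hxy, Finsupp.mem_support_iff]
        have d13 : p3 ≠ p1 := by rintro rfl; linarith
        have d14 : p4 ≠ p1 := by rintro rfl; linarith
        simp [mo_coeff, hd12.symm, d13, d14, hκ]
    rw [tp, hh, hxy]
    have e : (κ • (mo p1 - mo p2 - mo p3 + mo p4) : GE3) = κ • (mo p1 - mo p2) + κ • (mo p4 - mo p3) := by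
      module
    rw [e, topAt_add, topAt_self, topAt_zero_of_lt, add_zero]
    · intro v hv
      have : v = p4 ∨ v = p3 := by
        by_contra hc
        push Not at hc
        rw [Finsupp.mem_support_iff] at hv
        simp [mo_coeff, hc.1.symm, hc.2.symm] at hv
      rcases this with rfl | rfl <;> linarith
    · intro v hv
      rw [sp_pair hκ hd12] at hv
      rcases hv with rfl | rfl <;> linarith
  have hL := leibniz Complex.ofRealHom (ech ξ a)
    (Complex.ofRealHom.toAddMonoidHom.comp (innerₗ E3 a).toAddMonoidHom) (tp b x) (tp b y)
  have f1 : ∀ z, AddMonoidAlgebra.liftNC ((Complex.ofRealHom : ℝ →+* ℂ) : ℝ →+ ℂ) (ech ξ a) z = eev ξ a z :=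
    fun z => rfl
  rw [f1, f1, ex, ey, mul_zero, zero_mul, add_zero, ← tp_mul hx0 hy0, htop] at hL
  have hsm : (κ • (mo p1 - mo p2) : GE3) = AddMonoidAlgebra.single p1 κ - AddMonoidAlgebra.single p2 κ := by
    simp [mo, smul_sub]
  rw [hsm, map_sub, AddMonoidAlgebra.liftNC_single, AddMonoidAlgebra.liftNC_single] at hL
  change (κ : ℂ) * (((⟪a, p1⟫_ℝ : ℝ) : ℂ) * Complex.exp (ξ * (⟪a, p1⟫_ℝ : ℝ))) -
    (κ : ℂ) * (((⟪a, p2⟫_ℝ : ℝ) : ℂ) * Complex.exp (ξ * (⟪a, p2⟫_ℝ : ℝ))) = 0 at hL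
  rw [e12, ← mul_sub, ← sub_mul] at hL
  have h1 : ((⟪a, p1⟫_ℝ : ℝ) : ℂ) - ((⟪a, p2⟫_ℝ : ℝ) : ℂ) = l1 := by
    rw [hl1]; push_cast; ring
  rw [h1] at hL
  rcases mul_eq_zero.1 hL with h | h
  · exact hκ (by exact_mod_cast h)
  · rcases mul_eq_zero.1 h with h | h
    · exact hl10 h
    · exact Complex.exp_ne_zero _ h

end

section

structure AlgHyp (V : Finset E3) (A B C : RE) : Prop where
  hABC : A = B * C
  hA : MSum V (sp B) (sp C)
  pos : ∀ n : E3, ⟪n, n⟫_ℝ = 1 → 0 < wd n V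
  flag : ∀ n b a : E3, ON n b a → 0 < wd b (fc V n) → 0 < wd a (fc (fc V n) b) →
    ∃ m y κ W p1 p2 p3 p4, FlagData V A n b a m y κ W p1 p2 p3 p4

lemma AlgHyp.swap {V : Finset E3} {A B C : RE} (h : AlgHyp V A B C) : AlgHyp V A C B :=
  ⟨by rw [h.hABC, mul_comm], h.hA.swap, h.pos, h.flag⟩

lemma fc_eq_of_wd {b : E3} {V : Finset E3} (hV : V.Nonempty) (h : wd b V = 0) :
    fc V b = fc V (-b) := by
  have h1 := (wd_eq_zero hV).1 h
  rw [fc_const h1, fc_const (w := -b)]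
  intro x hx y hy
  rw [inner_neg_left, inner_neg_left, h1 x hx y hy]

/-- collapse to a point -/
lemma fc3_singleton {V : Finset E3} (hV : V.Nonempty) {n b a p : E3} (hon : ON n b a)
    (h0 : wd a (fc (fc V n) b) = 0) (hp : p ∈ fc (fc V n) b) : fc (fc V n) b = {p} := by
  have h1 := (wd_eq_zero (fc_nonempty (fc_nonempty hV n) b)).1 h0
  refine Finset.eq_singleton_iff_unique_mem.2 ⟨hp, fun x hx => ?_⟩
  rw [hon.expand x, hon.expand p, planar_fc n V x (fc_subset _ _ hx) p (fc_subset _ _ hp),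
    planar_fc b _ x hx p hp, h1 x hx p hp]

lemma wd_singleton (a v : E3) : wd a {v} = 0 := by
  rw [wd, hs_singleton, hs_singleton, inner_neg_left]; ring

lemma singleton_single {k : Type*} [CommRing k] {x : AddMonoidAlgebra k E3} {q : E3} (h : sp x = {q}) :
    x = AddMonoidAlgebra.single q (x.coeff q) := by
  classical
  ext v
  rw [AddMonoidAlgebra.coeff_single, Finsupp.single_apply]
  split_ifs with hv
  · rw [hv]
  · have : v ∉ sp x := by rw [h, Finset.mem_singleton]; exact fun e => hv e.symm
    exact Finsupp.notMem_support_iff.1 this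

lemma msum_nz {V : Finset E3} {B C : RE} (h : MSum V (sp B) (sp C)) : B ≠ 0 ∧ C ≠ 0 :=
  ⟨ne_zero_of_supp h.2.1.choose_spec, ne_zero_of_supp h.2.2.1.choose_spec⟩

/-- a vertex of the product -/
lemma vertex_coeff {V : Finset E3} {A B C : RE} (h : AlgHyp V A B C) {n b p : E3}
    (hp : fc (fc V n) b = {p}) : ∃ q ∈ fc (fc (sp B) n) b, ∃ s ∈ fc (fc (sp C) n) b,
      A.coeff p = B.coeff q * C.coeff s := by
  obtain ⟨hB0, hC0⟩ := msum_nz h.hA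
  have hM := (h.hA.fc n).fc b
  rw [hp] at hM
  have hw : ∀ w, wd w (fc (fc (sp B) n) b) = 0 ∧ wd w (fc (fc (sp C) n) b) = 0 := by
    intro w
    have h1 := hM.wd w
    rw [wd_singleton] at h1
    have h2 := wd_nonneg (a := w) hM.2.1
    have h3 := wd_nonneg (a := w) hM.2.2.1
    constructor <;> linarith
  obtain ⟨q, hq⟩ := eq_singleton_of_wd hM.2.1 fun w => (hw w).1
  obtain ⟨s, hs'⟩ := eq_singleton_of_wd hM.2.2.1 fun w => (hw w).2
  have e : p = q + s := by
    refine ext_inner_left ℝ fun w => ?_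
    have := hM.2.2.2 w
    rw [hq, hs', hs_singleton, hs_singleton, hs_singleton] at this
    rw [this, inner_add_right]
  refine ⟨q, by rw [hq]; simp, s, by rw [hs']; simp, ?_⟩
  have hqB : q ∈ fc (fc (sp B) n) b := by rw [hq]; simp
  have hsC : s ∈ fc (fc (sp C) n) b := by rw [hs']; simp
  have t1 : tp b (tp n A) = tp b (tp n B) * tp b (tp n C) := by
    rw [h.hABC, tp_mul hB0 hC0, tp_mul (tp_ne_zero hB0) (tp_ne_zero hC0)]
  have cB : (tp b (tp n B)).coeff q = B.coeff q := by
    rw [tp_coeff (by rw [sp_tp]; exact hqB), tp_coeff (fc_subset _ _ hqB)]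
  have cC : (tp b (tp n C)).coeff s = C.coeff s := by
    rw [tp_coeff (by rw [sp_tp]; exact hsC), tp_coeff (fc_subset _ _ hsC)]
  rw [singleton_single (x := tp b (tp n B)) (by rw [sp_tp, sp_tp, hq]),
    singleton_single (x := tp b (tp n C)) (by rw [sp_tp, sp_tp, hs']),
    AddMonoidAlgebra.single_mul_single, cB, cC, ← e] at t1
  have hne : B.coeff q * C.coeff s ≠ 0 := by
    refine mul_ne_zero ?_ ?_
    · exact Finsupp.mem_support_iff.1 (fc_subset _ _ (fc_subset _ _ hqB))
    · exact Finsupp.mem_support_iff.1 (fc_subset _ _ (fc_subset _ _ hsC))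
  have hpm : p ∈ sp (tp b (tp n A)) := by
    rw [t1, Finsupp.mem_support_iff]; simpa using hne
  have hp2 := hpm
  rw [sp_tp, sp_tp] at hp2
  have : (tp b (tp n A)).coeff p = A.coeff p := by
    rw [tp_coeff (by rw [sp_tp]; exact hp2), tp_coeff (fc_subset _ _ hp2)]
  rw [← this, t1]; simp

/-- G1 -/
lemma alg_G1 {V : Finset E3} {A B C : RE} (h : AlgHyp V A B C) {n b a : E3} (hon : ON n b a)
    (hb : 0 < wd b (fc V n)) (hl : wd a (fc (fc V n) (-b)) < wd a (fc (fc V n) b)) :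
    wd b (fc (sp B) n) = 0 ∨ wd b (fc (sp C) n) = 0 := by
  have hV := h.hA.1
  have hF := fc_nonempty hV n
  have hl2 : 0 ≤ wd a (fc (fc V n) (-b)) := wd_nonneg (fc_nonempty hF _)
  obtain ⟨m, y, κ, W, p1, p2, p3, p4, hf⟩ := h.flag n b a hon hb (hl2.trans_lt hl)
  have hq := hf.quad
  obtain ⟨S, T, hST, hz, hx0, hy0, hsx, hsy, hqS, hqT, -, -, halt⟩ :=
    flag_top hV hf h.hABC h.hA (h.pos n hon.n1) hb (hl2.trans_lt hl)
  obtain ⟨k1, k2, k3⟩ := quad_hs hf.κ0 hq hb (hl2.trans_lt hl)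
  have hM := h.hA.fc n
  have hm := msum_mul hx0 hy0
  rw [← hz] at k1
  obtain ⟨s1, s2, -, -⟩ := squeeze hM hm hsx hsy k1
  rcases hl2.lt_or_eq with hpos | hzero
  · obtain ⟨k4, -, -⟩ := quad_hs (neg_ne_zero.2 hf.κ0) hq.neg (by rwa [wd_neg]) hpos
    rw [← quad_neg_eq, ← hz] at k4
    obtain ⟨s3, s4, -, -⟩ := squeeze hM hm hsx hsy k4
    have e := two_edges (a := a) (b := b) (l1 := wd a (fc (fc V n) b)) (l2 := wd a (fc (fc V n) (-b)))
      hf.κ0 hq.b1 hq.b2 hq.b3 hq.b4 (by unfold wd at hb; linarith)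
      (by rw [hq.a1, hq.a2, wd]; ring) (by rw [hq.a3, hq.a4, wd]; ring) hpos hl hz
    unfold wd at e ⊢
    rw [s1, s2, s3, s4] at e
    exact e
  · have h34 : p3 = p4 := (hq.eq34 hon).2 hzero.symm
    obtain ⟨d12, -⟩ := hq.dist hb (hl2.trans_lt hl)
    have hzz : tp n S * tp n T = κ • (mo p1 - mo p2) := by rw [hz, h34, sub_add_cancel]
    have hw0 : wd b (sp (tp n S * tp n T)) = 0 := by
      rw [wd_eq_zero hm.1]
      have : ∀ x ∈ sp (tp n S * tp n T), ⟪b, x⟫_ℝ = hs (fc V n) b := by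
        intro x hx
        rw [hzz, sp_pair hf.κ0 d12] at hx
        rcases hx with rfl | rfl
        · exact hq.b1
        · exact hq.b2
      intro x hx y hy
      rw [this x hx, this y hy]
    rw [hm.wd] at hw0
    have w1 := wd_nonneg (a := b) hm.2.1
    have w2 := wd_nonneg (a := b) hm.2.2.1
    have hp3 : fc (fc V n) (-b) = {p3} := by
      apply fc3_singleton hV hon.negb hzero.symm
      exact fc_subset _ _ hf.h3
    obtain ⟨q, hq1, s, hs1, e⟩ := vertex_coeff h hp3
    rcases halt q s e h34 with hq2 | hs2
    · left
      have hqx := hqS q (fc_subset _ _ hq1) hq2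
      have l1 : ⟪-b, q⟫_ℝ = hs (fc (sp B) n) (-b) := (mem_fc.1 hq1).2
      have l2 := le_hs hqx (-b)
      have l3 : wd b (sp (tp n S)) = 0 := by linarith
      have l4 := wd_nonneg (a := b) hM.2.1
      unfold wd at l3 l4 ⊢
      linarith
    · right
      have hqx := hqT s (fc_subset _ _ hs1) hs2
      have l1 : ⟪-b, s⟫_ℝ = hs (fc (sp C) n) (-b) := (mem_fc.1 hs1).2
      have l2 := le_hs hqx (-b)
      have l3 : wd b (sp (tp n T)) = 0 := by linarith
      have l4 := wd_nonneg (a := b) hM.2.2.1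
      unfold wd at l3 l4 ⊢
      linarith

lemma hs_fc_eq {X : Finset E3} {w b : E3} (hX : X.Nonempty) (h : hs (fc X w) b = hs X b) :
    hs (fc X b) w = hs X w := by
  obtain ⟨v, hv, e⟩ := exists_hs (fc_nonempty hX w) b
  rw [mem_fc] at hv
  refine hs_eq (fun x hx => le_hs (fc_subset _ _ hx) w) (v := v) ?_ hv.2
  rw [mem_fc]; exact ⟨hv.1, e.trans h⟩

lemma wd_shear {X : Finset E3} (hX : X.Nonempty) {a b : E3} (t : ℝ) (hb : Planar b X) :
    wd (a + t • b) X = wd a X := by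
  obtain ⟨v, hv⟩ := id hX
  have h1 : hs X (t • b + a) = _ := hs_add_const hX (z := t • b) hv (fun x hx => by
    rw [real_inner_smul_left, real_inner_smul_left, hb x hx v hv]) a
  have h2 : hs X (-(t • b) + -a) = _ := hs_add_const hX (z := -(t • b)) hv (fun x hx => by
    rw [inner_neg_left, inner_neg_left, real_inner_smul_left, real_inner_smul_left, hb x hx v hv]) (-a)
  unfold wd
  rw [neg_add_rev, add_comm a, h1, h2, inner_neg_left]
  ring

/-- parallelogram argument -/
lemma parallelogram {X Y Z : Finset E3} (hM : MSum Z X Y) {p1 p2 p3 p4 a b : E3} {β1 β2 l : ℝ}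
    (hZ : ∀ v, v ∈ Z ↔ v = p1 ∨ v = p2 ∨ v = p3 ∨ v = p4)
    (b1 : ⟪b, p1⟫_ℝ = β1) (b2 : ⟪b, p2⟫_ℝ = β1) (b3 : ⟪b, p3⟫_ℝ = β2) (b4 : ⟪b, p4⟫_ℝ = β2)
    (hβ : β2 < β1) (hl1 : ⟪a, p1⟫_ℝ = ⟪a, p2⟫_ℝ + l) (hl2 : ⟪a, p3⟫_ℝ = ⟪a, p4⟫_ℝ + l)
    (hl : 0 < l) : wd a (fc X b) = wd a (fc X (-b)) := by
  set t : ℝ := -((⟪a, p1⟫_ℝ - ⟪a, p3⟫_ℝ) / (β1 - β2)) with ht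
  set w : E3 := a + t • b with hw
  have hsub : β1 - β2 ≠ 0 := by linarith
  have e13 : ⟪w, p1⟫_ℝ = ⟪w, p3⟫_ℝ := by
    rw [hw, inner_add_left, inner_add_left, real_inner_smul_left, real_inner_smul_left, b1, b3, ht]
    field_simp; ring
  have e12 : ⟪w, p1⟫_ℝ = ⟪w, p2⟫_ℝ + l := by
    rw [hw, inner_add_left, inner_add_left, real_inner_smul_left, real_inner_smul_left, b1, b2]
    linarith
  have e34 : ⟪w, p3⟫_ℝ = ⟪w, p4⟫_ℝ + l := by
    rw [hw, inner_add_left, inner_add_left, real_inner_smul_left, real_inner_smul_left, b3, b4]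
    linarith
  have key : ∀ u : E3, (∃ x ∈ fc Z u, ⟪b, x⟫_ℝ = β1) → (∃ x ∈ fc Z u, ⟪b, x⟫_ℝ = β2) →
      hs (fc X b) u = hs X u ∧ hs (fc X (-b)) u = hs X u := by
    rintro u ⟨x1, hx1, f1⟩ ⟨x2, hx2, f2⟩
    have hMu := hM.fc u
    have g1 := le_hs hx1 b
    have g2 := le_hs hx2 (-b)
    have g3 : hs Z b ≤ β1 := hs_le hM.1 fun v hv => by
      rcases (hZ v).1 hv with rfl | rfl | rfl | rfl <;> linarith
    have g4 : hs Z (-b) ≤ -β2 := hs_le hM.1 fun v hv => by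
      rw [inner_neg_left]
      rcases (hZ v).1 hv with rfl | rfl | rfl | rfl <;> linarith
    rw [inner_neg_left] at g2
    have i1 := hs_mono hMu.2.1 (fc_subset X u) b
    have i2 := hs_mono hMu.2.2.1 (fc_subset Y u) b
    have i3 := hs_mono hMu.2.1 (fc_subset X u) (-b)
    have i4 := hs_mono hMu.2.2.1 (fc_subset Y u) (-b)
    have j1 := hMu.2.2.2 b
    have j2 := hMu.2.2.2 (-b)
    have j3 := hM.2.2.2 b
    have j4 := hM.2.2.2 (-b)
    exact ⟨hs_fc_eq hM.2.1 (by linarith), hs_fc_eq hM.2.1 (by linarith)⟩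
  have hsw : hs Z w = ⟪w, p1⟫_ℝ := hs_eq (fun v hv => by
    rcases (hZ v).1 hv with rfl | rfl | rfl | rfl <;> linarith) ((hZ p1).2 (by tauto)) rfl
  have hsw' : hs Z (-w) = ⟪-w, p2⟫_ℝ := hs_eq (fun v hv => by
    rw [inner_neg_left, inner_neg_left]
    rcases (hZ v).1 hv with rfl | rfl | rfl | rfl <;> linarith) ((hZ p2).2 (by tauto)) rfl
  have k1 := key w ⟨p1, mem_fc.2 ⟨(hZ p1).2 (by tauto), hsw.symm⟩, b1⟩
    ⟨p3, mem_fc.2 ⟨(hZ p3).2 (by tauto), by rw [hsw, e13]⟩, b3⟩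
  have k2 := key (-w) ⟨p2, mem_fc.2 ⟨(hZ p2).2 (by tauto), hsw'.symm⟩, b2⟩
    ⟨p4, mem_fc.2 ⟨(hZ p4).2 (by tauto), by rw [hsw', inner_neg_left, inner_neg_left]; linarith⟩, b4⟩
  have hX := hM.2.1
  have c1 : wd w (fc X b) = wd a (fc X b) := wd_shear (fc_nonempty hX b) t (planar_fc b X)
  have c2 : wd w (fc X (-b)) = wd a (fc X (-b)) := wd_shear (fc_nonempty hX _) t (by
    simpa using (planar_fc (-b) X).neg)
  rw [← c1, ← c2, wd, wd, k1.1, k1.2, k2.1, k2.2]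

/-- G2 -/
lemma alg_G2 {V : Finset E3} {A B C : RE} (h : AlgHyp V A B C) {n b a : E3} (hon : ON n b a)
    (hb : 0 < wd b (fc V n)) (hl : wd a (fc (fc V n) (-b)) = wd a (fc (fc V n) b)) :
    wd a (fc (fc (sp B) n) b) = wd a (fc (fc (sp B) n) (-b)) := by
  have hV := h.hA.1
  have hF := fc_nonempty hV n
  have hM := h.hA.fc n
  have hl2 : 0 ≤ wd a (fc (fc V n) b) := wd_nonneg (fc_nonempty hF _)
  rcases hl2.lt_or_eq with hpos | hzero
  · obtain ⟨m, y, κ, W, p1, p2, p3, p4, hf⟩ := h.flag n b a hon hb hpos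
    have hq := hf.quad
    obtain ⟨S, T, hST, hz, hx0, hy0, hsx, hsy, -⟩ :=
      flag_top hV hf h.hABC h.hA (h.pos n hon.n1) hb hpos
    obtain ⟨k1, k2, k3⟩ := quad_hs hf.κ0 hq hb hpos
    obtain ⟨k4, k5, k6⟩ := quad_hs (neg_ne_zero.2 hf.κ0) hq.neg (by rwa [wd_neg]) (by rwa [hl])
    rw [← quad_neg_eq] at k4 k5 k6
    rw [← hz] at k1 k2 k3 k4 k5 k6
    have hm := msum_mul hx0 hy0
    obtain ⟨-, -, s1, s2⟩ := squeeze hM hm hsx hsy k1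
    obtain ⟨-, -, s3, s4⟩ := squeeze hM hm hsx hsy k4
    obtain ⟨t1, -⟩ := squeeze (hM.fc b) (hm.fc b) s1 s2 k2
    obtain ⟨t2, -⟩ := squeeze (hM.fc b) (hm.fc b) s1 s2 k3
    obtain ⟨t3, -⟩ := squeeze (hM.fc (-b)) (hm.fc (-b)) s3 s4 k5
    obtain ⟨t4, -⟩ := squeeze (hM.fc (-b)) (hm.fc (-b)) s3 s4 k6
    obtain ⟨d12, d13, d14, d23, d24⟩ := hq.dist hb hpos
    have d34 : p3 ≠ p4 := by
      rw [Ne, hq.eq34 hon, hl]; exact hpos.ne'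
    have e := parallelogram (a := a) (b := b) (l := wd a (fc (fc V n) b)) hm
      (fun v => by rw [hz]; exact sp_quad hf.κ0 d12 d13 d14 d23 d24 d34 v)
      hq.b1 hq.b2 hq.b3 hq.b4 (by unfold wd at hb; linarith)
      (by rw [hq.a1, hq.a2, wd]; ring) (by rw [← hl, hq.a3, hq.a4, wd]; ring) hpos
    unfold wd at e ⊢
    rw [← t1, ← t2, ← t3, ← t4, e]
  · have h1 := (hM.fc b).wd a
    have h2 := (hM.fc (-b)).wd a
    have i1 := wd_nonneg (a := a) (hM.fc b).2.1
    have i2 := wd_nonneg (a := a) (hM.fc b).2.2.1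
    have i3 := wd_nonneg (a := a) (hM.fc (-b)).2.1
    have i4 := wd_nonneg (a := a) (hM.fc (-b)).2.2.1
    linarith

end

section

noncomputable def bmom (c d : E3) (x : GE3) : ℝ := x.coeff.sum fun v r => r * (⟪c, v⟫_ℝ * ⟪d, v⟫_ℝ)

lemma rmom_eq (n : E3) (k : ℕ) (x : GE3) : rmom n k x = AddMonoidAlgebra.liftNC
    ((RingHom.id ℝ : ℝ →+* ℝ) : ℝ →+ ℝ) (fun v => ⟪n, v.toAdd⟫_ℝ ^ k) x := by
  rw [liftNC_eq_sum]; rfl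

lemma bmom_eq (c d : E3) (x : GE3) : bmom c d x = AddMonoidAlgebra.liftNC
    ((RingHom.id ℝ : ℝ →+* ℝ) : ℝ →+ ℝ) (fun v => ⟪c, v.toAdd⟫_ℝ * ⟪d, v.toAdd⟫_ℝ) x := by
  rw [liftNC_eq_sum]; rfl

lemma rmom_add (n : E3) (k : ℕ) (x y : GE3) : rmom n k (x + y) = rmom n k x + rmom n k y := by
  simp only [rmom_eq, map_add]

lemma bmom_add (c d : E3) (x y : GE3) : bmom c d (x + y) = bmom c d x + bmom c d y := by
  simp only [bmom_eq, map_add]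

lemma rmom_single (n : E3) (k : ℕ) (v : E3) (r : ℝ) : rmom n k (AddMonoidAlgebra.single v r) =
    r * ⟪n, v⟫_ℝ ^ k := by
  rw [rmom_eq, AddMonoidAlgebra.liftNC_single]; rfl

lemma bmom_single (c d v : E3) (r : ℝ) : bmom c d (AddMonoidAlgebra.single v r) =
    r * (⟪c, v⟫_ℝ * ⟪d, v⟫_ℝ) := by
  rw [bmom_eq, AddMonoidAlgebra.liftNC_single]; rfl

lemma rmom1_mul (n : E3) (x y : GE3) : rmom n 1 (x * y) = rmom n 1 x * rmom n 0 y +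
    rmom n 0 x * rmom n 1 y := by
  have := leibniz (RingHom.id ℝ) (1 : Multiplicative E3 →* ℝ) (innerₗ E3 n).toAddMonoidHom x y
  simp only [rmom_eq, pow_zero, pow_one]
  simp only [MonoidHom.one_apply, mul_one] at this
  exact this

lemma rmom0_indep (n n' : E3) (x : GE3) : rmom n 0 x = rmom n' 0 x := by
  simp only [rmom_eq, pow_zero]

lemma bmom_mul (c d : E3) (x y : GE3) : bmom c d (x * y) = bmom c d x * rmom c 0 y +
    rmom c 1 x * rmom d 1 y + rmom d 1 x * rmom c 1 y + rmom c 0 x * bmom c d y := by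
  induction x using AddMonoidAlgebra.induction_linear with
  | zero => simp [rmom_eq, bmom_eq]
  | add x x' hx hx' => simp only [add_mul, bmom_add, rmom_add, hx, hx']; ring
  | single v r =>
    induction y using AddMonoidAlgebra.induction_linear with
    | zero => simp [rmom_eq, bmom_eq]
    | add y y' hy hy' => simp only [mul_add, bmom_add, rmom_add, hy, hy']; ring
    | single w s =>
      simp only [AddMonoidAlgebra.single_mul_single, rmom_single, bmom_single, inner_add_right]
      ring

/-- the moment argument -/
lemma alg_H {V : Finset E3} {A B C : RE} (h : AlgHyp V A B C) {n b a : E3} (hon : ON n b a)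
    (hb : 0 < wd b (fc V n)) (hl : wd a (fc (fc V n) (-b)) < wd a (fc (fc V n) b))
    {q : E3} (hq : fc (sp B) n = {q}) (h0 : mom 0 B = 0) (h1 : mom 1 B = 0) : False := by
  classical
  have hV := h.hA.1
  have hF := fc_nonempty hV n
  have hl2 : 0 ≤ wd a (fc (fc V n) (-b)) := wd_nonneg (fc_nonempty hF _)
  obtain ⟨m, y, κ, W, p1, p2, p3, p4, hf⟩ := h.flag n b a hon hb (hl2.trans_lt hl)
  have hqd := hf.quad
  obtain ⟨S, T, hST, hz, hx0, hy0, hsx, hsy, hqS, hqT, m0, m1, -⟩ :=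
    flag_top hV hf h.hABC h.hA (h.pos n hon.n1) hb (hl2.trans_lt hl)
  have m0 := m0 h0
  have m1 := m1 h1
  -- level homomorphism
  have hlS : lev 0 0 n S ≠ 0 := by
    intro hc
    have e := lev_coeff 0 0 n (hs (sp S) n) S
    rw [hc] at e
    have e2 : topAt (fun v => ⟪n, v⟫_ℝ) (hs (sp S) n) S = tp n S := rfl
    have e3 : sp (tp n S) = {q} := by
      apply Finset.Subset.antisymm
      · rw [← hq]; exact hsx
      · obtain ⟨v, hv⟩ := supp_nonempty hx0
        have : v = q := by have := hsx hv; rw [hq] at this; simpa using this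
        rw [← this]; simpa using hv
    rw [e2, singleton_single e3, eev_single] at e
    have e4 : (tp n S).coeff q ≠ 0 := by
      have : q ∈ sp (tp n S) := by rw [e3]; simp
      exact Finsupp.mem_support_iff.1 this
    simp at e
    exact e4 (by exact_mod_cast e.symm)
  have hlW : lev 0 0 n W = 0 := by
    ext l
    rw [lev_coeff]
    by_cases hlv : l = -hs V (-n)
    · rw [topAt_self (fun v hv => by rw [hlv]; exact hf.hW v hv)]
      change AddMonoidAlgebra.liftNC _ _ W = 0
      rw [liftNC_eq_sum]
      have := congrArg (fun r : ℝ => (r : ℂ)) hf.hW0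
      rw [rmom, Finsupp.sum] at this
      rw [Finsupp.sum]
      simp only [Complex.ofReal_sum, Complex.ofReal_mul, pow_zero, Complex.ofReal_one, mul_one,
        Complex.ofReal_zero] at this
      rw [← this]
      refine Finset.sum_congr rfl fun v _ => ?_
      simp [ech]
    · have : topAt (fun v => ⟪n, v⟫_ℝ) l W = 0 := by
        by_contra hc
        obtain ⟨v, hv⟩ := supp_nonempty hc
        rw [topAt_supp] at hv
        exact hlv (by rw [← hv.2]; exact hf.hW v hv.1)
      rw [this]; simp
  have hlz : lev 0 0 n (κ • (mo p1 - mo p2 - mo p3 + mo p4)) = 0 := by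
    have hs : ∀ z : GE3, κ • z = AddMonoidAlgebra.single 0 κ * z := by
      intro z; ext v; simp
    rw [hs, map_mul, map_add, map_sub, map_sub, lev_mo, lev_mo, lev_mo, lev_mo, hqd.n1, hqd.n2,
      hqd.n3, hqd.n4]
    simp
  have hlT : lev 0 0 n T = 0 := by
    have : lev 0 0 n S * lev 0 0 n T = 0 := by rw [← map_mul, hST, map_add, hlz, hlW, add_zero]
    exact (mul_eq_zero.1 this).resolve_left hlS
  -- moments of T
  have key : ∀ (x : GE3) (k : ℕ), (rmom n k x : ℂ) = (lev 0 0 n x).coeff.sum fun l r => r * (l : ℂ) ^ k := by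
    intro x k
    induction x using AddMonoidAlgebra.induction_linear with
    | zero => simp [rmom_eq]
    | add x y hx hy =>
      rw [rmom_add, map_add, AddMonoidAlgebra.coeff_add, Finsupp.sum_add_index']
      · push_cast; rw [hx, hy]
      · simp
      · intros; ring
    | single v r =>
      rw [rmom_single, lev_single, AddMonoidAlgebra.coeff_single, Finsupp.sum_single_index]
      · simp
      · simp
  have t0 : rmom n 0 T = 0 := by
    have := key T 0; rw [hlT] at this; simpa using this
  have t1 : rmom n 1 T = 0 := by
    have := key T 1; rw [hlT] at this; simpa using this
  have B1 := bmom_mul n a S T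
  have R1 := rmom1_mul a S T
  rw [m0, m1, t0, t1] at B1
  rw [rmom0_indep a n T, rmom0_indep a n S, m0, t0] at R1
  have hsm : (κ • (mo p1 - mo p2 - mo p3 + mo p4) : GE3) = AddMonoidAlgebra.single p1 κ +
      AddMonoidAlgebra.single p2 (-κ) + AddMonoidAlgebra.single p3 (-κ) + AddMonoidAlgebra.single p4 κ := by
    simp only [mo, smul_sub, smul_add, AddMonoidAlgebra.smul_single, smul_eq_mul, mul_one,
      AddMonoidAlgebra.single_neg]
    abel
  have hWb : bmom n a W = -hs V (-n) * rmom a 1 W := by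
    rw [bmom, rmom, Finsupp.mul_sum]
    refine Finset.sum_congr rfl fun v hv => ?_
    simp only []
    rw [hf.hW v hv]; ring
  rw [hST, bmom_add, hsm, bmom_add, bmom_add, bmom_add, bmom_single, bmom_single, bmom_single, bmom_single,
    hqd.n1, hqd.n2, hqd.n3, hqd.n4, hWb] at B1
  rw [hST, rmom_add, hsm, rmom_add, rmom_add, rmom_add, rmom_single, rmom_single, rmom_single,
    rmom_single] at R1
  have hn := h.pos n hon.n1
  unfold wd at hn hl
  have a1 := hqd.a1; have a2 := hqd.a2; have a3 := hqd.a3; have a4 := hqd.a4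
  rw [a1, a2, a3, a4] at B1 R1
  have e : κ * ((hs (fc (fc V n) b) a + hs (fc (fc V n) b) (-a)) - (hs (fc (fc V n) (-b)) a +
    hs (fc (fc V n) (-b)) (-a))) * (hs V n + hs V (-n)) = 0 := by
    linear_combination B1 + hs V (-n) * R1
  rcases mul_eq_zero.1 e with e | e
  · rcases mul_eq_zero.1 e with e | e
    · exact hf.κ0 e
    · linarith
  · linarith

lemma csym_singleton (s : E3) : CSym {s} := by
  refine ⟨(2 : ℝ) • s, fun η => ?_⟩
  rw [hs_singleton, hs_singleton, inner_neg_left, real_inner_smul_left, real_inner_comm η s]; ring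

lemma alg_face {V : Finset E3} {A B C : RE} (h : AlgHyp V A B C) (h0 : mom 0 B = 0)
    (h1 : mom 1 B = 0) (n : E3) (hn : ⟪n, n⟫_ℝ = 1) : CSym (fc (sp C) n) := by
  have hM := h.hA.fc n
  have hV := h.hA.1
  have hF := fc_nonempty hV n
  by_cases hS : ∃ s1 ∈ fc (sp C) n, ∃ s2 ∈ fc (sp C) n, s1 ≠ s2
  swap
  · push Not at hS
    obtain ⟨s, hs⟩ := hM.2.2.1
    have : fc (sp C) n = {s} := Finset.eq_singleton_iff_unique_mem.2 ⟨hs, fun x hx => hS x hx s hs⟩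
    rw [this]; exact csym_singleton s
  obtain ⟨s1, hs1, s2, hs2, hs12⟩ := hS
  have hpc := planar_fc n (sp C)
  have hsn : ⟪n, s1 - s2⟫_ℝ = 0 := by rw [inner_sub_right, hpc s1 hs1 s2 hs2, sub_self]
  have neg_case : ∀ b a : E3, ⟪s1 - s2, b⟫_ℝ ≠ 0 → 0 < wd b (fc V n) := by
    intro b a hb
    have hSw : 0 ≤ wd b (fc (sp C) n) := wd_nonneg hM.2.2.1
    have hQw : 0 ≤ wd b (fc (sp B) n) := wd_nonneg hM.2.1
    rw [hM.wd]
    have : wd b (fc (sp C) n) ≠ 0 := by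
      intro hc
      apply hb
      rw [real_inner_comm, inner_sub_right, (wd_eq_zero hM.2.2.1).1 hc s1 hs1 s2 hs2, sub_self]
    have := lt_of_le_of_ne hSw (Ne.symm this)
    linarith
  by_cases hQ : ∃ q1 ∈ fc (sp B) n, ∃ q2 ∈ fc (sp B) n, q1 ≠ q2
  · obtain ⟨q1, hq1, q2, hq2, hq12⟩ := hQ
    have hpb := planar_fc n (sp B)
    have hqn : ⟪n, q1 - q2⟫_ℝ = 0 := by rw [inner_sub_right, hpb q1 hq1 q2 hq2, sub_self]
    refine planar_sym hn hM.2.2.1 hpc hsn hqn (sub_ne_zero.2 hs12) (sub_ne_zero.2 hq12) ?_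
    intro b a hon hb1 hb2
    have hbF := neg_case b a hb1
    have w1 : wd b (fc (sp C) n) ≠ 0 := by
      intro hc
      apply hb1
      rw [real_inner_comm, inner_sub_right, (wd_eq_zero hM.2.2.1).1 hc s1 hs1 s2 hs2, sub_self]
    have w2 : wd b (fc (sp B) n) ≠ 0 := by
      intro hc
      apply hb2
      rw [real_inner_comm, inner_sub_right, (wd_eq_zero hM.2.1).1 hc q1 hq1 q2 hq2, sub_self]
    have e : wd a (fc (fc V n) (-b)) = wd a (fc (fc V n) b) := by
      rcases lt_trichotomy (wd a (fc (fc V n) (-b))) (wd a (fc (fc V n) b)) with hlt | he | hgt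
      · rcases alg_G1 h hon hbF hlt with h | h
        · exact absurd h w2
        · exact absurd h w1
      · exact he
      · rcases alg_G1 h hon.negb (by rwa [wd_neg]) (by rwa [neg_neg]) with h | h
        · rw [wd_neg] at h; exact absurd h w2
        · rw [wd_neg] at h; exact absurd h w1
    exact alg_G2 h.swap hon hbF e
  · push Not at hQ
    obtain ⟨q, hq⟩ := hM.2.1
    have hQ1 : fc (sp B) n = {q} := Finset.eq_singleton_iff_unique_mem.2 ⟨hq, fun x hx => hQ x hx q hq⟩
    refine planar_sym hn hM.2.2.1 hpc hsn hsn (sub_ne_zero.2 hs12) (sub_ne_zero.2 hs12) ?_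
    intro b a hon hb1 _
    have hbF := neg_case b a hb1
    have e : wd a (fc (fc V n) (-b)) = wd a (fc (fc V n) b) := by
      rcases lt_trichotomy (wd a (fc (fc V n) (-b))) (wd a (fc (fc V n) b)) with hlt | he | hgt
      · exact (alg_H h hon hbF hlt hQ1 h0 h1).elim
      · exact he
      · exact (alg_H h hon.negb (by rwa [wd_neg]) (by rwa [neg_neg]) hQ1 h0 h1).elim
    exact alg_G2 h.swap hon hbF e

/-- conclusion of the algebraic part -/
theorem alg_main {V : Finset E3} {A B C : RE} (h : AlgHyp V A B C) (h0 : mom 0 A = 0)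
    (h1 : mom 1 A = 0) (h2 : mom 2 A = 0) : CSym (sp B) ∨ CSym (sp C) := by
  rw [h.hABC] at h0 h1 h2
  rcases mom_contra h0 h1 h2 with ⟨h0, h1⟩ | ⟨h0, h1⟩
  · exact Or.inr (csym_of_faces h.hA.2.2.1 (alg_face h h0 h1))
  · exact Or.inl (csym_of_faces h.hA.2.1 (alg_face h.swap h0 h1))

end

section

/-- normals of facets -/
def FN (V : Finset E3) : Set E3 := {n | ⟪n, n⟫_ℝ = 1 ∧ ¬ Collinear ℝ (fc V n : Set E3)}

lemma collinear_of_planar {i j : E3} {F : Finset E3} (hi : ⟪i, i⟫_ℝ = 1)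
    (hij : ∀ t : ℝ, j ≠ t • i) (h1 : Planar i F) (h2 : Planar j F) :
    Collinear ℝ (F : Set E3) := by
  obtain ⟨b, a, β, hon, hβ, hj⟩ := exists_on hi hij
  rcases F.eq_empty_or_nonempty with h | ⟨p, hp⟩
  · rw [h]; simpa using collinear_empty ℝ E3
  rw [collinear_iff_of_mem (p₀ := p) (by exact_mod_cast hp)]
  refine ⟨a, fun x hx => ⟨⟪a, x - p⟫_ℝ, ?_⟩⟩
  have hx' : x ∈ F := by exact_mod_cast hx
  have e1 : ⟪i, x - p⟫_ℝ = 0 := by rw [inner_sub_right, h1 x hx' p hp, sub_self]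
  have e2 : ⟪j, x - p⟫_ℝ = 0 := by rw [inner_sub_right, h2 x hx' p hp, sub_self]
  rw [hj, inner_add_left, real_inner_smul_left, real_inner_smul_left, e1] at e2
  have e3 : ⟪b, x - p⟫_ℝ = 0 := by
    rcases mul_eq_zero.1 (by rw [mul_zero, zero_add] at e2; exact e2) with h | h
    · exact absurd h hβ.ne'
    · exact h
  have := hon.expand (x - p)
  rw [e1, e3] at this
  simp only [vadd_eq_add]
  rw [← sub_eq_iff_eq_add]
  simpa using this

lemma unit_par {i j : E3} {t : ℝ} (hi : ⟪i, i⟫_ℝ = 1) (hj : ⟪j, j⟫_ℝ = 1) (h : j = t • i) :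
    j = i ∨ j = -i := by
  rw [h, real_inner_smul_left, real_inner_smul_right, hi] at hj
  have : t = 1 ∨ t = -1 := by
    have : (t - 1) * (t + 1) = 0 := by linarith
    rcases mul_eq_zero.1 this with h | h
    · left; linarith
    · right; linarith
  rcases this with h' | h' <;> rw [h, h'] <;> simp

lemma FN_finite {V : Finset E3} (hpos : ∀ n : E3, ⟪n, n⟫_ℝ = 1 → 0 < wd n V) : (FN V).Finite := by
  refine Set.Finite.of_finite_image (f := fc V) ?_ ?_
  · refine (V.powerset.finite_toSet).subset ?_
    rintro _ ⟨n, _, rfl⟩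
    simp [fc_subset]
  · intro i hi j hj e
    by_contra hne
    have hV : (fc V i).Nonempty := by
      by_contra h
      rw [Finset.not_nonempty_iff_eq_empty] at h
      apply hi.2
      rw [h]; simpa using collinear_empty ℝ E3
    by_cases hp : ∃ t : ℝ, j = t • i
    · obtain ⟨t, ht⟩ := hp
      rcases unit_par hi.1 hj.1 ht with h | h
      · exact hne h.symm
      · obtain ⟨x, hx⟩ := hV
        have h1 := (mem_fc.1 hx).2
        have hx2 := hx
        have e' : fc V i = fc V j := e
        rw [e', h] at hx2
        have h2 := (mem_fc.1 hx2).2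
        have := hpos i hi.1
        rw [wd, ← h1, ← h2, inner_neg_left] at this
        linarith
    · push Not at hp
      apply hi.2
      refine collinear_of_planar hi.1 hp (planar_fc i V) ?_
      have e' : fc V i = fc V j := e
      rw [e']; exact planar_fc j V

lemma inner_le_hs {V : Finset E3} {x : E3} (hx : x ∈ convexHull ℝ (V : Set E3)) (w : E3) :
    ⟪w, x⟫_ℝ ≤ hs V w := by
  have h : convexHull ℝ (V : Set E3) ⊆ {y | ⟪w, y⟫_ℝ ≤ hs V w} :=
    convexHull_min (fun v hv => le_hs (by exact_mod_cast hv) w)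
      (convex_halfSpace_le (innerₗ E3 w).isLinear _)
  exact h hx

lemma mem_face {V : Finset E3} {x n : E3} (hx : x ∈ convexHull ℝ (V : Set E3))
    (h : ⟪n, x⟫_ℝ = hs V n) : x ∈ convexHull ℝ (fc V n : Set E3) := by
  obtain ⟨w, h0, h1, h2⟩ := Finset.mem_convexHull'.1 hx
  have hz : ∀ y ∈ V, w y ≠ 0 → y ∈ fc V n := by
    have hs0 : ∑ y ∈ V, w y * (hs V n - ⟪n, y⟫_ℝ) = 0 := by
      have : ∑ y ∈ V, w y * ⟪n, y⟫_ℝ = ⟪n, x⟫_ℝ := by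
        rw [← h2, inner_sum]; simp [real_inner_smul_right]
      simp only [mul_sub, Finset.sum_sub_distrib, ← Finset.sum_mul, h1, this, h]; ring
    rw [Finset.sum_eq_zero_iff_of_nonneg
      (fun y hy => mul_nonneg (h0 y hy) (sub_nonneg.2 (le_hs hy n)))] at hs0
    intro y hy hwy
    rcases mul_eq_zero.1 (hs0 y hy) with h | h
    · exact absurd h hwy
    · exact mem_fc.2 ⟨hy, by linarith⟩
  have hz' : ∀ y ∈ V, y ∉ fc V n → w y = 0 := fun y hy hn => by
    by_contra h; exact hn (hz y hy h)
  rw [Finset.mem_convexHull']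
  refine ⟨w, fun y hy => h0 y (fc_subset V n hy), ?_, ?_⟩
  · rw [← h1]
    exact Finset.sum_subset (fc_subset V n) hz'
  · rw [← h2]
    exact Finset.sum_subset (fc_subset V n) (fun y hy hn => by rw [hz' y hy hn, zero_smul])

lemma planar_hull {V : Finset E3} {n x y : E3} (h : Planar n V) (hx : x ∈ convexHull ℝ (V : Set E3))
    (hy : y ∈ V) : ⟪n, x⟫_ℝ = ⟪n, y⟫_ℝ := by
  obtain ⟨w, h0, h1, h2⟩ := Finset.mem_convexHull'.1 hx
  rw [← h2, inner_sum]
  simp only [real_inner_smul_right]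
  rw [Finset.sum_congr rfl (fun z hz => by rw [h z hz y hy]), ← Finset.sum_mul, h1, one_mul]

lemma hull_le_ne {V : Finset E3} {x : E3} (hx : x ∈ convexHull ℝ (V : Set E3)) : V.Nonempty := by
  by_contra h
  rw [Finset.not_nonempty_iff_eq_empty] at h
  simp [h] at hx

lemma lt_of_interior {P : Set E3} {V : Finset E3} (hP : P = convexHull ℝ (V : Set E3)) {o n : E3}
    (ho : o ∈ interior P) (hn : ⟪n, n⟫_ℝ = 1) : ⟪n, o⟫_ℝ < hs V n := by
  obtain ⟨ε, hε, hb⟩ := Metric.isOpen_iff.1 isOpen_interior o ho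
  have h1 : o + (ε / 2) • n ∈ P := by
    apply interior_subset
    apply hb
    have : ‖n‖ = 1 := by
      rw [real_inner_self_eq_norm_sq] at hn
      nlinarith [norm_nonneg n]
    rw [Metric.mem_ball, dist_eq_norm, add_sub_cancel_left, norm_smul, this, Real.norm_eq_abs,
      abs_of_pos (by linarith)]
    linarith
  rw [hP] at h1
  have := inner_le_hs h1 n
  rw [inner_add_right, real_inner_smul_right, hn] at this
  linarith

lemma pos_of_interior {P : Set E3} {V : Finset E3} (hP : P = convexHull ℝ (V : Set E3))
    (ho : (interior P).Nonempty) (n : E3) (hn : ⟪n, n⟫_ℝ = 1) : 0 < wd n V := by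
  obtain ⟨o, ho⟩ := ho
  have h1 := lt_of_interior hP ho hn
  have h2 := lt_of_interior hP ho (n := -n) (by simpa using hn)
  rw [inner_neg_left] at h2
  rw [wd]; linarith

lemma FN_flag {V : Finset E3} (hV : V.Nonempty) {n b a : E3} (hon : ON n b a)
    (h1 : 0 < wd b (fc V n)) (h2 : 0 < wd a (fc (fc V n) b)) : n ∈ FN V := by
  refine ⟨hon.n1, fun hc => ?_⟩
  have hF := fc_nonempty hV n
  have hG := fc_nonempty hF b
  obtain ⟨p, hp⟩ := fc_nonempty hG a
  obtain ⟨q, hq⟩ := fc_nonempty hG (-a)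
  obtain ⟨r, hr⟩ := fc_nonempty hF (-b)
  have hpG := (mem_fc.1 hp).1
  have hqG := (mem_fc.1 hq).1
  rw [collinear_iff_of_mem (p₀ := p) (by exact_mod_cast (mem_fc.1 hpG).1)] at hc
  obtain ⟨v, hv⟩ := hc
  obtain ⟨s, hs⟩ := hv q (by exact_mod_cast (mem_fc.1 hqG).1)
  obtain ⟨t, ht⟩ := hv r (by exact_mod_cast (mem_fc.1 hr).1)
  have e1 := (mem_fc.1 hpG).2
  have e2 := (mem_fc.1 hqG).2
  have e3 := (mem_fc.1 hr).2
  have e4 := (mem_fc.1 hp).2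
  have e5 := (mem_fc.1 hq).2
  rw [wd, ← e1, ← e3] at h1
  rw [wd, ← e4, ← e5] at h2
  rw [← e1] at e2
  rw [hs] at e2 h2
  rw [ht] at h1
  simp only [vadd_eq_add, inner_add_right, real_inner_smul_right, inner_neg_left] at e2 h1 h2
  have : s * ⟪b, v⟫_ℝ = 0 := by linarith
  rcases mul_eq_zero.1 this with h | h
  · rw [h] at h2; linarith
  · rw [h] at h1; linarith

end

section

lemma exists_generic_interior {P : Set E3} (V : Finset E3) (hIntr : (interior P).Nonempty) (y : E3) :
    ∃ o ∈ interior P, ∀ F ⊆ V, Collinear ℝ (F : Set E3) →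
      o ∉ affineSpan ℝ (insert y (F : Set E3)) := by
  classical
  set T : Set E3 := ⋃ F ∈ {F : Finset E3 | F ⊆ V ∧ Collinear ℝ (F : Set E3)},
    (affineSpan ℝ (insert y (F : Set E3)) : Set E3) with hT
  have h0 : volume T = 0 := by
    rw [hT]
    rw [measure_biUnion_null_iff ((V.powerset.finite_toSet.subset
      (fun F hF => by simpa using hF.1)).countable)]
    intro F hF
    apply Measure.addHaar_affineSubspace
    intro htop
    have hc : Collinear ℝ (F : Set E3) := hF.2
    have h1 := (collinear_iff_finrank_le_one (k := ℝ) (s := (F : Set E3))).1 hc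
    have h2 := finrank_vectorSpan_insert_le_set ℝ (F : Set E3) y
    rw [← direction_affineSpan ℝ (insert y (F : Set E3)), htop, AffineSubspace.direction_top,
      finrank_top, finrank_euclideanSpace_fin] at h2
    omega
  have h1 : 0 < volume (interior P) := isOpen_interior.measure_pos _ hIntr
  have : ¬ interior P ⊆ T := fun h => by
    have := measure_mono (μ := volume) h
    rw [h0] at this
    exact absurd this (not_le.2 h1)
  obtain ⟨o, ho, hoT⟩ := Set.not_subset.1 this
  refine ⟨o, ho, fun F hF hc hmem => hoT ?_⟩
  rw [hT]
  simp only [Set.mem_iUnion]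
  exact ⟨F, ⟨hF, hc⟩, hmem⟩

lemma FN_rep {P : Set E3} {V : Finset E3} (hP : P = convexHull ℝ (V : Set E3))
    (hIntr : (interior P).Nonempty) {y : E3} (hy : ∀ i ∈ FN V, ⟪i, y⟫_ℝ ≤ hs V i) : y ∈ P := by
  by_contra hyP
  obtain ⟨o, ho, hgen⟩ := exists_generic_interior V hIntr y
  have hcpt : IsCompact P := by rw [hP]; exact (V.finite_toSet).isCompact_convexHull (𝕜 := ℝ)
  have hcv : Convex ℝ P := by rw [hP]; exact convex_convexHull ℝ _
  have hoP := interior_subset ho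
  -- exit time
  have hc : Continuous fun t : ℝ => o + t • (y - o) := by fun_prop
  have hK : IsCompact (Set.Icc (0:ℝ) 1 ∩ (fun t : ℝ => o + t • (y - o)) ⁻¹' P) :=
    isCompact_Icc.inter_right (hcpt.isClosed.preimage hc)
  obtain ⟨τ, ⟨hτ, hτP⟩, hmax⟩ := hK.exists_isMaxOn ⟨0, by simpa using hoP⟩ continuousOn_id
  simp only [Set.mem_preimage] at hτP
  set z := o + τ • (y - o) with hz
  have hτ1 : τ < 1 := by
    rcases hτ.2.lt_or_eq with h | h
    · exact h
    · exfalso; apply hyP; rw [hz, h] at hτP; simpa using hτP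
  have hzint : z ∉ interior P := by
    intro hzi
    have : ∀ᶠ t in nhds τ, o + t • (y - o) ∈ interior P :=
      hc.continuousAt.eventually (isOpen_interior.mem_nhds hzi)
    obtain ⟨ε, hε, hball⟩ := Metric.eventually_nhds_iff.1 this
    set s := τ + min (ε / 2) (1 - τ) with hs
    have hs0 : 0 < min (ε / 2) (1 - τ) := lt_min (by linarith) (by linarith)
    have h1 := hball (y := s) (by
      rw [Real.dist_eq, hs, add_sub_cancel_left, abs_of_pos hs0]
      exact lt_of_le_of_lt (min_le_left _ _) (by linarith))
    have h2 := hmax (a := s) ⟨⟨by linarith [hτ.1], by linarith [min_le_right (ε / 2) (1 - τ)]⟩,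
      (interior_subset h1 : o + s • (y - o) ∈ P)⟩
    simp only [Set.mem_setOf_eq, id] at h2
    linarith
  obtain ⟨f, hf⟩ := geometric_hahn_banach_open_point hcv.interior isOpen_interior hzint
  set w := (InnerProductSpace.toDual ℝ E3).symm f with hw
  have hfw : ∀ x, f x = ⟪w, x⟫_ℝ := fun x => by rw [hw, InnerProductSpace.toDual_symm_apply]
  have hw0 : w ≠ 0 := by
    intro h
    have := hf o ho
    rw [hfw, hfw, h] at this; simp at this
  have hwn : 0 < ‖w‖ := norm_pos_iff.2 hw0
  set n := ‖w‖⁻¹ • w with hn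
  have hn1 : ⟪n, n⟫_ℝ = 1 := by
    rw [hn, real_inner_smul_left, real_inner_smul_right, real_inner_self_eq_norm_sq]
    field_simp
  have hle : ∀ x ∈ P, ⟪n, x⟫_ℝ ≤ ⟪n, z⟫_ℝ := by
    intro x hx
    have hcl : P ⊆ closure (interior P) := by
      rw [hcv.closure_interior_eq_closure_of_nonempty_interior hIntr]; exact subset_closure
    have : closure (interior P) ⊆ {x | ⟪n, x⟫_ℝ ≤ ⟪n, z⟫_ℝ} := by
      apply closure_minimal
      · intro x hx
        have := hf x hx
        rw [hfw, hfw] at this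
        simp only [Set.mem_setOf_eq, hn, real_inner_smul_left]
        exact mul_le_mul_of_nonneg_left this.le (inv_nonneg.2 hwn.le)
      · exact isClosed_le (by fun_prop) (by fun_prop)
    exact this (hcl hx)
  have hVne : V.Nonempty := hull_le_ne (hP ▸ hoP)
  have hzn : ⟪n, z⟫_ℝ = hs V n := by
    apply le_antisymm
    · exact inner_le_hs (hP ▸ hτP) n
    · exact hs_le hVne fun v hv => hle v (hP ▸ subset_convexHull ℝ _ (by exact_mod_cast hv))
  have hzF := mem_face (hP ▸ hτP) hzn
  have hlt := lt_of_interior hP ho hn1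
  have hnN : n ∈ FN V := by
    refine ⟨hn1, fun hcol => hgen (fc V n) (fc_subset V n) hcol ?_⟩
    have h1 : z ∈ affineSpan ℝ (insert y (fc V n : Set E3)) :=
      affineSpan_mono ℝ (Set.subset_insert _ _) (convexHull_subset_affineSpan _ hzF)
    have h2 : y ∈ affineSpan ℝ (insert y (fc V n : Set E3)) :=
      subset_affineSpan ℝ _ (Set.mem_insert _ _)
    have h3 := AffineMap.lineMap_mem (-(τ / (1 - τ))) h1 h2
    have : AffineMap.lineMap z y (-(τ / (1 - τ))) = o := by
      have h4 : (1 - τ) ≠ 0 := by linarith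
      rw [AffineMap.lineMap_apply_module, hz]
      have e1 : (1 - -(τ / (1 - τ))) = 1 / (1 - τ) := by field_simp; ring
      have e2 : -(τ / (1 - τ)) = 1 - 1 / (1 - τ) := by field_simp; ring
      have e3 : (1 / (1 - τ)) * τ = 1 / (1 - τ) - 1 := by field_simp; ring
      rw [e1, e2, smul_add, smul_smul, e3]
      module
    rwa [this] at h3
  have h5 := hy n hnN
  rw [← hzn, hz] at hlt
  rw [← hzn, hz] at h5
  simp only [inner_add_right, real_inner_smul_right, inner_sub_right] at hlt h5
  nlinarith [hτ.1]

lemma ir_core {P : Set E3} {V : Finset E3} (hP : P = convexHull ℝ (V : Set E3))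
    {i j k x : E3} {α β γ : ℝ} (hi : ⟪i, i⟫_ℝ = 1) (hij : ∀ t : ℝ, j ≠ t • i)
    (hk : k ∈ FN V) (hα : 0 < α) (hβ : 0 < β) (hγ : 0 < γ)
    (e : γ • k = α • i + β • j) (ei : ⟪i, x⟫_ℝ = hs V i)
    (ej : ⟪j, x⟫_ℝ = hs V j) (ek : ⟪k, x⟫_ℝ = hs V k) : False := by
  have key : ∀ v ∈ fc V k, ⟪i, v⟫_ℝ = hs V i ∧ ⟪j, v⟫_ℝ = hs V j := by
    intro v hv
    obtain ⟨hvV, hv⟩ := mem_fc.1 hv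
    have h1 : γ * ⟪k, v⟫_ℝ = α * ⟪i, v⟫_ℝ + β * ⟪j, v⟫_ℝ := by
      rw [← real_inner_smul_left, e, inner_add_left, real_inner_smul_left, real_inner_smul_left]
    have h2 : γ * ⟪k, x⟫_ℝ = α * ⟪i, x⟫_ℝ + β * ⟪j, x⟫_ℝ := by
      rw [← real_inner_smul_left, e, inner_add_left, real_inner_smul_left, real_inner_smul_left]
    have h3 := mul_le_mul_of_nonneg_left (le_hs hvV i) hα.le
    have h4 := mul_le_mul_of_nonneg_left (le_hs hvV j) hβ.le
    rw [hv, ← ek, h2, ei, ej] at h1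
    constructor
    · exact mul_left_cancel₀ hα.ne' (by linarith)
    · exact mul_left_cancel₀ hβ.ne' (by linarith)
  exact hk.2 (collinear_of_planar hi hij
    (fun v hv w hw => by rw [(key v hv).1, (key w hw).1])
    (fun v hv w hw => by rw [(key v hv).2, (key w hw).2]))

lemma FN_ir {P : Set E3} {V : Finset E3} (hP : P = convexHull ℝ (V : Set E3))
    (hIntr : (interior P).Nonempty) {i j k x y : E3} (hi : i ∈ FN V) (hj : j ∈ FN V) (hk : k ∈ FN V)
    (hij : i ≠ j) (hik : i ≠ k) (hjk : j ≠ k)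
    (xi : ⟪i, x⟫_ℝ = hs V i) (xj : ⟪j, x⟫_ℝ = hs V j) (xk : ⟪k, x⟫_ℝ = hs V k)
    (yi : ⟪i, y⟫_ℝ = hs V i) (yj : ⟪j, y⟫_ℝ = hs V j) (yk : ⟪k, y⟫_ℝ = hs V k) : x = y := by
  by_contra hxy
  obtain ⟨o, ho⟩ := hIntr
  have oi := lt_of_interior hP ho hi.1
  have oj := lt_of_interior hP ho hj.1
  have ok := lt_of_interior hP ho hk.1
  have npar : ∀ p q : E3, p ∈ FN V → q ∈ FN V → p ≠ q → ⟪p, x⟫_ℝ = hs V p → ⟪q, x⟫_ℝ = hs V q →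
      ⟪p, o⟫_ℝ < hs V p → ⟪q, o⟫_ℝ < hs V q → ∀ t : ℝ, q ≠ t • p := by
    intro p q hp hq hpq ep eq op oq t ht
    rcases unit_par hp.1 hq.1 ht with h | h
    · exact hpq h.symm
    · rw [h, inner_neg_left] at eq oq
      rw [← eq] at oq
      linarith
  have nij := npar i j hi hj hij xi xj oi oj
  have nik := npar i k hi hk hik xi xk oi ok
  have njk := npar j k hj hk hjk xj xk oj ok
  obtain ⟨b, a, β, hon, hβ, ej⟩ := exists_on hi.1 nij
  set d := x - y with hd
  have hd0 : d ≠ 0 := sub_ne_zero.2 hxy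
  have di : ⟪i, d⟫_ℝ = 0 := by rw [hd, inner_sub_right, xi, yi, sub_self]
  have dj : ⟪j, d⟫_ℝ = 0 := by rw [hd, inner_sub_right, xj, yj, sub_self]
  have dk : ⟪k, d⟫_ℝ = 0 := by rw [hd, inner_sub_right, xk, yk, sub_self]
  have db : ⟪b, d⟫_ℝ = 0 := by
    rw [ej, inner_add_left, real_inner_smul_left, real_inner_smul_left, di, mul_zero, zero_add] at dj
    exact (mul_eq_zero.1 dj).resolve_left hβ.ne'
  have hda := hon.expand d
  rw [di, db, zero_smul, zero_smul, zero_add, zero_add] at hda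
  have hka : ⟪a, k⟫_ℝ = 0 := by
    rw [hda, real_inner_smul_right] at dk
    rcases mul_eq_zero.1 dk with h | h
    · exfalso; apply hd0; rw [hda, h, zero_smul]
    · rw [real_inner_comm]; exact h
  have ek := hon.expand k
  rw [hka, zero_smul, add_zero] at ek
  set α := ⟪i, j⟫_ℝ
  set α' := ⟪i, k⟫_ℝ
  set β' := ⟪b, k⟫_ℝ
  have hrel : β • k = β' • j + (β * α' - β' * α) • i := by
    rw [ek, ej]; module
  rcases lt_trichotomy β' 0 with h | h | h
  · rcases le_or_gt (β * α' - β' * α) 0 with hg | hg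
    · have e1 := congrArg (fun w => ⟪w, x - o⟫_ℝ) hrel
      simp only [inner_add_left, real_inner_smul_left, inner_sub_right] at e1
      have f1 := mul_pos hβ (sub_pos.2 ok)
      have f2 := mul_pos (neg_pos.2 h) (sub_pos.2 oj)
      have f3 := mul_nonneg (neg_nonneg.2 hg) (sub_pos.2 oi).le
      rw [xi, xj, xk] at e1
      linarith
    · exact ir_core hP (i := j) (j := k) (k := i) hj.1 njk hi (neg_pos.2 h) hβ hg
        (by rw [hrel]; module) xj xk xi
  · rw [h, zero_smul, add_zero] at ek
    exact nik _ ek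
  · rcases lt_trichotomy (β * α' - β' * α) 0 with hg | hg | hg
    · exact ir_core hP (i := i) (j := k) (k := j) hi.1 nik hj (neg_pos.2 hg) hβ h
        (by rw [hrel]; module) xi xk xj
    · rw [hg, zero_smul, add_zero] at hrel
      apply njk (β⁻¹ * β')
      rw [mul_smul, ← hrel, smul_smul, inv_mul_cancel₀ hβ.ne', one_smul]
    · exact ir_core hP (i := i) (j := j) (k := k) hi.1 nij hk hg h hβ
        (by rw [hrel]; module) xi xj xk

/-- basic data of a polytope -/
structure HPoly (V : Finset E3) (P : Set E3) (N : Finset E3) : Prop where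
  hull : P = convexHull ℝ (V : Set E3)
  int : (interior P).Nonempty
  unit : ∀ n ∈ N, ⟪n, n⟫_ℝ = 1
  rep : ∀ x, x ∈ P ↔ ∀ i ∈ N, ⟪i, x⟫_ℝ ≤ hs V i
  ne : V.Nonempty
  VP : (V : Set E3) ⊆ P
  cpt : IsCompact P
  cvx : Convex ℝ P
  le : ∀ x ∈ P, ∀ w, ⟪w, x⟫_ℝ ≤ hs V w
  pos : ∀ n : E3, ⟪n, n⟫_ℝ = 1 → 0 < wd n V
  flag : ∀ n b a : E3, ON n b a → 0 < wd b (fc V n) → 0 < wd a (fc (fc V n) b) → n ∈ N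
  ir : ∀ i ∈ N, ∀ j ∈ N, ∀ k ∈ N, i ≠ j → i ≠ k → j ≠ k → ∀ x y : E3,
    ⟪i, x⟫_ℝ = hs V i → ⟪j, x⟫_ℝ = hs V j → ⟪k, x⟫_ℝ = hs V k →
    ⟪i, y⟫_ℝ = hs V i → ⟪j, y⟫_ℝ = hs V j → ⟪k, y⟫_ℝ = hs V k → x = y

lemma exists_hpoly {V : Finset E3} {P : Set E3} (hP : P = convexHull ℝ (V : Set E3))
    (hIntr : (interior P).Nonempty) : ∃ N, HPoly V P N := by
  have hpos := pos_of_interior hP hIntr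
  have hfin := FN_finite hpos
  have hne : V.Nonempty := by
    obtain ⟨o, ho⟩ := hIntr
    exact hull_le_ne (hP ▸ interior_subset ho)
  refine ⟨hfin.toFinset, hP, hIntr, fun n hn => ((Set.Finite.mem_toFinset _).1 hn).1, ?_, hne, ?_,
    ?_, ?_, ?_, hpos, ?_, ?_⟩
  · intro x
    refine ⟨fun hx i _ => inner_le_hs (hP ▸ hx) i, fun h => ?_⟩
    exact FN_rep hP hIntr (fun i hi => h i ((Set.Finite.mem_toFinset _).2 hi))
  · rw [hP]; exact subset_convexHull ℝ _
  · rw [hP]; exact (V.finite_toSet).isCompact_convexHull (𝕜 := ℝ)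
  · rw [hP]; exact convex_convexHull ℝ _
  · intro x hx w; exact inner_le_hs (hP ▸ hx) w
  · intro n b a hon h1 h2
    exact (Set.Finite.mem_toFinset _).2 (FN_flag hne hon h1 h2)
  · intro i hi j hj k hk hij hik hjk x y
    exact FN_ir hP hIntr ((Set.Finite.mem_toFinset _).1 hi) ((Set.Finite.mem_toFinset _).1 hj)
      ((Set.Finite.mem_toFinset _).1 hk) hij hik hjk

end

section

lemma exit1 {ι : Type*} {N : Finset ι} {s d : ι → ℝ} {z : ℝ} (hz : ∀ i ∈ N, s i * z ≤ d i)
    (hout : ∀ δ > 0, ¬ ∀ i ∈ N, s i * (z + δ) ≤ d i) : ∃ i ∈ N, 0 < s i ∧ s i * z = d i := by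
  by_contra hcon
  push Not at hcon
  have : ∀ᶠ δ in nhdsWithin (0:ℝ) (Set.Ioi 0), ∀ i ∈ N, s i * (z + δ) ≤ d i := by
    rw [Filter.eventually_all_finset]
    intro i hi
    rcases (hz i hi).lt_or_eq with h | h
    · have hc : Continuous fun δ : ℝ => s i * (z + δ) := by fun_prop
      have := (hc.tendsto 0).eventually (eventually_lt_nhds (b := d i) (by simpa using h))
      filter_upwards [mem_nhdsWithin_of_mem_nhds this] with δ hδ using hδ.le
    · have hs : s i ≤ 0 := by
        by_contra hs
        exact hcon i hi (not_le.1 hs) h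
      filter_upwards [self_mem_nhdsWithin] with δ hδ
      have : s i * δ ≤ 0 := mul_nonpos_of_nonpos_of_nonneg hs (le_of_lt hδ)
      rw [mul_add, h]; linarith
  obtain ⟨δ, h1, h2⟩ := (this.and self_mem_nhdsWithin).exists
  exact hout δ h2 h1

lemma second_facet {V : Finset E3} {P : Set E3} {N : Finset E3} (h : HPoly V P N) {n b a p q : E3}
    (hon : ON n b a) (hp : p ∈ fc (fc V n) b) (hq : q ∈ fc (fc V n) b) :
    ∃ j ∈ N, 0 < ⟪j, b⟫_ℝ ∧ ⟪j, p⟫_ℝ = hs V j ∧ ⟪j, q⟫_ℝ = hs V j := by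
  set x := (1 / 2 : ℝ) • p + (1 / 2 : ℝ) • q with hx
  have hpV := fc_subset _ _ (fc_subset _ _ hp)
  have hqV := fc_subset _ _ (fc_subset _ _ hq)
  have hxP : x ∈ P := h.cvx (h.VP hpV) (h.VP hqV) (by norm_num) (by norm_num) (by norm_num)
  have xn : ⟪n, x⟫_ℝ = hs V n := by
    rw [hx, inner_add_right, real_inner_smul_right, real_inner_smul_right,
      (mem_fc.1 (mem_fc.1 hp).1).2, (mem_fc.1 (mem_fc.1 hq).1).2]; ring
  have xb : ⟪b, x⟫_ℝ = hs (fc V n) b := by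
    rw [hx, inner_add_right, real_inner_smul_right, real_inner_smul_right,
      (mem_fc.1 hp).2, (mem_fc.1 hq).2]; ring
  obtain ⟨j, hj, h1, h2⟩ := exit1 (N := N) (s := fun i => ⟪i, b⟫_ℝ)
    (d := fun i => hs V i - ⟪i, x⟫_ℝ) (z := 0)
    (fun i hi => by simpa using (h.rep x).1 hxP i hi) (by
      intro δ hδ hall
      have hxP : x + δ • b ∈ P := by
        rw [h.rep]
        intro i hi
        have := hall i hi
        rw [inner_add_right, real_inner_smul_right]
        rw [zero_add] at this
        linarith
      have h3 : x + δ • b ∈ convexHull ℝ (fc V n : Set E3) := by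
        refine mem_face (h.hull ▸ hxP) ?_
        rw [inner_add_right, real_inner_smul_right, hon.nb, xn]; ring
      have h4 := inner_le_hs h3 b
      rw [inner_add_right, real_inner_smul_right, hon.b1, xb] at h4
      linarith)
  refine ⟨j, hj, h1, ?_⟩
  simp only [mul_zero] at h2
  have h3 := le_hs hpV j
  have h4 := le_hs hqV j
  have h5 : ⟪j, x⟫_ℝ = 1 / 2 * ⟪j, p⟫_ℝ + 1 / 2 * ⟪j, q⟫_ℝ := by
    rw [hx, inner_add_right, real_inner_smul_right, real_inner_smul_right]
  constructor <;> linarith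

lemma seg_int {w lo hi : ℝ} (hw : w ≠ 0) (h : lo ≤ hi) :
    ∫ z, (Set.Icc lo hi).indicator (fun z => Real.exp (w * z)) z =
      w⁻¹ * (Real.exp (w * hi) - Real.exp (w * lo)) := by
  rw [integral_indicator measurableSet_Icc, integral_Icc_eq_integral_Ioc,
    ← intervalIntegral.integral_of_le h, intervalIntegral.integral_comp_mul_left Real.exp hw,
    integral_exp, smul_eq_mul]

lemma compact_convex_Icc {S : Set ℝ} (hc : IsCompact S) (hv : Convex ℝ S) (hne : S.Nonempty) :
    S = Set.Icc (sInf S) (sSup S) :=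
  eq_Icc_of_connected_compact ⟨hne, hv.isPreconnected⟩ hc

lemma pl1 {ι : Type*} {N : Finset ι} {s d : ι → ℝ} {w : ℝ} (hw : w ≠ 0)
    (hb : Bornology.IsBounded {z : ℝ | ∀ i ∈ N, s i * z ≤ d i})
    (htie : ∀ i ∈ N, ∀ j ∈ N, i ≠ j → 0 < s i * s j → ∀ z, (∀ i ∈ N, s i * z ≤ d i) →
      s i * z = d i → s j * z = d j → False) :
    ∫ z, {z : ℝ | ∀ i ∈ N, s i * z ≤ d i}.indicator (fun z => Real.exp (w * z)) z =
      w⁻¹ * ∑ i ∈ N, Real.sign (s i) *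
        {z : ℝ | ∀ i ∈ N, s i * z ≤ d i}.indicator (fun z => Real.exp (w * z)) (d i / s i) := by
  classical
  set S := {z : ℝ | ∀ i ∈ N, s i * z ≤ d i} with hS
  rcases S.eq_empty_or_nonempty with he | hne
  · rw [he]; simp
  have hcl : IsClosed S := by
    have : S = ⋂ i ∈ N, {z | s i * z ≤ d i} := by ext; simp [hS]
    rw [this]
    exact isClosed_biInter fun i _ => isClosed_le (by fun_prop) continuous_const
  have hc : IsCompact S := Metric.isCompact_of_isClosed_isBounded hcl hb
  have hv : Convex ℝ S := by
    intro x hx y hy a b ha hb hab i hi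
    have h1 := mul_le_mul_of_nonneg_left (hx i hi) ha
    have h2 := mul_le_mul_of_nonneg_left (hy i hi) hb
    have : d i = a * d i + b * d i := by rw [← add_mul, hab, one_mul]
    simp only [smul_eq_mul]
    nlinarith
  have hI := compact_convex_Icc hc hv hne
  set lo := sInf S
  set hi := sSup S
  have hlo : lo ∈ S := hc.sInf_mem hne
  have hhi : hi ∈ S := hc.sSup_mem hne
  have hle : lo ≤ hi := by rw [hI] at hlo; exact hlo.2
  obtain ⟨i, hiN, si, ei⟩ := exit1 (N := N) (s := s) (d := d) (z := hi) hhi (by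
    intro δ hδ h
    have : hi + δ ∈ S := h
    rw [hI] at this
    linarith [this.2])
  obtain ⟨j, hjN, sj, ej⟩ := exit1 (N := N) (s := fun i => - s i) (d := d) (z := -lo)
    (fun i hi => by simpa using hlo i hi) (by
    intro δ hδ h
    have : lo - δ ∈ S := fun i hi => by
      have := h i hi
      linarith
    rw [hI] at this
    linarith [this.1])
  simp only [neg_mul_neg] at ej
  have key : ∀ k ∈ N, Real.sign (s k) * S.indicator (fun z => Real.exp (w * z)) (d k / s k) =
      (if i = k then Real.exp (w * hi) else 0) - (if j = k then Real.exp (w * lo) else 0) := by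
    intro k hk
    rcases lt_trichotomy (s k) 0 with h | h | h
    · have hik : i ≠ k := by rintro rfl; linarith
      rw [if_neg hik, Real.sign_of_neg h]
      by_cases hm : d k / s k ∈ S
      · have e0 : s k * (d k / s k) = d k := by
          rw [← mul_div_assoc, mul_div_cancel_left₀ _ (by first | exact h.ne | exact h.ne')]
        have e1 : d k / s k = lo := by
          have h1 := hlo k hk
          have h2 : lo ≤ d k / s k := by rw [hI] at hm; exact hm.1
          apply le_antisymm _ h2
          rw [← e0] at h1
          exact (mul_le_mul_left_of_neg h).1 h1
        have e2 : j = k := by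
          by_contra hne
          refine htie j hjN k hk hne (by nlinarith) lo hlo ej ?_
          rw [← e1, e0]
        rw [Set.indicator_of_mem hm, if_pos e2, e1]; ring
      · have e2 : j ≠ k := by
          rintro rfl
          apply hm
          rw [← ej, mul_div_cancel_left₀ _ h.ne]; exact hlo
        rw [Set.indicator_of_notMem hm, if_neg e2]; ring
    · rw [if_neg (by rintro rfl; linarith), if_neg (by rintro rfl; linarith), h, Real.sign_zero]; ring
    · have hik : j ≠ k := by rintro rfl; linarith
      rw [if_neg hik, Real.sign_of_pos h]
      by_cases hm : d k / s k ∈ S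
      · have e0 : s k * (d k / s k) = d k := by
          rw [← mul_div_assoc, mul_div_cancel_left₀ _ (by first | exact h.ne | exact h.ne')]
        have e1 : d k / s k = hi := by
          have h1 := hhi k hk
          have h2 : d k / s k ≤ hi := by rw [hI] at hm; exact hm.2
          apply le_antisymm h2
          rw [← e0] at h1
          exact le_of_mul_le_mul_left h1 h
        have e2 : i = k := by
          by_contra hne
          refine htie i hiN k hk hne (by nlinarith) hi hhi ei ?_
          rw [← e1, e0]
        rw [Set.indicator_of_mem hm, if_pos e2, e1]; ring
      · have e2 : i ≠ k := by
          rintro rfl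
          apply hm
          rw [← ei, mul_div_cancel_left₀ _ h.ne']; exact hhi
        rw [Set.indicator_of_notMem hm, if_neg e2]; ring
  rw [Finset.sum_congr rfl key, Finset.sum_sub_distrib, Finset.sum_ite_eq, Finset.sum_ite_eq,
    if_pos hiN, if_pos hjN, ← seg_int hw hle, ← hI]

/-- weighted point indicator -/
noncomputable def pt (P : Set E3) (u x : E3) : ℝ := P.indicator (fun x => Real.exp ⟪u, x⟫_ℝ) x

lemma line_bdd {P : Set E3} (hP : IsCompact P) {c : E3} (hc : c ≠ 0) (p : E3) :
    Bornology.IsBounded {z : ℝ | p + z • c ∈ P} := by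
  obtain ⟨M, hM⟩ := hP.isBounded.exists_norm_le
  rw [isBounded_iff_forall_norm_le]
  have hc' := norm_pos_iff.2 hc
  refine ⟨(M + ‖p‖) / ‖c‖, fun z hz => ?_⟩
  rw [le_div_iff₀ hc', ← norm_smul]
  have := norm_sub_le (p + z • c) p
  rw [add_sub_cancel_left] at this
  linarith [hM _ hz]

lemma line_cpt {P : Set E3} (hP : IsCompact P) {c : E3} (hc : c ≠ 0) (p : E3) :
    IsCompact {z : ℝ | p + z • c ∈ P} :=
  Metric.isCompact_of_isClosed_isBounded
    (hP.isClosed.preimage (f := fun z : ℝ => p + z • c) (by fun_prop)) (line_bdd hP hc p)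

lemma line_cvx {P : Set E3} (hP : Convex ℝ P) (c p : E3) : Convex ℝ {z : ℝ | p + z • c ∈ P} := by
  intro x hx y hy a b ha hb hab
  have := hP hx hy ha hb hab
  have e : a • (p + x • c) + b • (p + y • c) = p + (a • x + b • y) • c := by
    have : p = (a + b) • p := by rw [hab, one_smul]
    conv_rhs => rw [this]
    simp only [smul_eq_mul]
    module
  rw [e] at this
  exact this

lemma pt_line (P : Set E3) (u p c : E3) (z : ℝ) : pt P u (p + z • c) =
    Real.exp ⟪u, p⟫_ℝ * {z : ℝ | p + z • c ∈ P}.indicator (fun z => Real.exp (⟪u, c⟫_ℝ * z)) z := by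
  by_cases h : p + z • c ∈ P
  · rw [pt, Set.indicator_of_mem h, Set.indicator_of_mem (by exact h), ← Real.exp_add,
      inner_add_right, real_inner_smul_right, mul_comm z]
  · rw [pt, Set.indicator_of_notMem h, Set.indicator_of_notMem (by exact h), mul_zero]

lemma pl2 {P : Set E3} {N : Finset E3} {h : E3 → ℝ} (hcpt : IsCompact P)
    (hrep : ∀ x, x ∈ P ↔ ∀ i ∈ N, ⟪i, x⟫_ℝ ≤ h i) {u p c : E3} (huc : ⟪u, c⟫_ℝ ≠ 0)
    (htie : ∀ i ∈ N, ∀ j ∈ N, i ≠ j → 0 < ⟪i, c⟫_ℝ * ⟪j, c⟫_ℝ → ∀ z : ℝ, p + z • c ∈ P →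
      ⟪i, p + z • c⟫_ℝ = h i → ⟪j, p + z • c⟫_ℝ = h j → False) :
    ∫ z : ℝ, pt P u (p + z • c) = (⟪u, c⟫_ℝ)⁻¹ *
      ∑ i ∈ N, Real.sign ⟪i, c⟫_ℝ * pt P u (p + ((h i - ⟪i, p⟫_ℝ) / ⟪i, c⟫_ℝ) • c) := by
  have hc : c ≠ 0 := by rintro rfl; simp at huc
  have hS : {z : ℝ | p + z • c ∈ P} = {z : ℝ | ∀ i ∈ N, ⟪i, c⟫_ℝ * z ≤ h i - ⟪i, p⟫_ℝ} := by
    ext z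
    simp only [Set.mem_setOf_eq, hrep, inner_add_right, real_inner_smul_right]
    refine forall₂_congr fun i _ => ?_
    constructor <;> intro h <;> linarith
  have hb := line_bdd hcpt hc p
  simp only [pt_line]
  rw [integral_const_mul]
  rw [hS] at hb ⊢
  rw [pl1 huc hb]
  · rw [← mul_assoc, mul_comm (Real.exp _), mul_assoc, Finset.mul_sum]
    congr 1
    refine Finset.sum_congr rfl fun i _ => by ring
  · intro i hi j hj hij hs z hz e1 e2
    have hz' : z ∈ {z : ℝ | p + z • c ∈ P} := by rw [hS]; exact hz
    refine htie i hi j hj hij hs z hz' ?_ ?_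
    · rw [inner_add_right, real_inner_smul_right]; linarith
    · rw [inner_add_right, real_inner_smul_right]; linarith

lemma pt_integrable {P : Set E3} (hP : IsCompact P) {c : E3} (hc : c ≠ 0) (u p : E3) :
    Integrable fun z : ℝ => pt P u (p + z • c) := by
  simp only [pt_line]
  apply Integrable.const_mul
  rw [integrable_indicator_iff (line_cpt hP hc p).measurableSet]
  exact (Continuous.continuousOn (by fun_prop)).integrableOn_compact (line_cpt hP hc p)

end

section

/-- projection of `e2` along `e3` to the plane orthogonal to `i` -/
noncomputable def cc (e2 e3 i : E3) : E3 := e2 - (⟪i, e2⟫_ℝ / ⟪i, e3⟫_ℝ) • e3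

structure Gen (N : Finset E3) (e1 e2 e3 : E3) (κ : ℝ) : Prop where
  unit : ∀ i ∈ N, ⟪i, i⟫_ℝ = 1
  ne3 : ∀ i ∈ N, ⟪i, e3⟫_ℝ ≠ 0
  nc : ∀ i ∈ N, ∀ j ∈ N, j ≠ i → j ≠ -i → ⟪j, cc e2 e3 i⟫_ℝ ≠ 0
  indep : ∀ x y z : ℝ, x • e1 + y • e2 + z • e3 = 0 → x = 0 ∧ y = 0 ∧ z = 0
  κ0 : 0 < κ
  vol : ∀ (P : Set E3) (u : E3), IsCompact P → ∫ x, pt P u x =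
    κ * ∫ y1 : ℝ, ∫ y2 : ℝ, ∫ z : ℝ, pt P u (y1 • e1 + y2 • e2 + z • e3)

lemma avoid (S : Finset (Submodule ℝ E3)) (hS : ⊤ ∉ S) : ∃ e : E3, ∀ p ∈ S, e ∉ p := by
  classical
  have h := Subspace.biUnion_ne_univ_of_top_notMem hS
  obtain ⟨e, he⟩ := (Set.ne_univ_iff_exists_notMem _).1 h
  refine ⟨e, fun p hp hep => he ?_⟩
  simp only [Set.mem_iUnion]
  exact ⟨p, hp, hep⟩

lemma ker_ne_top {t : E3} (ht : t ≠ 0) : LinearMap.ker (innerₗ E3 t) ≠ ⊤ := by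
  intro h
  have : t ∈ LinearMap.ker (innerₗ E3 t) := by rw [h]; trivial
  rw [LinearMap.mem_ker, innerₗ_apply_apply, inner_self_eq_zero] at this
  exact ht this

lemma vol_frame {e1 e2 e3 : E3}
    (hind : ∀ x y z : ℝ, x • e1 + y • e2 + z • e3 = 0 → x = 0 ∧ y = 0 ∧ z = 0) :
    ∃ κ : ℝ, 0 < κ ∧ ∀ (P : Set E3) (u : E3), IsCompact P → ∫ x, pt P u x =
    κ * ∫ y1 : ℝ, ∫ y2 : ℝ, ∫ z : ℝ, pt P u (y1 • e1 + y2 • e2 + z • e3) := by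
  let f : (ℝ × ℝ × ℝ) →ₗ[ℝ] E3 :=
    { toFun := fun p => p.1 • e1 + p.2.1 • e2 + p.2.2 • e3
      map_add' := fun p q => by simp only [Prod.fst_add, Prod.snd_add]; module
      map_smul' := fun r p => by simp only [Prod.smul_fst, Prod.smul_snd, smul_eq_mul, RingHom.id_apply]; module }
  have hinj : Function.Injective f := by
    rw [← LinearMap.ker_eq_bot, LinearMap.ker_eq_bot']
    rintro ⟨x, y, z⟩ h
    obtain ⟨h1, h2, h3⟩ := hind x y z h
    simp [h1, h2, h3]
  let L0 := LinearMap.linearEquivOfInjective f hinj (by simp)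
  let L : (ℝ × ℝ × ℝ) ≃L[ℝ] E3 := L0.toContinuousLinearEquiv
  have hL : ∀ p, L p = p.1 • e1 + p.2.1 • e2 + p.2.2 • e3 := fun p => rfl
  haveI i1 : (volume : Measure (ℝ × ℝ)).IsAddHaarMeasure :=
    inferInstanceAs ((volume : Measure ℝ).prod (volume : Measure ℝ)).IsAddHaarMeasure
  haveI i2 : (volume : Measure (ℝ × ℝ × ℝ)).IsAddHaarMeasure :=
    inferInstanceAs ((volume : Measure ℝ).prod (volume : Measure (ℝ × ℝ))).IsAddHaarMeasure
  haveI : (Measure.map L (volume : Measure (ℝ × ℝ × ℝ))).IsAddHaarMeasure :=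
    L.isAddHaarMeasure_map volume
  have hc := Measure.isAddLeftInvariant_eq_smul (Measure.map L (volume : Measure (ℝ × ℝ × ℝ)))
    (volume : Measure E3)
  have hcr := Measure.addHaarScalarFactor_pos_of_isAddHaarMeasure
    (Measure.map L (volume : Measure (ℝ × ℝ × ℝ))) (volume : Measure E3)
  set c := Measure.addHaarScalarFactor (Measure.map L (volume : Measure (ℝ × ℝ × ℝ)))
    (volume : Measure E3)
  have hcr : 0 < (c : ℝ) := hcr
  refine ⟨(c : ℝ)⁻¹, inv_pos.2 hcr, fun P u hP => ?_⟩
  have e1' : ∫ x, pt P u x ∂(Measure.map L (volume : Measure (ℝ × ℝ × ℝ))) =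
      ∫ p : ℝ × ℝ × ℝ, pt P u (L p) :=
    integral_map_equiv L.toHomeomorph.toMeasurableEquiv _
  rw [hc, integral_smul_nnreal_measure, NNReal.smul_def, smul_eq_mul] at e1'
  rw [eq_inv_mul_iff_mul_eq₀ hcr.ne', e1']
  have hK : IsCompact (L ⁻¹' P) := L.toHomeomorph.isCompact_preimage.2 hP
  have hIntr : Integrable fun p : ℝ × ℝ × ℝ => pt P u (L p) := by
    have : (fun p : ℝ × ℝ × ℝ => pt P u (L p)) =
        (L ⁻¹' P).indicator (fun p => Real.exp ⟪u, L p⟫_ℝ) := by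
      ext p
      by_cases h : L p ∈ P
      · rw [pt, Set.indicator_of_mem h, Set.indicator_of_mem (by exact h)]
      · rw [pt, Set.indicator_of_notMem h, Set.indicator_of_notMem (by exact h)]
    rw [this, integrable_indicator_iff hK.measurableSet]
    exact (Continuous.continuousOn (by fun_prop)).integrableOn_compact hK
  have h2 : Integrable (fun p : ℝ × ℝ × ℝ => pt P u (L p))
    ((volume : Measure ℝ).prod (volume : Measure (ℝ × ℝ))) := hIntr
  have e2' : ∫ p : ℝ × ℝ × ℝ, pt P u (L p) = ∫ y1 : ℝ, ∫ q : ℝ × ℝ, pt P u (L (y1, q)) :=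
    integral_prod _ h2
  rw [e2']
  refine integral_congr_ae ?_
  filter_upwards [h2.prod_right_ae] with y1 hy1
  have h3 : Integrable (fun q : ℝ × ℝ => pt P u (L (y1, q)))
    ((volume : Measure ℝ).prod (volume : Measure ℝ)) := hy1
  exact integral_prod _ h3

lemma exists_gen (N : Finset E3) (hN : ∀ i ∈ N, ⟪i, i⟫_ℝ = 1) :
    ∃ e1 e2 e3 κ, Gen N e1 e2 e3 κ := by
  classical
  have hne : ∀ i ∈ N, i ≠ 0 := fun i hi h => by have := hN i hi; rw [h] at this; simp at this
  obtain ⟨e, he⟩ := avoid (insert ⊥ (N.image fun i => LinearMap.ker (innerₗ E3 i))) (by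
    simp only [Finset.mem_insert, Finset.mem_image, not_or, not_exists, not_and]
    exact ⟨top_ne_bot, fun i hi => ker_ne_top (hne i hi)⟩)
  have he0 : e ≠ 0 := fun h => he ⊥ (by simp) (by simp [h])
  have hen := norm_pos_iff.2 he0
  set e3 := ‖e‖⁻¹ • e with he3
  have h3u : ⟪e3, e3⟫_ℝ = 1 := by
    rw [he3, real_inner_smul_left, real_inner_smul_right, real_inner_self_eq_norm_sq]
    field_simp
  have h3 : ∀ i ∈ N, ⟪i, e3⟫_ℝ ≠ 0 := by
    intro i hi h
    rw [he3, real_inner_smul_right] at h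
    refine he (LinearMap.ker (innerₗ E3 i)) ?_ ?_
    · exact Finset.mem_insert_of_mem (Finset.mem_image_of_mem _ hi)
    · rw [LinearMap.mem_ker, innerₗ_apply_apply]
      exact (mul_eq_zero.1 h).resolve_left (inv_ne_zero hen.ne')
  clear_value e3
  have hcr : ∀ i ∈ N, ∀ j ∈ N, j ≠ i → j ≠ -i → ⟪i, e3⟫_ℝ • j - ⟪j, e3⟫_ℝ • i ≠ 0 := by
    intro i hi j hj h1 h2 h
    have : j = ((⟪i, e3⟫_ℝ)⁻¹ * ⟪j, e3⟫_ℝ) • i := by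
      rw [mul_smul, ← sub_eq_zero.1 h, smul_smul, inv_mul_cancel₀ (h3 i hi), one_smul]
    rcases unit_par (hN i hi) (hN j hj) this with h | h
    · exact h1 h
    · exact h2 h
  obtain ⟨e2, he2⟩ := avoid (insert (Submodule.span ℝ {e3})
    (((N ×ˢ N).filter (fun p => p.2 ≠ p.1 ∧ p.2 ≠ -p.1)).image
      fun p => LinearMap.ker (innerₗ E3 (⟪p.1, e3⟫_ℝ • p.2 - ⟪p.2, e3⟫_ℝ • p.1)))) (by
    simp only [Finset.mem_insert, Finset.mem_image, not_or, not_exists, not_and, Finset.mem_filter,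
      Finset.mem_product]
    refine ⟨fun h => ?_, fun p hp => ker_ne_top (hcr p.1 hp.1.1 p.2 hp.1.2 hp.2.1 hp.2.2)⟩
    have h1 := finrank_span_singleton (K := ℝ) (v := e3) (fun h => by rw [h] at h3u; simp at h3u)
    rw [← h, finrank_top, finrank_euclideanSpace_fin] at h1
    omega)
  have hnp : ∀ t : ℝ, e2 ≠ t • e3 := by
    intro t h
    refine he2 (Submodule.span ℝ {e3}) (Finset.mem_insert_self _ _) ?_
    rw [h]; exact Submodule.smul_mem _ _ (Submodule.mem_span_singleton_self _)
  obtain ⟨b, a, β, hon, hβ, e2eq⟩ := exists_on h3u hnp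
  have hind : ∀ x y z : ℝ, x • a + y • e2 + z • e3 = 0 → x = 0 ∧ y = 0 ∧ z = 0 := by
    intro x y z h
    have k1 := congrArg (fun v => ⟪a, v⟫_ℝ) h
    have k2 := congrArg (fun v => ⟪b, v⟫_ℝ) h
    have k3 := congrArg (fun v => ⟪e3, v⟫_ℝ) h
    have m1 : ⟪a, e2⟫_ℝ = 0 := by
      rw [e2eq, inner_add_right, real_inner_smul_right, real_inner_smul_right, hon.an, hon.ab]; ring
    have m2 : ⟪b, e2⟫_ℝ = β := by
      rw [e2eq, inner_add_right, real_inner_smul_right, real_inner_smul_right, hon.bn, hon.b1]; ring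
    simp only [inner_add_right, real_inner_smul_right, hon.a1, hon.an, hon.na, hon.ba, hon.bn, h3u,
      m1, m2, inner_zero_right] at k1 k2 k3
    have hx : x = 0 := by linarith
    have hy : y = 0 := by
      have : y * β = 0 := by linarith
      exact (mul_eq_zero.1 this).resolve_right hβ.ne'
    refine ⟨hx, hy, ?_⟩
    rw [hy] at k3; linarith
  obtain ⟨κ, hκ, hvol⟩ := vol_frame hind
  refine ⟨a, e2, e3, κ, hN, h3, ?_, hind, hκ, hvol⟩
  intro i hi j hj h1 h2 h
  refine he2 (LinearMap.ker (innerₗ E3 (⟪i, e3⟫_ℝ • j - ⟪j, e3⟫_ℝ • i))) ?_ ?_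
  · refine Finset.mem_insert_of_mem (Finset.mem_image.2 ⟨(i, j), ?_, rfl⟩)
    simp [hi, hj, h1, h2]
  · rw [LinearMap.mem_ker, innerₗ_apply_apply]
    rw [cc, inner_sub_right, real_inner_smul_right] at h
    rw [inner_sub_left, real_inner_smul_left, real_inner_smul_left]
    have := h3 i hi
    field_simp at h
    linarith

end

section

noncomputable def gg (e3 : E3) (h : E3 → ℝ) (i : E3) : E3 := (h i / ⟪i, e3⟫_ℝ) • e3
noncomputable def c3 (e1 e2 e3 i j : E3) : E3 :=
  cc e1 e3 i - (⟪j, cc e1 e3 i⟫_ℝ / ⟪j, cc e2 e3 i⟫_ℝ) • cc e2 e3 i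
noncomputable def g3 (e2 e3 : E3) (h : E3 → ℝ) (i j : E3) : E3 :=
  gg e3 h i + ((h j - ⟪j, gg e3 h i⟫_ℝ) / ⟪j, cc e2 e3 i⟫_ℝ) • cc e2 e3 i

lemma inner_cc {e2 e3 i : E3} (h : ⟪i, e3⟫_ℝ ≠ 0) : ⟪i, cc e2 e3 i⟫_ℝ = 0 := by
  rw [cc, inner_sub_right, real_inner_smul_right]; field_simp; ring

lemma inner_gg {e3 i : E3} {h : E3 → ℝ} (h0 : ⟪i, e3⟫_ℝ ≠ 0) : ⟪i, gg e3 h i⟫_ℝ = h i := by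
  rw [gg, real_inner_smul_right]; field_simp

lemma inner_c3_left {e1 e2 e3 i j : E3} (h : ⟪i, e3⟫_ℝ ≠ 0) : ⟪i, c3 e1 e2 e3 i j⟫_ℝ = 0 := by
  rw [c3, inner_sub_right, real_inner_smul_right, inner_cc h, inner_cc h]; ring

lemma inner_c3_right {e1 e2 e3 i j : E3} (h : ⟪j, cc e2 e3 i⟫_ℝ ≠ 0) :
    ⟪j, c3 e1 e2 e3 i j⟫_ℝ = 0 := by
  rw [c3, inner_sub_right, real_inner_smul_right]; field_simp; ring

lemma inner_g3_left {e2 e3 i j : E3} {f : E3 → ℝ} (h : ⟪i, e3⟫_ℝ ≠ 0) :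
    ⟪i, g3 e2 e3 f i j⟫_ℝ = f i := by
  rw [g3, inner_add_right, real_inner_smul_right, inner_cc h, inner_gg h]; ring

lemma inner_g3_right {e2 e3 i j : E3} {f : E3 → ℝ} (h : ⟪j, cc e2 e3 i⟫_ℝ ≠ 0) :
    ⟪j, g3 e2 e3 f i j⟫_ℝ = f j := by
  rw [g3, inner_add_right, real_inner_smul_right]; field_simp; ring

/-- line segment parameter set -/
def lset (P : Set E3) (g c : E3) : Set ℝ := {z : ℝ | g + z • c ∈ P}
noncomputable def hiP (P : Set E3) (g c : E3) : E3 := g + sSup (lset P g c) • c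
noncomputable def loP (P : Set E3) (g c : E3) : E3 := g + sInf (lset P g c) • c

lemma seg3 {P : Set E3} (hP : IsCompact P) (hv : Convex ℝ P) {u g c : E3} (huc : ⟪u, c⟫_ℝ ≠ 0) :
    ∫ z : ℝ, pt P u (g + z • c) =
      (⟪u, c⟫_ℝ)⁻¹ * (Real.exp ⟪u, hiP P g c⟫_ℝ - Real.exp ⟪u, loP P g c⟫_ℝ) := by
  have hc : c ≠ 0 := by rintro rfl; simp at huc
  rcases (lset P g c).eq_empty_or_nonempty with he | hne
  · have h1 : ∀ z : ℝ, pt P u (g + z • c) = 0 := fun z => by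
      rw [pt, Set.indicator_of_notMem]
      intro h
      have : z ∈ lset P g c := h
      rw [he] at this; exact this
    simp [h1, hiP, loP, he]
  · have hcpt := line_cpt hP hc g
    have hI := compact_convex_Icc hcpt (line_cvx hv c g) hne
    have hle : sInf (lset P g c) ≤ sSup (lset P g c) :=
      Real.sInf_le_sSup _ hcpt.bddBelow hcpt.bddAbove
    simp only [pt_line]
    rw [integral_const_mul, hI, hiP, loP]
    change _ * ∫ z, (Set.Icc (sInf (lset P g c)) (sSup (lset P g c))).indicator _ z = _
    rw [seg_int huc hle]
    simp only [inner_add_right, real_inner_smul_right, Real.exp_add]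
    rw [mul_comm (sSup _), mul_comm (sInf _)]
    ring

section
variable {V : Finset E3} {P : Set E3} {N M : Finset E3} {e1 e2 e3 : E3} {κ : ℝ}

lemma lev1 (h : HPoly V P N) (g : Gen M e1 e2 e3 κ) (hN : N ⊆ M) {u : E3} (u3 : ⟪u, e3⟫_ℝ ≠ 0)
    (u2 : ∀ i ∈ N, ⟪u, cc e2 e3 i⟫_ℝ ≠ 0) (y1 : ℝ) :
    ∫ y2 : ℝ, ∫ z : ℝ, pt P u (y1 • e1 + y2 • e2 + z • e3) = (⟪u, e3⟫_ℝ)⁻¹ *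
      ∑ i ∈ N, Real.sign ⟪i, e3⟫_ℝ * ∫ y2 : ℝ, pt P u ((gg e3 (hs V) i + y1 • cc e1 e3 i) + y2 • cc e2 e3 i) := by
  classical
  have hform : ∀ i ∈ N, ∀ y2 : ℝ, y1 • e1 + y2 • e2 +
      ((hs V i - ⟪i, y1 • e1 + y2 • e2⟫_ℝ) / ⟪i, e3⟫_ℝ) • e3 =
      (gg e3 (hs V) i + y1 • cc e1 e3 i) + y2 • cc e2 e3 i := by
    intro i hi y2
    rw [gg, cc, cc, inner_add_right, real_inner_smul_right, real_inner_smul_right, sub_div, add_div,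
      mul_div_assoc, mul_div_assoc]
    module
  have hae : ∀ᵐ y2 : ℝ, y2 ∉ ((N ×ˢ N).image fun p : E3 × E3 =>
      (hs V p.2 - ⟪p.2, gg e3 (hs V) p.1 + y1 • cc e1 e3 p.1⟫_ℝ) / ⟪p.2, cc e2 e3 p.1⟫_ℝ : Finset ℝ) := by
    exact (Finset.countable_toSet _).ae_notMem volume
  have : ∫ y2 : ℝ, ∫ z : ℝ, pt P u (y1 • e1 + y2 • e2 + z • e3) = ∫ y2 : ℝ, (⟪u, e3⟫_ℝ)⁻¹ *
      ∑ i ∈ N, Real.sign ⟪i, e3⟫_ℝ * pt P u ((gg e3 (hs V) i + y1 • cc e1 e3 i) + y2 • cc e2 e3 i) := by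
    refine integral_congr_ae ?_
    filter_upwards [hae] with y2 hy2
    rw [pl2 h.cpt h.rep u3]
    · congr 1
      exact Finset.sum_congr rfl fun i hi => by rw [hform i hi]
    · intro i hi j hj hij hs0 z hz ei ej
      have n3 := g.ne3 i (hN hi)
      have hji : j ≠ -i := by
        rintro rfl
        rw [inner_neg_left] at hs0
        nlinarith [mul_self_nonneg ⟪i, e3⟫_ℝ]
      have hnc := g.nc i (hN hi) j (hN hj) hij.symm hji
      apply hy2
      refine Finset.mem_image.2 ⟨(i, j), by simp [hi, hj], ?_⟩
      have hz' : z = (hs V i - ⟪i, y1 • e1 + y2 • e2⟫_ℝ) / ⟪i, e3⟫_ℝ := by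
        rw [inner_add_right, real_inner_smul_right] at ei
        field_simp; linarith
      rw [hz', hform i hi, inner_add_right, real_inner_smul_right] at ej
      field_simp; linarith
  rw [this, integral_const_mul, integral_finset_sum]
  · simp only [integral_const_mul]
  · intro i hi
    exact (pt_integrable h.cpt (fun h0 => u2 i hi (by rw [h0]; simp)) u _).const_mul _

lemma lev2 (h : HPoly V P N) (g : Gen M e1 e2 e3 κ) (hN : N ⊆ M) {u : E3}
    (u2 : ∀ i ∈ N, ⟪u, cc e2 e3 i⟫_ℝ ≠ 0) :
    ∀ᵐ y1 : ℝ, ∀ i ∈ N, ∫ y2 : ℝ, pt P u ((gg e3 (hs V) i + y1 • cc e1 e3 i) + y2 • cc e2 e3 i) =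
      (⟪u, cc e2 e3 i⟫_ℝ)⁻¹ * ∑ j ∈ N, Real.sign ⟪j, cc e2 e3 i⟫_ℝ *
        pt P u (g3 e2 e3 (hs V) i j + y1 • c3 e1 e2 e3 i j) := by
  have hform : ∀ i ∈ N, ∀ j ∈ N, ∀ y1 : ℝ, gg e3 (hs V) i + y1 • cc e1 e3 i +
      ((hs V j - ⟪j, gg e3 (hs V) i + y1 • cc e1 e3 i⟫_ℝ) / ⟪j, cc e2 e3 i⟫_ℝ) • cc e2 e3 i =
      g3 e2 e3 (hs V) i j + y1 • c3 e1 e2 e3 i j := by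
    intro i hi j hj y1
    rw [g3, c3, inner_add_right, real_inner_smul_right, ← sub_sub, sub_div _ (y1 * _), mul_div_assoc]
    module
  set bad : E3 → E3 → E3 → Set ℝ := fun i j k => {y1 | ∃ z : ℝ,
    i ≠ j ∧ i ≠ k ∧ j ≠ k ∧
    ⟪j, (gg e3 (hs V) i + y1 • cc e1 e3 i) + z • cc e2 e3 i⟫_ℝ = hs V j ∧
    ⟪k, (gg e3 (hs V) i + y1 • cc e1 e3 i) + z • cc e2 e3 i⟫_ℝ = hs V k} with hbad
  have hact : ∀ i ∈ N, ∀ y1 z : ℝ,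
      ⟪i, (gg e3 (hs V) i + y1 • cc e1 e3 i) + z • cc e2 e3 i⟫_ℝ = hs V i := by
    intro i hi y1 z
    rw [inner_add_right, inner_add_right, real_inner_smul_right, real_inner_smul_right,
      inner_cc (g.ne3 i (hN hi)), inner_cc (g.ne3 i (hN hi)), inner_gg (g.ne3 i (hN hi))]; ring
  have hfin : (⋃ i ∈ N, ⋃ j ∈ N, ⋃ k ∈ N, bad i j k).Finite := by
    refine N.finite_toSet.biUnion fun i hi => N.finite_toSet.biUnion fun j hj =>
      N.finite_toSet.biUnion fun k hk => Set.Subsingleton.finite ?_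
    rintro y ⟨z, hij, hik, hjk, hj1, hk1⟩ y' ⟨z', -, -, -, hj2, hk2⟩
    have := h.ir i hi j hj k hk hij hik hjk _ _ (hact i hi y z) hj1 hk1 (hact i hi y' z') hj2 hk2
    have h0 := sub_eq_zero.2 this
    have := g.indep (y - y') (z - z') (-(y - y') * (⟪i, e1⟫_ℝ / ⟪i, e3⟫_ℝ) -
      (z - z') * (⟪i, e2⟫_ℝ / ⟪i, e3⟫_ℝ)) (by rw [← h0, cc, cc]; module)
    linarith [this.1]
  filter_upwards [hfin.countable.ae_notMem volume] with y1 hy1 i hi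
  rw [pl2 h.cpt h.rep (u2 i hi)]
  · congr 1
    exact Finset.sum_congr rfl fun j hj => by rw [hform i hi j hj]
  · intro j hj k hk hjk hs0 z hz ej ek
    apply hy1
    simp only [Set.mem_iUnion]
    refine ⟨i, hi, j, hj, k, hk, z, ?_, ?_, hjk, ej, ek⟩
    · rintro rfl; rw [inner_cc (g.ne3 i (hN hi))] at hs0; simp at hs0
    · rintro rfl; rw [inner_cc (g.ne3 i (hN hi))] at hs0; simp at hs0

theorem lev3 (h : HPoly V P N) (g : Gen M e1 e2 e3 κ) (hN : N ⊆ M) {u : E3} (u3 : ⟪u, e3⟫_ℝ ≠ 0)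
    (u2 : ∀ i ∈ N, ⟪u, cc e2 e3 i⟫_ℝ ≠ 0) (u1 : ∀ i ∈ N, ∀ j ∈ N, ⟪u, c3 e1 e2 e3 i j⟫_ℝ ≠ 0) :
    ∫ x, pt P u x = κ * ((⟪u, e3⟫_ℝ)⁻¹ * ∑ i ∈ N, Real.sign ⟪i, e3⟫_ℝ * ((⟪u, cc e2 e3 i⟫_ℝ)⁻¹ *
      ∑ j ∈ N, Real.sign ⟪j, cc e2 e3 i⟫_ℝ * ((⟪u, c3 e1 e2 e3 i j⟫_ℝ)⁻¹ *
      (Real.exp ⟪u, hiP P (g3 e2 e3 (hs V) i j) (c3 e1 e2 e3 i j)⟫_ℝ -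
       Real.exp ⟪u, loP P (g3 e2 e3 (hs V) i j) (c3 e1 e2 e3 i j)⟫_ℝ)))) := by
  rw [g.vol P u h.cpt]
  congr 1
  simp only [lev1 h g hN u3 u2]
  rw [integral_const_mul]
  congr 1
  have hIntr : ∀ i ∈ N, ∀ j ∈ N, Integrable fun y1 : ℝ =>
      pt P u (g3 e2 e3 (hs V) i j + y1 • c3 e1 e2 e3 i j) := fun i hi j hj =>
    pt_integrable h.cpt (fun h0 => u1 i hi j hj (by rw [h0]; simp)) u _
  have : ∫ y1 : ℝ, ∑ i ∈ N, Real.sign ⟪i, e3⟫_ℝ *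
        ∫ y2 : ℝ, pt P u ((gg e3 (hs V) i + y1 • cc e1 e3 i) + y2 • cc e2 e3 i) =
      ∫ y1 : ℝ, ∑ i ∈ N, Real.sign ⟪i, e3⟫_ℝ * ((⟪u, cc e2 e3 i⟫_ℝ)⁻¹ *
        ∑ j ∈ N, Real.sign ⟪j, cc e2 e3 i⟫_ℝ *
        pt P u (g3 e2 e3 (hs V) i j + y1 • c3 e1 e2 e3 i j)) := by
    refine integral_congr_ae ?_
    filter_upwards [lev2 h g hN u2] with y1 hy1
    exact Finset.sum_congr rfl fun i hi => by rw [hy1 i hi]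
  rw [this, integral_finset_sum]
  · refine Finset.sum_congr rfl fun i hi => ?_
    rw [integral_const_mul, integral_const_mul, integral_finset_sum]
    · congr 2
      refine Finset.sum_congr rfl fun j hj => ?_
      rw [integral_const_mul, seg3 h.cpt h.cvx (u1 i hi j hj)]
    · intro j hj
      exact (hIntr i hi j hj).const_mul _
  · intro i hi
    refine Integrable.const_mul (Integrable.const_mul (integrable_finset_sum _ fun j hj => ?_) _) _
    exact (hIntr i hi j hj).const_mul _
end

end

section

noncomputable abbrev evc (u : E3) : R3 →+* ℝ := MvPolynomial.eval (fun i => u i)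

lemma poly_zero {r D : R3} (hD : D ≠ 0) (h : ∀ u : E3, evc u D ≠ 0 → evc u r = 0) : r = 0 := by
  have : r * D = 0 := by
    apply MvPolynomial.funext
    intro x
    have h1 := h (WithLp.toLp 2 x)
    rw [map_mul, map_zero]
    by_cases h2 : MvPolynomial.eval x D = 0
    · rw [h2, mul_zero]
    · have h3 : MvPolynomial.eval x r = 0 := h1 h2
      rw [h3, zero_mul]
  exact (mul_eq_zero.1 this).resolve_right hD

lemma lin_ne_zero {c : E3} (hc : c ≠ 0) : lin c ≠ 0 := by
  intro h
  have := eval_lin c c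
  rw [h, map_zero] at this
  exact hc (inner_self_eq_zero.1 this.symm)

noncomputable def xch (u : E3) (t : ℝ) : Multiplicative E3 →* ℝ where
  toFun v := Real.exp (t * ⟪u, v.toAdd⟫_ℝ)
  map_one' := by simp
  map_mul' v w := by rw [toAdd_mul, inner_add_right, mul_add, Real.exp_add]

noncomputable def Ex (u : E3) (t : ℝ) : RE →+* ℝ :=
  AddMonoidAlgebra.liftNCRingHom (evc u) (xch u t) (fun _ _ => Commute.all _ _)

lemma Ex_single (u v : E3) (t : ℝ) (r : R3) : Ex u t (AddMonoidAlgebra.single v r) =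
    evc u r * Real.exp (t * ⟪u, v⟫_ℝ) := by
  change AddMonoidAlgebra.liftNC _ _ _ = _
  rw [AddMonoidAlgebra.liftNC_single]; rfl

lemma Ex_sum (u : E3) (t : ℝ) (x : RE) : Ex u t x =
    ∑ v ∈ sp x, evc u (x.coeff v) * Real.exp (t * ⟪u, v⟫_ℝ) := by
  change AddMonoidAlgebra.liftNC _ _ _ = _
  rw [liftNC_eq_sum]; rfl

lemma evc_mom (u : E3) (k : ℕ) (x : RE) : evc u (mom k x) =
    ∑ v ∈ sp x, evc u (x.coeff v) * ⟪u, v⟫_ℝ ^ k := by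
  rw [mom, Finsupp.sum, map_sum]
  refine Finset.sum_congr rfl fun v _ => ?_
  rw [map_mul, map_pow, eval_lin, real_inner_comm]

noncomputable def qq (e1 e2 e3 : E3) (p : E3 × E3) : R3 :=
  lin e3 * lin (cc e2 e3 p.1) * lin (c3 e1 e2 e3 p.1 p.2)

noncomputable def DD (M : Finset E3) (e1 e2 e3 : E3) : R3 :=
  lin e3 * ∏ p ∈ M ×ˢ M, qq e1 e2 e3 p

open Classical in
noncomputable def co (M : Finset E3) (e1 e2 e3 : E3) (p : E3 × E3) : R3 :=
  lin e3 * ∏ p ∈ (M ×ˢ M).erase p, qq e1 e2 e3 p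

lemma co_mul {M : Finset E3} {e1 e2 e3 i j : E3} (hi : i ∈ M) (hj : j ∈ M) :
    DD M e1 e2 e3 = co M e1 e2 e3 (i, j) * qq e1 e2 e3 (i, j) := by
  classical
  rw [DD, co, mul_assoc, Finset.prod_erase_mul _ _ (by simp [hi, hj])]

noncomputable def sg (e2 e3 i j : E3) : ℝ := Real.sign ⟪i, e3⟫_ℝ * Real.sign ⟪j, cc e2 e3 i⟫_ℝ

section
variable (V : Finset E3) (P : Set E3) (N M : Finset E3) (e1 e2 e3 : E3)

noncomputable def hi3 (i j : E3) : E3 := hiP P (g3 e2 e3 (hs V) i j) (c3 e1 e2 e3 i j)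
noncomputable def lo3 (i j : E3) : E3 := loP P (g3 e2 e3 (hs V) i j) (c3 e1 e2 e3 i j)

noncomputable def AA : RE := ∑ i ∈ N, ∑ j ∈ N,
  (AddMonoidAlgebra.single (hi3 V P e1 e2 e3 i j)
    (MvPolynomial.C (sg e2 e3 i j) * co M e1 e2 e3 (i, j)) -
  AddMonoidAlgebra.single (lo3 V P e1 e2 e3 i j)
    (MvPolynomial.C (sg e2 e3 i j) * co M e1 e2 e3 (i, j)))
end

section
variable {V : Finset E3} {P : Set E3} {N M : Finset E3} {e1 e2 e3 : E3} {κ : ℝ}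

lemma Gen.e3_ne (g : Gen M e1 e2 e3 κ) : e3 ≠ 0 := fun h => by
  have := g.indep 0 0 1 (by rw [h]; simp)
  exact one_ne_zero this.2.2

lemma Gen.cc_ne (g : Gen M e1 e2 e3 κ) (i : E3) : cc e2 e3 i ≠ 0 := fun h => by
  have := g.indep 0 1 (-(⟪i, e2⟫_ℝ / ⟪i, e3⟫_ℝ)) (by rw [← h, cc]; module)
  exact one_ne_zero this.2.1

lemma Gen.c3_ne (g : Gen M e1 e2 e3 κ) (i j : E3) : c3 e1 e2 e3 i j ≠ 0 := fun h => by
  have := g.indep 1 (-(⟪j, cc e1 e3 i⟫_ℝ / ⟪j, cc e2 e3 i⟫_ℝ))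
    (-(⟪i, e1⟫_ℝ / ⟪i, e3⟫_ℝ) + (⟪j, cc e1 e3 i⟫_ℝ / ⟪j, cc e2 e3 i⟫_ℝ) * (⟪i, e2⟫_ℝ / ⟪i, e3⟫_ℝ))
    (by
      rw [← h, c3]
      generalize ⟪j, cc e1 e3 i⟫_ℝ / ⟪j, cc e2 e3 i⟫_ℝ = r
      rw [cc, cc]; module)
  exact one_ne_zero this.1

lemma Gen.DD_ne (g : Gen M e1 e2 e3 κ) : DD M e1 e2 e3 ≠ 0 := by
  refine mul_ne_zero (lin_ne_zero g.e3_ne) (Finset.prod_ne_zero_iff.2 fun p _ => ?_)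
  exact mul_ne_zero (mul_ne_zero (lin_ne_zero g.e3_ne) (lin_ne_zero (g.cc_ne _)))
    (lin_ne_zero (g.c3_ne _ _))

theorem star (h : HPoly V P N) (g : Gen M e1 e2 e3 κ) (hN : N ⊆ M) {u : E3}
    (hu : evc u (DD M e1 e2 e3) ≠ 0) (t : ℝ) :
    evc u (DD M e1 e2 e3) * t ^ 3 * ∫ x, pt P (t • u) x = κ * Ex u t (AA V P N M e1 e2 e3) := by
  have hAA : Ex u t (AA V P N M e1 e2 e3) = ∑ i ∈ N, ∑ j ∈ N, sg e2 e3 i j *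
      evc u (co M e1 e2 e3 (i, j)) * (Real.exp (t * ⟪u, hi3 V P e1 e2 e3 i j⟫_ℝ) -
        Real.exp (t * ⟪u, lo3 V P e1 e2 e3 i j⟫_ℝ)) := by
    rw [AA, map_sum]
    refine Finset.sum_congr rfl fun i _ => ?_
    rw [map_sum]
    refine Finset.sum_congr rfl fun j _ => ?_
    rw [map_sub, Ex_single, Ex_single, map_mul, MvPolynomial.eval_C]; ring
  by_cases ht : t = 0
  · rw [hAA, ht]; simp
  have hE : evc u (lin e3) ≠ 0 := fun h0 => hu (by rw [DD, map_mul, h0, zero_mul])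
  have hq : ∀ i ∈ N, ∀ j ∈ N, evc u (qq e1 e2 e3 (i, j)) ≠ 0 := fun i hi j hj h0 =>
    hu (by rw [co_mul (hN hi) (hN hj), map_mul, h0, mul_zero])
  have hq' : ∀ i j, evc u (qq e1 e2 e3 (i, j)) =
      ⟪u, e3⟫_ℝ * ⟪u, cc e2 e3 i⟫_ℝ * ⟪u, c3 e1 e2 e3 i j⟫_ℝ := fun i j => by
    rw [qq, map_mul, map_mul, eval_lin, eval_lin, eval_lin, real_inner_comm, real_inner_comm u,
      real_inner_comm u]
  rw [eval_lin, real_inner_comm] at hE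
  have k2 : ∀ i ∈ N, ⟪u, cc e2 e3 i⟫_ℝ ≠ 0 := fun i hi h0 => hq i hi i hi (by rw [hq', h0]; ring)
  have k1 : ∀ i ∈ N, ∀ j ∈ N, ⟪u, c3 e1 e2 e3 i j⟫_ℝ ≠ 0 := fun i hi j hj h0 =>
    hq i hi j hj (by rw [hq', h0]; ring)
  have hin : ∀ c : E3, ⟪t • u, c⟫_ℝ = t * ⟪u, c⟫_ℝ := fun c => real_inner_smul_left _ _ _
  rw [lev3 h g hN (u := t • u) (by rw [hin]; exact mul_ne_zero ht hE)
    (fun i hi => by rw [hin]; exact mul_ne_zero ht (k2 i hi))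
    (fun i hi j hj => by rw [hin]; exact mul_ne_zero ht (k1 i hi j hj)), hAA]
  simp only [Finset.mul_sum]
  refine Finset.sum_congr rfl fun i hi => Finset.sum_congr rfl fun j hj => ?_
  rw [co_mul (hN hi) (hN hj), map_mul, hq', sg, hin, hin, hin, hin, hin, hi3, lo3]
  have a1 := k2 i hi
  have a2 := k1 i hi j hj
  field_simp

lemma hi3_mem (hP : IsCompact P) (g : Gen M e1 e2 e3 κ) {i j : E3}
    (hne : hi3 V P e1 e2 e3 i j ≠ lo3 V P e1 e2 e3 i j) :
    hi3 V P e1 e2 e3 i j ∈ P ∧ lo3 V P e1 e2 e3 i j ∈ P := by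
  have h1 : (lset P (g3 e2 e3 (hs V) i j) (c3 e1 e2 e3 i j)).Nonempty := by
    by_contra h0
    rw [Set.not_nonempty_iff_eq_empty] at h0
    apply hne
    simp [hi3, lo3, hiP, loP, h0]
  have hc : IsCompact (lset P (g3 e2 e3 (hs V) i j) (c3 e1 e2 e3 i j)) :=
    line_cpt hP (g.c3_ne i j) _
  exact ⟨hc.sSup_mem h1, hc.sInf_mem h1⟩

lemma spAA_subset (hP : IsCompact P) (g : Gen M e1 e2 e3 κ) :
    ∀ v ∈ sp (AA V P N M e1 e2 e3), v ∈ P := by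
  classical
  intro v hv
  by_contra hvP
  rw [Finsupp.mem_support_iff] at hv
  apply hv
  rw [AA, AddMonoidAlgebra.coeff_sum, Finsupp.finset_sum_apply]
  refine Finset.sum_eq_zero fun i _ => ?_
  rw [AddMonoidAlgebra.coeff_sum, Finsupp.finset_sum_apply]
  refine Finset.sum_eq_zero fun j _ => ?_
  by_cases h : hi3 V P e1 e2 e3 i j = lo3 V P e1 e2 e3 i j
  · rw [h]; simp
  · obtain ⟨h1, h2⟩ := hi3_mem hP g h
    have n1 : hi3 V P e1 e2 e3 i j ≠ v := by rintro rfl; exact hvP h1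
    have n2 : lo3 V P e1 e2 e3 i j ≠ v := by rintro rfl; exact hvP h2
    simp [AddMonoidAlgebra.coeff_single, Finsupp.single_apply, n1, n2]
end

end

section

lemma pt_nonneg (P : Set E3) (u x : E3) : 0 ≤ pt P u x :=
  Set.indicator_nonneg (fun _ _ => (Real.exp_pos _).le) _

lemma pt_int {P : Set E3} (hP : IsCompact P) (u : E3) : Integrable (pt P u) := by
  have : pt P u = P.indicator (fun x => Real.exp ⟪u, x⟫_ℝ) := rfl
  rw [this, integrable_indicator_iff hP.measurableSet]
  exact (Continuous.continuousOn (by fun_prop)).integrableOn_compact hP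

/-- lower bound -/
lemma F_lower {P K : Set E3} (hP : IsCompact P) (hK : MeasurableSet K) (hKP : K ⊆ P) {u : E3} {m : ℝ}
    (hm : ∀ x ∈ K, m ≤ ⟪u, x⟫_ℝ) : volume.real K * Real.exp m ≤ ∫ x, pt P u x := by
  have hfin : volume K ≠ ⊤ := ((measure_mono hKP).trans_lt hP.measure_lt_top).ne
  have h1 : ∫ x, K.indicator (fun _ => Real.exp m) x = volume.real K * Real.exp m := by
    rw [integral_indicator hK, setIntegral_const, smul_eq_mul]
  rw [← h1]
  refine integral_mono_of_nonneg (Filter.Eventually.of_forall fun x => ?_) (pt_int hP u)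
    (Filter.Eventually.of_forall fun x => ?_)
  · exact Set.indicator_nonneg (fun _ _ => (Real.exp_pos _).le) _
  · by_cases hx : x ∈ K
    · simp only [Set.indicator_of_mem hx, pt, Set.indicator_of_mem (hKP hx)]
      exact Real.exp_le_exp.2 (hm x hx)
    · simp only [Set.indicator_of_notMem hx]; exact pt_nonneg _ _ _

lemma F_upper {P : Set E3} (hP : IsCompact P) (u : E3) :
    ∃ C : ℝ, ∀ t : ℝ, 0 ≤ t → t ≤ 1 → ∫ x, pt P (t • u) x ≤ C := by
  obtain ⟨M, hM⟩ := hP.isBounded.exists_norm_le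
  refine ⟨∫ x, P.indicator (fun _ => Real.exp (‖u‖ * M)) x, fun t h0 h1 => ?_⟩
  refine integral_mono (pt_int hP _) ?_ fun x => ?_
  · rw [integrable_indicator_iff hP.measurableSet]
    exact continuousOn_const.integrableOn_compact hP
  · by_cases hx : x ∈ P
    · simp only [pt, Set.indicator_of_mem hx]
      refine Real.exp_le_exp.2 ?_
      rw [real_inner_smul_left]
      have h2 := real_inner_le_norm u x
      have h3 : ⟪u, x⟫_ℝ ≤ ‖u‖ * M := h2.trans (mul_le_mul_of_nonneg_left (hM x hx) (norm_nonneg _))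
      have h4 : 0 ≤ ‖u‖ * M := mul_nonneg (norm_nonneg _) ((norm_nonneg _).trans (hM x hx))
      nlinarith
    · simp only [pt, Set.indicator_of_notMem hx]; exact le_rfl

lemma poly_near {D : R3} (hD : D ≠ 0) (w : E3) {δ : ℝ} (hδ : 0 < δ) :
    ∃ u : E3, ‖u - w‖ < δ ∧ evc u D ≠ 0 := by
  obtain ⟨u1, h1⟩ : ∃ u : E3, evc u D ≠ 0 := by
    by_contra h
    push Not at h
    exact hD (poly_zero (D := 1) one_ne_zero fun u _ => h u)
  set p := psi w (u1 - w) 0 D with hp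
  have he : ∀ ε : ℝ, p.eval ε = evc (w + ε • (u1 - w)) D := fun ε => by
    rw [hp, psi_eval, smul_zero, add_zero]
  have hp0 : p ≠ 0 := by
    intro h
    have := he 1
    rw [h] at this
    apply h1
    rw [one_smul, add_sub_cancel] at this
    rw [← this]; simp
  have hfin : {x | p.IsRoot x}.Finite := Polynomial.finite_setOf_isRoot hp0
  set η := δ / (‖u1 - w‖ + 1)
  have hη : 0 < η := by positivity
  obtain ⟨ε, hε, hr⟩ := ((Set.Ioo_infinite hη).diff hfin).nonempty
  refine ⟨w + ε • (u1 - w), ?_, ?_⟩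
  · rw [add_sub_cancel_left, norm_smul, Real.norm_eq_abs, abs_of_pos hε.1]
    calc ε * ‖u1 - w‖ ≤ ε * (‖u1 - w‖ + 1) := by nlinarith [hε.1]
      _ < η * (‖u1 - w‖ + 1) := by
        apply mul_lt_mul_of_pos_right hε.2; positivity
      _ = δ := by simp only [η]; field_simp
  · rw [← he]; exact hr

lemma small_poly {m0 m1 m2 C δ : ℝ} (hδ : 0 < δ)
    (h : ∀ t, 0 < t → t < δ → |m0 + m1 * t + m2 * t ^ 2| ≤ C * t ^ 3) : m0 = 0 ∧ m1 = 0 ∧ m2 = 0 := by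
  have key : ∀ (f g : ℝ → ℝ), Continuous f → Continuous g → g 0 = 0 →
      (∀ t, 0 < t → t < δ → |f t| ≤ g t) → f 0 = 0 := by
    intro f g hf hg g0 hfg
    have h1 : Filter.Tendsto (fun t => |f t|) (nhdsWithin 0 (Set.Ioi 0)) (nhds |f 0|) :=
      (hf.abs.tendsto 0).mono_left nhdsWithin_le_nhds
    have h2 : Filter.Tendsto g (nhdsWithin 0 (Set.Ioi 0)) (nhds (g 0)) :=
      (hg.tendsto 0).mono_left nhdsWithin_le_nhds
    have h3 := le_of_tendsto_of_tendsto h1 h2 (by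
      filter_upwards [Ioo_mem_nhdsGT hδ] with t ht using hfg t ht.1 ht.2)
    rw [g0] at h3
    exact abs_eq_zero.1 (le_antisymm h3 (abs_nonneg _))
  have e0 : m0 = 0 := by
    have := key (fun t => m0 + m1 * t + m2 * t ^ 2) (fun t => C * t ^ 3) (by fun_prop) (by fun_prop)
      (by simp) h
    simpa using this
  have e1 : m1 = 0 := by
    have := key (fun t => m1 + m2 * t) (fun t => C * t ^ 2) (by fun_prop) (by fun_prop)
      (by simp) (fun t h0 h1 => by
        have := h t h0 h1
        have e : m0 + m1 * t + m2 * t ^ 2 = t * (m1 + m2 * t) := by rw [e0]; ring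
        rw [e, abs_mul, abs_of_pos h0] at this
        exact le_of_mul_le_mul_left (by linarith) h0)
    simpa using this
  refine ⟨e0, e1, ?_⟩
  have := key (fun t => m2) (fun t => C * t) (by fun_prop) (by fun_prop)
      (by simp) (fun t h0 h1 => by
        have := h t h0 h1
        have e : m0 + m1 * t + m2 * t ^ 2 = t ^ 2 * m2 := by rw [e0, e1]; ring
        rw [e, abs_mul, abs_of_pos (by positivity)] at this
        exact le_of_mul_le_mul_left (a := t ^ 2) (by linarith) (by positivity))
  simpa using this

section
variable {V : Finset E3} {P : Set E3} {N M : Finset E3} {e1 e2 e3 : E3} {κ : ℝ}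

lemma moms (h : HPoly V P N) (g : Gen M e1 e2 e3 κ) (hN : N ⊆ M) :
    mom 0 (AA V P N M e1 e2 e3) = 0 ∧ mom 1 (AA V P N M e1 e2 e3) = 0 ∧
    mom 2 (AA V P N M e1 e2 e3) = 0 := by
  set A := AA V P N M e1 e2 e3 with hA
  have key : ∀ u : E3, evc u (DD M e1 e2 e3) ≠ 0 → evc u (mom 0 A) = 0 ∧ evc u (mom 1 A) = 0 ∧
      evc u (mom 2 A) / 2 = 0 := by
    intro u hu
    obtain ⟨C, hC⟩ := F_upper h.cpt u
    set B := ∑ v ∈ sp A, |⟪u, v⟫_ℝ| with hB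
    have hB0 : 0 ≤ B := Finset.sum_nonneg fun _ _ => abs_nonneg _
    set K := ∑ v ∈ sp A, |evc u (A.coeff v)| * |⟪u, v⟫_ℝ| ^ 3 with hK
    refine small_poly (C := K + κ⁻¹ * |evc u (DD M e1 e2 e3)| * C) (δ := 1 / (B + 1)) (by positivity)
      fun t t0 t1 => ?_
    have tB : t * (B + 1) < 1 := by rwa [lt_div_iff₀ (by positivity)] at t1
    have t1' : t ≤ 1 := by nlinarith
    have hst := star h g hN hu t
    rw [← hA] at hst
    have e1' : |Ex u t A| ≤ κ⁻¹ * |evc u (DD M e1 e2 e3)| * C * t ^ 3 := by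
      have : Ex u t A = κ⁻¹ * (evc u (DD M e1 e2 e3) * t ^ 3 * ∫ x, pt P (t • u) x) := by
        rw [hst, inv_mul_cancel_left₀ g.κ0.ne']
      rw [this, abs_mul, abs_mul, abs_mul, abs_of_pos (inv_pos.2 g.κ0),
        abs_of_pos (pow_pos t0 3), abs_of_nonneg (integral_nonneg (pt_nonneg _ _))]
      have h1 := hC t t0.le t1'
      have h2 : 0 ≤ κ⁻¹ * |evc u (DD M e1 e2 e3)| * t ^ 3 := by
        have := inv_pos.2 g.κ0
        positivity
      have := mul_le_mul_of_nonneg_left h1 h2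
      linarith
    have e2' : |Ex u t A - (evc u (mom 0 A) + evc u (mom 1 A) * t + evc u (mom 2 A) / 2 * t ^ 2)| ≤
        K * t ^ 3 := by
      rw [Ex_sum, evc_mom, evc_mom, evc_mom]
      have : ∑ v ∈ sp A, evc u (A.coeff v) * Real.exp (t * ⟪u, v⟫_ℝ) -
          (∑ v ∈ sp A, evc u (A.coeff v) * ⟪u, v⟫_ℝ ^ 0 +
            (∑ v ∈ sp A, evc u (A.coeff v) * ⟪u, v⟫_ℝ ^ 1) * t +
            (∑ v ∈ sp A, evc u (A.coeff v) * ⟪u, v⟫_ℝ ^ 2) / 2 * t ^ 2) =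
          ∑ v ∈ sp A, evc u (A.coeff v) * (Real.exp (t * ⟪u, v⟫_ℝ) -
            (1 + t * ⟪u, v⟫_ℝ + (t * ⟪u, v⟫_ℝ) ^ 2 / 2)) := by
        rw [Finset.sum_mul, Finset.sum_div, Finset.sum_mul, ← Finset.sum_add_distrib,
          ← Finset.sum_add_distrib, ← Finset.sum_sub_distrib]
        exact Finset.sum_congr rfl fun v _ => by ring
      rw [this, hK, Finset.sum_mul]
      refine (Finset.abs_sum_le_sum_abs _ _).trans (Finset.sum_le_sum fun v hv => ?_)
      rw [abs_mul, mul_assoc]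
      refine mul_le_mul_of_nonneg_left ?_ (abs_nonneg _)
      have hvB : |⟪u, v⟫_ℝ| ≤ B := Finset.single_le_sum (f := fun v => |⟪u, v⟫_ℝ|)
        (fun _ _ => abs_nonneg _) hv
      have hx : |t * ⟪u, v⟫_ℝ| ≤ 1 := by
        rw [abs_mul, abs_of_pos t0]; nlinarith
      have hb := Real.exp_bound hx (n := 3) (by norm_num)
      simp only [Finset.sum_range_succ, Finset.sum_range_zero] at hb
      norm_num [Nat.factorial] at hb
      have e5 : |t * ⟪u, v⟫_ℝ| ^ 3 = |⟪u, v⟫_ℝ| ^ 3 * t ^ 3 := by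
        rw [abs_mul, abs_of_pos t0]; ring
      rw [← e5]
      refine hb.trans ?_
      have := pow_nonneg (abs_nonneg (t * ⟪u, v⟫_ℝ)) 3
      rw [abs_mul] at this ⊢
      nlinarith
    have := abs_sub_abs_le_abs_sub (evc u (mom 0 A) + evc u (mom 1 A) * t + evc u (mom 2 A) / 2 * t ^ 2)
      (Ex u t A)
    rw [abs_sub_comm] at this
    linarith
  refine ⟨poly_zero g.DD_ne fun u hu => (key u hu).1, poly_zero g.DD_ne fun u hu => (key u hu).2.1,
    poly_zero g.DD_ne fun u hu => ?_⟩
  have := (key u hu).2.2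
  linarith

lemma F_pos (h : HPoly V P N) (u : E3) {δ : ℝ} (hδ : 0 < δ) : ∃ c : ℝ, 0 < c ∧ ∀ t : ℝ, 0 ≤ t →
    c * Real.exp (t * (hs V u - δ)) ≤ ∫ x, pt P (t • u) x := by
  obtain ⟨v, hv, ev⟩ := exists_hs h.ne u
  set K := interior P ∩ {x | hs V u - δ < ⟪u, x⟫_ℝ} with hK
  have hKo : IsOpen K := isOpen_interior.inter (isOpen_lt continuous_const (by fun_prop))
  have hKn : K.Nonempty := by
    have : v ∈ closure (interior P) := by
      rw [h.cvx.closure_interior_eq_closure_of_nonempty_interior h.int]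
      exact subset_closure (h.VP hv)
    obtain ⟨x, hx1, hx2⟩ := mem_closure_iff.1 this {x | hs V u - δ < ⟪u, x⟫_ℝ}
      (isOpen_lt continuous_const (by fun_prop)) (by simp only [Set.mem_setOf_eq]; linarith)
    exact ⟨x, hx2, hx1⟩
  have hKP : K ⊆ P := Set.inter_subset_left.trans interior_subset
  have hfin : volume K ≠ ⊤ := ((measure_mono hKP).trans_lt h.cpt.measure_lt_top).ne
  refine ⟨volume.real K, ENNReal.toReal_pos (hKo.measure_pos _ hKn).ne' hfin, fun t ht => ?_⟩
  refine F_lower h.cpt hKo.measurableSet hKP fun x hx => ?_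
  rw [real_inner_smul_left]
  exact mul_le_mul_of_nonneg_left (le_of_lt hx.2) ht

lemma AA_ne (h : HPoly V P N) (g : Gen M e1 e2 e3 κ) (hN : N ⊆ M) : AA V P N M e1 e2 e3 ≠ 0 := by
  intro h0
  obtain ⟨u, -, hu⟩ := poly_near g.DD_ne 0 one_pos
  have hst := star h g hN hu 1
  obtain ⟨c, hc, hF⟩ := F_pos h u one_pos
  have hF := hF 1 zero_le_one
  have : 0 < c * Real.exp (1 * (hs V u - 1)) := by positivity
  rw [h0, map_zero, mul_zero, one_pow, mul_one] at hst
  rcases mul_eq_zero.1 hst with h1 | h1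
  · exact hu h1
  · linarith

lemma hs_spAA (h : HPoly V P N) (g : Gen M e1 e2 e3 κ) (hN : N ⊆ M) (w : E3) :
    hs (sp (AA V P N M e1 e2 e3)) w = hs V w := by
  set A := AA V P N M e1 e2 e3 with hA
  have hne : (sp A).Nonempty := by
    rw [Finsupp.support_nonempty_iff]
    intro h0
    apply AA_ne h g hN
    apply AddMonoidAlgebra.coeff_injective
    simpa using h0
  apply le_antisymm
  · exact hs_le hne fun v hv => h.le v (spAA_subset h.cpt g v hv) w
  by_contra hlt
  push Not at hlt
  have hopen : IsOpen {w | hs (sp A) w < hs V w} :=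
    isOpen_lt (hs_continuous _) (hs_continuous _)
  obtain ⟨δ, hδ, hball⟩ := Metric.isOpen_iff.1 hopen w hlt
  obtain ⟨u, hu1, hu⟩ := poly_near g.DD_ne w hδ
  have hlt : hs (sp A) u < hs V u := hball (by rw [Metric.mem_ball, dist_eq_norm]; exact hu1)
  set h' := hs (sp A) u with hh'
  obtain ⟨c, hc, hF⟩ := F_pos h u (sub_pos.2 hlt)
  have hb : ∀ t : ℝ, 0 ≤ t → |evc u (DD M e1 e2 e3)| * c * t ^ 3 ≤
      κ * ∑ v ∈ sp A, |evc u (A.coeff v)| := by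
    intro t ht
    have h1 := hF t ht
    rw [sub_sub_cancel] at h1
    have hst := congrArg abs (star h g hN hu t)
    rw [abs_mul, abs_mul, abs_mul, abs_of_pos g.κ0, abs_of_nonneg (pow_nonneg ht 3),
      abs_of_nonneg (integral_nonneg (pt_nonneg _ _))] at hst
    have h2 : |Ex u t A| ≤ (∑ v ∈ sp A, |evc u (A.coeff v)|) * Real.exp (t * h') := by
      rw [Ex_sum, Finset.sum_mul]
      refine (Finset.abs_sum_le_sum_abs _ _).trans (Finset.sum_le_sum fun v hv => ?_)
      rw [abs_mul, Real.abs_exp]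
      refine mul_le_mul_of_nonneg_left (Real.exp_le_exp.2 ?_) (abs_nonneg _)
      exact mul_le_mul_of_nonneg_left (le_hs hv u) ht
    have h3 : |evc u (DD M e1 e2 e3)| * t ^ 3 * (c * Real.exp (t * h')) ≤
        κ * ((∑ v ∈ sp A, |evc u (A.coeff v)|) * Real.exp (t * h')) := by
      calc _ ≤ |evc u (DD M e1 e2 e3)| * t ^ 3 * ∫ x, pt P (t • u) x :=
            mul_le_mul_of_nonneg_left h1 (by positivity)
        _ = κ * |Ex u t A| := hst
        _ ≤ _ := mul_le_mul_of_nonneg_left h2 g.κ0.le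
    have h4 := Real.exp_pos (t * h')
    refine le_of_mul_le_mul_right (a := Real.exp (t * h')) ?_ h4
    linarith
  set a := |evc u (DD M e1 e2 e3)| * c with ha
  have ha0 : 0 < a := mul_pos (abs_pos.2 hu) hc
  set b := κ * ∑ v ∈ sp A, |evc u (A.coeff v)| with hb'
  have hb0 : 0 ≤ b := mul_nonneg g.κ0.le (Finset.sum_nonneg fun _ _ => abs_nonneg _)
  have h5 := hb (b / a + 1) (by positivity)
  have h6 : b / a + 1 ≤ (b / a + 1) ^ 3 := le_self_pow₀ (by
    have : 0 ≤ b / a := by positivity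
    linarith) (by norm_num)
  have h7 : a * (b / a + 1) = b + a := by field_simp
  nlinarith
end

end

section

noncomputable def sgm : R3 →+* R3 := MvPolynomial.eval₂Hom MvPolynomial.C (fun i => -MvPolynomial.X i)

lemma sgm_sgm (r : R3) : sgm (sgm r) = r := by
  have : (sgm.comp sgm) = RingHom.id R3 := by
    apply MvPolynomial.ringHom_ext
    · intro r; simp [sgm]
    · intro i; simp [sgm]
  exact congrArg (fun f : R3 →+* R3 => f r) this

lemma evc_sgm (u : E3) (r : R3) : evc u (sgm r) = evc (-u) r := by
  have : (evc u).comp sgm = evc (-u) := by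
    apply MvPolynomial.ringHom_ext
    · intro r; simp [sgm]
    · intro i; simp [sgm]
  exact congrArg (fun f : R3 →+* ℝ => f r) this

lemma Ex_dag (u : E3) (t : ℝ) (x : RE) : Ex u t (dag sgm x) = Ex (-u) t x := by
  induction x using AddMonoidAlgebra.induction_linear with
  | zero => simp
  | add x y hx hy => rw [map_add, map_add, map_add, hx, hy]
  | single v r =>
    rw [dag_single, Ex_single, Ex_single, evc_sgm, inner_neg_right, inner_neg_left]

/-- linear independence of exponentials -/
lemma exp_indep {S : Finset E3} {u : E3} {c : E3 → ℝ}
    (hinj : ∀ v ∈ S, ∀ w ∈ S, v ≠ w → ⟪u, v⟫_ℝ ≠ ⟪u, w⟫_ℝ)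
    (h : ∀ t : ℝ, ∑ v ∈ S, c v * Real.exp (t * ⟪u, v⟫_ℝ) = 0) : ∀ v ∈ S, c v = 0 := by
  let φ : S → (Multiplicative ℝ →* ℝ) := fun v =>
    { toFun := fun t => Real.exp (t.toAdd * ⟪u, (v : E3)⟫_ℝ)
      map_one' := by simp
      map_mul' := fun s t => by rw [toAdd_mul, add_mul, Real.exp_add] }
  have hφ : Function.Injective φ := by
    intro v w hvw
    by_contra hne
    apply hinj v v.2 w w.2 (fun e => hne (Subtype.ext e))
    have := congrArg (fun f : Multiplicative ℝ →* ℝ => f (Multiplicative.ofAdd 1)) hvw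
    simp only [φ, MonoidHom.coe_mk, OneHom.coe_mk, toAdd_ofAdd, one_mul] at this
    exact Real.exp_injective this
  have hli := (linearIndependent_monoidHom (Multiplicative ℝ) ℝ).comp φ hφ
  rw [Fintype.linearIndependent_iff] at hli
  have := hli (fun v => c v) (by
    funext t
    have := h t.toAdd
    rw [← Finset.sum_coe_sort] at this
    simpa [φ] using this)
  exact fun v hv => this ⟨v, hv⟩

lemma RE_zero {Z : RE} {D : R3} (hD : D ≠ 0) (h : ∀ u : E3, evc u D ≠ 0 → ∀ t, Ex u t Z = 0) :
    Z = 0 := by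
  classical
  apply AddMonoidAlgebra.coeff_injective
  ext1 v
  set D' := D * ∏ p ∈ (sp Z).offDiag, lin (p.1 - p.2) with hD'
  have hD0 : D' ≠ 0 := by
    refine mul_ne_zero hD (Finset.prod_ne_zero_iff.2 fun p hp => lin_ne_zero (sub_ne_zero.2 ?_))
    exact (Finset.mem_offDiag.1 hp).2.2
  have : Z.coeff v = 0 := by
    by_cases hv : v ∈ sp Z
    swap
    · exact Finsupp.notMem_support_iff.1 hv
    refine poly_zero hD0 fun u hu => ?_
    rw [hD', map_mul] at hu
    refine exp_indep (S := sp Z) (u := u) (c := fun v => evc u (Z.coeff v)) ?_ ?_ v hv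
    · intro a ha b hb hab he
      have h2 := right_ne_zero_of_mul hu
      rw [map_prod, Finset.prod_ne_zero_iff] at h2
      apply h2 (a, b) (Finset.mem_offDiag.2 ⟨ha, hb, hab⟩)
      rw [eval_lin, inner_sub_left, real_inner_comm, real_inner_comm u b, he, sub_self]
    · intro t
      rw [← Ex_sum]
      exact h u (left_ne_zero_of_mul hu) t
  rw [this]; simp

section
variable {V V' : Finset E3} {P P' : Set E3} {N N' M : Finset E3} {e1 e2 e3 : E3} {κ : ℝ}

theorem AA_dag (h : HPoly V P N) (h' : HPoly V' P' N') (g : Gen M e1 e2 e3 κ) (hN : N ⊆ M)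
    (hN' : N' ⊆ M)
    (hF : ∀ u : E3, (∫ x, pt P u x) * ∫ x, pt P (-u) x = (∫ x, pt P' u x) * ∫ x, pt P' (-u) x) :
    AA V P N M e1 e2 e3 * dag sgm (AA V P N M e1 e2 e3) =
    AA V' P' N' M e1 e2 e3 * dag sgm (AA V' P' N' M e1 e2 e3) := by
  rw [← sub_eq_zero]
  have hs0 : sgm (DD M e1 e2 e3) ≠ 0 := fun h0 => g.DD_ne (by
    rw [← sgm_sgm (DD M e1 e2 e3), h0, map_zero])
  refine RE_zero (D := DD M e1 e2 e3 * sgm (DD M e1 e2 e3)) (mul_ne_zero g.DD_ne hs0) fun u hu t => ?_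
  rw [map_mul, evc_sgm] at hu
  have hu1 := left_ne_zero_of_mul hu
  have hu2 := right_ne_zero_of_mul hu
  rw [map_sub, map_mul, map_mul, Ex_dag, Ex_dag, sub_eq_zero]
  have a1 := star h g hN hu1 t
  have a2 := star h g hN hu2 t
  have b1 := star h' g hN' hu1 t
  have b2 := star h' g hN' hu2 t
  have e := hF (t • u)
  rw [← smul_neg] at e
  have hk : κ * κ ≠ 0 := mul_ne_zero g.κ0.ne' g.κ0.ne'
  apply mul_left_cancel₀ hk
  calc κ * κ * (Ex u t (AA V P N M e1 e2 e3) * Ex (-u) t (AA V P N M e1 e2 e3))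
      = (κ * Ex u t (AA V P N M e1 e2 e3)) * (κ * Ex (-u) t (AA V P N M e1 e2 e3)) := by ring
    _ = (evc u (DD M e1 e2 e3) * t ^ 3) * (evc (-u) (DD M e1 e2 e3) * t ^ 3) *
        ((∫ x, pt P (t • u) x) * ∫ x, pt P (t • (-u)) x) := by rw [← a1, ← a2]; ring
    _ = (κ * Ex u t (AA V' P' N' M e1 e2 e3)) * (κ * Ex (-u) t (AA V' P' N' M e1 e2 e3)) := by
        rw [e, ← b1, ← b2]; ring
    _ = _ := by ring
end

/-- the product of Laplace transforms is determined by the covariogram -/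
theorem F_cov {P : Set E3} (hP : IsCompact P) (u : E3) :
    (∫ x, pt P u x) * ∫ x, pt P (-u) x =
      ∫ x, Real.exp ⟪u, x⟫_ℝ * (volume (P ∩ ((x + ·) '' P))).toReal := by
  have e0 : ∀ y, pt P (-u) (-y) = pt (-P) u y := fun y => by
    by_cases hy : y ∈ -P
    · rw [pt, pt, Set.indicator_of_mem hy, Set.indicator_of_mem (by exact hy), inner_neg_neg]
    · rw [pt, pt, Set.indicator_of_notMem hy, Set.indicator_of_notMem (by exact hy)]
  have e1 : ∫ x, pt P (-u) x = ∫ x, pt (-P) u x := by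
    rw [← integral_neg_eq_self (fun x => pt P (-u) x)]
    exact integral_congr_ae (Filter.Eventually.of_forall e0)
  rw [e1]
  have := integral_convolution (L := ContinuousLinearMap.lsmul ℝ ℝ) (μ := (volume : Measure E3))
    (ν := (volume : Measure E3)) (pt_int hP u) (pt_int hP.neg u)
  rw [ContinuousLinearMap.lsmul_apply, smul_eq_mul] at this
  rw [← this]
  refine integral_congr_ae (Filter.Eventually.of_forall fun x => ?_)
  simp only [convolution, ContinuousLinearMap.lsmul_apply, smul_eq_mul]
  have hm : MeasurableSet (P ∩ ((x + ·) '' P)) :=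
    hP.measurableSet.inter (hP.image (by fun_prop)).measurableSet
  have : ∀ t, pt P u t * pt (-P) u (x - t) =
      (P ∩ ((x + ·) '' P)).indicator (fun _ => Real.exp ⟪u, x⟫_ℝ) t := fun t => by
    have hiff : t ∈ ((x + ·) '' P) ↔ x - t ∈ -P := by
      rw [Set.mem_neg, neg_sub]
      constructor
      · rintro ⟨y, hy, rfl⟩; simpa using hy
      · intro h; exact ⟨t - x, h, by simp⟩
    by_cases h1 : t ∈ P
    · by_cases h2 : x - t ∈ -P
      · have h3 : t ∈ P ∩ ((x + ·) '' P) := ⟨h1, hiff.2 h2⟩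
        rw [pt, pt, Set.indicator_of_mem h1, Set.indicator_of_mem h2,
          Set.indicator_of_mem h3, ← Real.exp_add, ← inner_add_right, add_sub_cancel]
      · rw [pt, pt, Set.indicator_of_notMem h2, mul_zero,
          Set.indicator_of_notMem fun h => h2 (hiff.1 h.2)]
    · rw [pt, pt, Set.indicator_of_notMem h1, zero_mul, Set.indicator_of_notMem fun h => h1 h.1]
  simp_rw [this]
  rw [integral_indicator hm, setIntegral_const, smul_eq_mul, mul_comm, Measure.real]

end

section

section
variable {V : Finset E3} {P : Set E3} {N M : Finset E3} {e1 e2 e3 : E3} {κ : ℝ}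

/-- inner product with a normal in the `n`,`b` plane -/
lemma ON.inner_of {n b a j : E3} (hon : ON n b a) (ha : ⟪a, j⟫_ℝ = 0) (x : E3) :
    ⟪j, x⟫_ℝ = ⟪n, j⟫_ℝ * ⟪n, x⟫_ℝ + ⟪b, j⟫_ℝ * ⟪b, x⟫_ℝ := by
  conv_lhs => rw [hon.expand j]
  rw [ha, inner_add_left, inner_add_left, real_inner_smul_left, real_inner_smul_left, zero_smul,
    inner_zero_left, add_zero]

lemma ON.ext {n b a x y : E3} (hon : ON n b a) (h1 : ⟪n, x⟫_ℝ = ⟪n, y⟫_ℝ) (h2 : ⟪b, x⟫_ℝ = ⟪b, y⟫_ℝ)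
    (h3 : ⟪a, x⟫_ℝ = ⟪a, y⟫_ℝ) : x = y := by
  rw [hon.expand x, hon.expand y, h1, h2, h3]

lemma active_b (h : HPoly V P N) {n b a j x : E3} (hon : ON n b a) (haj : ⟪a, j⟫_ℝ = 0)
    (hbj : 0 < ⟪b, j⟫_ℝ) (hx : x ∈ P) (hxn : ⟪n, x⟫_ℝ = hs V n) (hxj : ⟪j, x⟫_ℝ = hs V j) :
    ⟪b, x⟫_ℝ = hs (fc V n) b ∧ x ∈ convexHull ℝ (fc (fc V n) b : Set E3) := by
  have hx1 : x ∈ convexHull ℝ (fc V n : Set E3) := mem_face (h.hull ▸ hx) hxn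
  have e : ⟪b, x⟫_ℝ = hs (fc V n) b := by
    apply le_antisymm (inner_le_hs hx1 b)
    apply hs_le (fc_nonempty h.ne n)
    intro p hp
    have h1 := mem_fc.1 hp
    have h2 := h.le p (h.VP h1.1) j
    rw [← hxj, hon.inner_of haj, hon.inner_of haj x, hxn, h1.2] at h2
    exact le_of_mul_le_mul_left (by linarith) hbj
  exact ⟨e, mem_face hx1 e⟩

lemma edge_seg (h : HPoly V P N) {n b a j x p1 p2 : E3} {s : ℝ} (hon : ON n b a)
    (haj : ⟪a, j⟫_ℝ = 0) (hbj : 0 < ⟪b, j⟫_ℝ) (hn3 : ⟪n, e3⟫_ℝ ≠ 0) (hjc : ⟪j, cc e2 e3 n⟫_ℝ ≠ 0)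
    (hc : c3 e1 e2 e3 n j = s • a) (s0 : s ≠ 0)
    (hx : x ∈ P) (hxn : ⟪n, x⟫_ℝ = hs V n) (hxj : ⟪j, x⟫_ℝ = hs V j)
    (h1 : p1 ∈ fc (fc (fc V n) b) a) (h2 : p2 ∈ fc (fc (fc V n) b) (-a)) :
    (⟪j, p1⟫_ℝ = hs V j ∧ ⟪j, p2⟫_ℝ = hs V j) ∧
    ((mo (hi3 V P e1 e2 e3 n j) : GE3) - mo (lo3 V P e1 e2 e3 n j) =
      Real.sign s • (mo p1 - mo p2)) := by
  obtain ⟨hxb, -⟩ := active_b h hon haj hbj hx hxn hxj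
  have act : ∀ p ∈ fc (fc V n) b, p ∈ P ∧ ⟪n, p⟫_ℝ = hs V n ∧ ⟪b, p⟫_ℝ = hs (fc V n) b ∧
      ⟪j, p⟫_ℝ = hs V j := by
    intro p hp
    have a1 := mem_fc.1 hp
    have a2 := mem_fc.1 a1.1
    refine ⟨h.VP a2.1, a2.2, a1.2, ?_⟩
    rw [← hxj, hon.inner_of haj, hon.inner_of haj x, a2.2, a1.2, hxn, hxb]
  have q1 := act p1 (fc_subset _ _ h1)
  have q2 := act p2 (fc_subset _ _ h2)
  refine ⟨⟨q1.2.2.2, q2.2.2.2⟩, ?_⟩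
  set G := g3 e2 e3 (hs V) n j with hG
  have Gn : ⟪n, G⟫_ℝ = hs V n := inner_g3_left hn3
  have Gj : ⟪j, G⟫_ℝ = hs V j := inner_g3_right hjc
  have Gb : ⟪b, G⟫_ℝ = hs (fc V n) b := by
    have := hon.inner_of haj G
    rw [Gj, ← hxj, hon.inner_of haj x, hxn, Gn, hxb] at this
    exact mul_left_cancel₀ hbj.ne' (by linarith)
  have lineq : ∀ p : E3, ⟪n, p⟫_ℝ = hs V n → ⟪b, p⟫_ℝ = hs (fc V n) b →
      G + ((⟪a, p⟫_ℝ - ⟪a, G⟫_ℝ) / s) • (c3 e1 e2 e3 n j) = p := by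
    intro p hp hb
    rw [hc, smul_smul, div_mul_cancel₀ _ s0]
    apply hon.ext
    · rw [inner_add_right, real_inner_smul_right, hon.na, Gn, hp]; ring
    · rw [inner_add_right, real_inner_smul_right, hon.ba, Gb, hb]; ring
    · rw [inner_add_right, real_inner_smul_right, hon.a1]; ring
  set z1 := (⟪a, p1⟫_ℝ - ⟪a, G⟫_ℝ) / s with hz1
  set z2 := (⟪a, p2⟫_ℝ - ⟪a, G⟫_ℝ) / s with hz2
  have l1 := lineq p1 q1.2.1 q1.2.2.1
  have l2 := lineq p2 q2.2.1 q2.2.2.1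
  rw [← hz1] at l1
  rw [← hz2] at l2
  have m1 : z1 ∈ lset P G (c3 e1 e2 e3 n j) := by
    show G + z1 • _ ∈ P
    rw [l1]; exact q1.1
  have m2 : z2 ∈ lset P G (c3 e1 e2 e3 n j) := by
    show G + z2 • _ ∈ P
    rw [l2]; exact q2.1
  have bd : ∀ z ∈ lset P G (c3 e1 e2 e3 n j), z * s ≤ z1 * s ∧ z2 * s ≤ z * s := by
    intro z hz
    have hz' : G + z • c3 e1 e2 e3 n j ∈ P := hz
    rw [hc] at hz'
    have y1 := (active_b h hon haj hbj hz'
      (by rw [inner_add_right, real_inner_smul_right, real_inner_smul_right, hon.na, Gn]; ring)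
      (by rw [inner_add_right, real_inner_smul_right, real_inner_smul_right, real_inner_comm a, Gj,
        haj]; ring)).2
    have y2 := inner_le_hs y1 a
    have y3 := inner_le_hs y1 (-a)
    rw [← (mem_fc.1 h1).2] at y2
    rw [← (mem_fc.1 h2).2, inner_neg_left, inner_neg_left] at y3
    rw [inner_add_right, real_inner_smul_right, real_inner_smul_right, hon.a1] at y2 y3
    rw [hz1, hz2, div_mul_cancel₀ _ s0, div_mul_cancel₀ _ s0]
    constructor <;> linarith
  rw [hi3, lo3, ← hG, hiP, loP]
  rcases lt_or_gt_of_ne s0 with hs0 | hs0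
  · have f1 : sSup (lset P G (c3 e1 e2 e3 n j)) = z2 :=
      IsGreatest.csSup_eq ⟨m2, fun z hz => by nlinarith [(bd z hz).2]⟩
    have f2 : sInf (lset P G (c3 e1 e2 e3 n j)) = z1 :=
      IsLeast.csInf_eq ⟨m1, fun z hz => by nlinarith [(bd z hz).1]⟩
    rw [f1, f2, l1, l2, Real.sign_of_neg hs0]
    module
  · have f1 : sSup (lset P G (c3 e1 e2 e3 n j)) = z1 :=
      IsGreatest.csSup_eq ⟨m1, fun z hz => by nlinarith [(bd z hz).1]⟩
    have f2 : sInf (lset P G (c3 e1 e2 e3 n j)) = z2 :=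
      IsLeast.csInf_eq ⟨m2, fun z hz => by nlinarith [(bd z hz).2]⟩
    rw [f1, f2, l1, l2, Real.sign_of_pos hs0]
    module

lemma edge_empty {n j : E3} (he : ¬ ∃ x ∈ P, ⟪n, x⟫_ℝ = hs V n ∧ ⟪j, x⟫_ℝ = hs V j)
    (hn3 : ⟪n, e3⟫_ℝ ≠ 0) (hjc : ⟪j, cc e2 e3 n⟫_ℝ ≠ 0) :
    hi3 V P e1 e2 e3 n j = lo3 V P e1 e2 e3 n j := by
  have : lset P (g3 e2 e3 (hs V) n j) (c3 e1 e2 e3 n j) = ∅ := by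
    rw [Set.eq_empty_iff_forall_notMem]
    intro z hz
    refine he ⟨_, hz, ?_, ?_⟩
    · rw [inner_add_right, real_inner_smul_right, inner_g3_left hn3, inner_c3_left hn3]; ring
    · rw [inner_add_right, real_inner_smul_right, inner_g3_right hjc, inner_c3_right hjc]; ring
  rw [hi3, lo3, hiP, loP, this, Real.sSup_empty, Real.sInf_empty]

open Classical in
/-- the sum over facets adjacent on one side -/
lemma edge_sum (h : HPoly V P N) {n b a p1 p2 : E3} {s : ℝ} (hon : ON n b a) (hnN : n ∈ N)
    (hn3 : ⟪n, e3⟫_ℝ ≠ 0) (hjc : ∀ j ∈ N, ⟪a, j⟫_ℝ = 0 → 0 < ⟪b, j⟫_ℝ → ⟪j, cc e2 e3 n⟫_ℝ ≠ 0)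
    (hc : ∀ j ∈ N, ⟪a, j⟫_ℝ = 0 → 0 < ⟪b, j⟫_ℝ → c3 e1 e2 e3 n j = s • a) (s0 : s ≠ 0)
    (h1 : p1 ∈ fc (fc (fc V n) b) a) (h2 : p2 ∈ fc (fc (fc V n) b) (-a)) :
    ∑ j ∈ N, (if ⟪a, j⟫_ℝ = 0 ∧ 0 < ⟪b, j⟫_ℝ then
      (mo (hi3 V P e1 e2 e3 n j) : GE3) - mo (lo3 V P e1 e2 e3 n j) else 0) =
      Real.sign s • (mo p1 - mo p2) := by
  by_cases hp : p1 = p2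
  · rw [hp, sub_self, smul_zero]
    refine Finset.sum_eq_zero fun j hj => ?_
    split_ifs with hj2
    · by_cases he : ∃ x ∈ P, ⟪n, x⟫_ℝ = hs V n ∧ ⟪j, x⟫_ℝ = hs V j
      · obtain ⟨x, hx, hxn, hxj⟩ := he
        rw [(edge_seg h hon hj2.1 hj2.2 hn3 (hjc j hj hj2.1 hj2.2) (hc j hj hj2.1 hj2.2) s0 hx hxn hxj
          h1 h2).2, hp, sub_self, smul_zero]
      · rw [edge_empty he hn3 (hjc j hj hj2.1 hj2.2), sub_self]
    · rfl
  obtain ⟨j0, hj0, hb0, a1, a2⟩ := second_facet h hon (fc_subset _ _ h1) (fc_subset _ _ h2)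
  rw [real_inner_comm] at hb0
  have m1 := mem_fc.1 (fc_subset _ _ h1)
  have m2 := mem_fc.1 (fc_subset _ _ h2)
  have n1 := mem_fc.1 m1.1
  have n2 := mem_fc.1 m2.1
  have haj0 : ⟪a, j0⟫_ℝ = 0 := by
    by_contra hne
    apply hp
    apply hon.ext
    · rw [n1.2, n2.2]
    · rw [m1.2, m2.2]
    · have e := a1.trans a2.symm
      rw [hon.expand p1, hon.expand p2, n1.2, n2.2, m1.2, m2.2] at e
      simp only [inner_add_right, real_inner_smul_right] at e
      rw [real_inner_comm] at hne
      have : ⟪a, p1⟫_ℝ * ⟪j0, a⟫_ℝ = ⟪a, p2⟫_ℝ * ⟪j0, a⟫_ℝ := by linarith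
      exact mul_right_cancel₀ hne this
  rw [Finset.sum_eq_single j0]
  · rw [if_pos ⟨haj0, hb0⟩]
    exact (edge_seg h hon haj0 hb0 hn3 (hjc j0 hj0 haj0 hb0) (hc j0 hj0 haj0 hb0) s0 (h.VP n1.1)
      n1.2 a1 h1 h2).2
  · intro j hj hne
    split_ifs with hj2
    · by_cases he : ∃ x ∈ P, ⟪n, x⟫_ℝ = hs V n ∧ ⟪j, x⟫_ℝ = hs V j
      · exfalso
        obtain ⟨x, hx, hxn, hxj⟩ := he
        obtain ⟨b1, b2⟩ := (edge_seg h hon hj2.1 hj2.2 hn3 (hjc j hj hj2.1 hj2.2)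
          (hc j hj hj2.1 hj2.2) s0 hx hxn hxj h1 h2).1
        have nj : ∀ k, 0 < ⟪b, k⟫_ℝ → n ≠ k := by
          rintro k hk rfl
          rw [hon.bn] at hk
          exact lt_irrefl _ hk
        exact hp (h.ir n hnN j hj j0 hj0 (nj j hj2.2) (nj j0 hb0) hne p1 p2 n1.2 b1 a1 n2.2 b2 a2)
      · rw [edge_empty he hn3 (hjc j hj hj2.1 hj2.2), sub_self]
    · rfl
  · intro hn; exact absurd hj0 hn
end

end

section

open Polynomial in
lemma X_cancel {p q : ℕ} {f g : Polynomial ℝ} (hf : f.coeff 0 ≠ 0) (hg : g.coeff 0 ≠ 0)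
    (h : (X : Polynomial ℝ) ^ p * f = X ^ q * g) : p = q ∧ f = g := by
  have key : ∀ {p q : ℕ} {f g : Polynomial ℝ}, f.coeff 0 ≠ 0 →
      (X : Polynomial ℝ) ^ p * f = X ^ q * g → q ≤ p := by
    intro p q f g hf h
    by_contra hlt
    push Not at hlt
    have := congrArg (fun r => Polynomial.coeff r p) h
    simp only [Polynomial.coeff_X_pow_mul'] at this
    rw [if_pos le_rfl, Nat.sub_self, if_neg (by omega)] at this
    exact hf this
  have e : p = q := le_antisymm (key hg h.symm) (key hf h)
  subst e
  exact ⟨rfl, mul_left_cancel₀ (pow_ne_zero _ Polynomial.X_ne_zero) h⟩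

open Polynomial in
lemma psi_lin_lead {n b a c : E3} (hon : ON n b a) (hc : c ≠ 0) :
    ∃ (k : ℕ) (r : Polynomial ℝ), psi n b a (lin c) = X ^ k * r ∧ r.coeff 0 ≠ 0 ∧ k ≤ 2 ∧
      (⟪n, c⟫_ℝ ≠ 0 → k = 0 ∧ r.coeff 0 = ⟪n, c⟫_ℝ) ∧
      (⟪n, c⟫_ℝ = 0 → ⟪b, c⟫_ℝ ≠ 0 → k = 1 ∧ r.coeff 0 = ⟪b, c⟫_ℝ) ∧
      (⟪n, c⟫_ℝ = 0 → ⟪b, c⟫_ℝ = 0 → k = 2 ∧ r.coeff 0 = ⟪a, c⟫_ℝ) := by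
  rw [psi_lin]
  by_cases h1 : ⟪n, c⟫_ℝ = 0
  · by_cases h2 : ⟪b, c⟫_ℝ = 0
    · refine ⟨2, C ⟪a, c⟫_ℝ, ?_, ?_, le_rfl, fun h => absurd h1 h, fun _ h => absurd h2 h,
        fun _ _ => ⟨rfl, by simp⟩⟩
      · rw [h1, h2]; simp only [map_zero]; ring
      · rw [Polynomial.coeff_C_zero]
        intro h3
        exact hc (hon.ext (y := 0) (by simpa using h1) (by simpa using h2) (by simpa using h3))
    · refine ⟨1, C ⟪b, c⟫_ℝ + C ⟪a, c⟫_ℝ * X, ?_, ?_, by norm_num, fun h => absurd h1 h,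
        fun _ _ => ⟨rfl, by simp⟩, fun _ h => absurd h h2⟩
      · rw [h1]; simp only [map_zero]; ring
      · simpa using h2
  · refine ⟨0, _, by rw [pow_zero, one_mul], ?_, by norm_num, fun _ => ⟨rfl, by simp⟩,
      fun h => absurd h h1, fun h => absurd h h1⟩
    simpa using h1

lemma cc_neg (e2 e3 n : E3) : cc e2 e3 (-n) = cc e2 e3 n := by
  rw [cc, cc, inner_neg_left, inner_neg_left, neg_div_neg_eq]

lemma c3_neg (e1 e2 e3 n j : E3) : c3 e1 e2 e3 (-n) j = c3 e1 e2 e3 n j := by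
  rw [c3, c3, cc_neg, cc_neg]

section
variable {V : Finset E3} {P : Set E3} {N M : Finset E3} {e1 e2 e3 : E3} {κ : ℝ} {n b a : E3}

lemma b_cc (h : HPoly V P N) (g : Gen M e1 e2 e3 κ) (hN : N ⊆ M) (hon : ON n b a)
    (hb : 0 < wd b (fc V n)) (ha : 0 < wd a (fc (fc V n) b)) :
    ⟪b, cc e2 e3 n⟫_ℝ ≠ 0 ∧ ∃ j ∈ N, ⟪a, j⟫_ℝ = 0 ∧ 0 < ⟪b, j⟫_ℝ := by
  have hnN := h.flag n b a hon hb ha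
  have hne := fc_nonempty (fc_nonempty h.ne n) b
  obtain ⟨p1, h1⟩ := fc_nonempty hne a
  obtain ⟨p2, h2⟩ := fc_nonempty hne (-a)
  obtain ⟨j0, hj0, hb0, a1, a2⟩ := second_facet h hon (fc_subset _ _ h1) (fc_subset _ _ h2)
  rw [real_inner_comm] at hb0
  have m1 := mem_fc.1 (fc_subset _ _ h1)
  have m2 := mem_fc.1 (fc_subset _ _ h2)
  have n1 := mem_fc.1 m1.1
  have n2 := mem_fc.1 m2.1
  have hw : ⟪a, p1⟫_ℝ - ⟪a, p2⟫_ℝ ≠ 0 := by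
    rw [wd, ← (mem_fc.1 h1).2, ← (mem_fc.1 h2).2, inner_neg_left] at ha
    intro h0; linarith
  have haj0 : ⟪a, j0⟫_ℝ = 0 := by
    have e := a1.trans a2.symm
    rw [hon.expand p1, hon.expand p2, n1.2, n2.2, m1.2, m2.2] at e
    simp only [inner_add_right, real_inner_smul_right] at e
    have : (⟪a, p1⟫_ℝ - ⟪a, p2⟫_ℝ) * ⟪j0, a⟫_ℝ = 0 := by linarith
    rw [real_inner_comm]
    exact (mul_eq_zero.1 this).resolve_left hw
  refine ⟨?_, j0, hj0, haj0, hb0⟩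
  have hj1 : j0 ≠ n := by rintro rfl; rw [hon.bn] at hb0; exact lt_irrefl _ hb0
  have hj2 : j0 ≠ -n := by
    rintro rfl; rw [inner_neg_right, hon.bn, neg_zero] at hb0; exact lt_irrefl _ hb0
  have := g.nc n (hN hnN) j0 (hN hj0) hj1 hj2
  rw [hon.inner_of haj0, inner_cc (g.ne3 n (hN hnN))] at this
  intro h0
  rw [h0] at this
  simp at this

lemma cc_c3_indep (g : Gen M e1 e2 e3 κ) {i j : E3} {s t : ℝ}
    (h : s • cc e2 e3 i + t • c3 e1 e2 e3 i j = 0) : t = 0 := by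
  have := g.indep t (s - t * (⟪j, cc e1 e3 i⟫_ℝ / ⟪j, cc e2 e3 i⟫_ℝ))
    (-(s * (⟪i, e2⟫_ℝ / ⟪i, e3⟫_ℝ)) - t * (⟪i, e1⟫_ℝ / ⟪i, e3⟫_ℝ) +
      t * (⟪j, cc e1 e3 i⟫_ℝ / ⟪j, cc e2 e3 i⟫_ℝ) * (⟪i, e2⟫_ℝ / ⟪i, e3⟫_ℝ))
    (by
      rw [← h, c3]
      generalize ⟪j, cc e1 e3 i⟫_ℝ / ⟪j, cc e2 e3 i⟫_ℝ = r
      rw [cc, cc]; module)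
  exact this.1

lemma not_both (g : Gen M e1 e2 e3 κ) {i j : E3} (hi : i ∈ M) (hnM : n ∈ M) (hon : ON n b a)
    (hj : ⟪j, cc e2 e3 i⟫_ℝ ≠ 0)
    (h1 : i ≠ n) (h2 : i ≠ -n) : ⟪n, cc e2 e3 i⟫_ℝ ≠ 0 ∨ ⟪n, c3 e1 e2 e3 i j⟫_ℝ ≠ 0 := by
  by_contra hcon
  push Not at hcon
  obtain ⟨k1, k2⟩ := hcon
  obtain ⟨b', a', β, hon', hβ, hw⟩ := exists_on (n := n) (w := i) hon.n1 (fun t ht => by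
    rcases unit_par hon.n1 (g.unit i hi) ht with h | h
    · exact h1 h
    · exact h2 h)
  have par : ∀ v, ⟪n, v⟫_ℝ = 0 → ⟪i, v⟫_ℝ = 0 → v = ⟪a', v⟫_ℝ • a' := by
    intro v hv1 hv2
    rw [hw, inner_add_left, real_inner_smul_left, real_inner_smul_left, hv1, mul_zero, zero_add] at hv2
    have hv3 := (mul_eq_zero.1 hv2).resolve_left hβ.ne'
    conv_lhs => rw [hon'.expand v, hv1, hv3]
    simp
  have l1 := par _ k1 (inner_cc (g.ne3 i hi))
  have l2 := par _ k2 (inner_c3_left (g.ne3 i hi))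
  set s := ⟪a', cc e2 e3 i⟫_ℝ
  set t := ⟪a', c3 e1 e2 e3 i j⟫_ℝ
  have := cc_c3_indep g (i := i) (j := j) (s := t) (t := -s) (by rw [l1, l2]; module)
  apply g.cc_ne i
  rw [l1, neg_eq_zero.1 this, zero_smul]

lemma b_c3_iff (g : Gen M e1 e2 e3 κ) (hnM : n ∈ M) (hon : ON n b a) {j : E3}
    (hj : ⟪j, cc e2 e3 n⟫_ℝ ≠ 0) : ⟪b, c3 e1 e2 e3 n j⟫_ℝ = 0 ↔ ⟪a, j⟫_ℝ = 0 := by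
  have c0 := inner_c3_left (e1 := e1) (e2 := e2) (j := j) (g.ne3 n hnM)
  have c1 := inner_c3_right (e1 := e1) hj
  constructor
  · intro h0
    rw [hon.expand (c3 e1 e2 e3 n j), c0, h0] at c1
    simp only [zero_smul, zero_add, real_inner_smul_right] at c1
    rw [real_inner_comm]
    refine (mul_eq_zero.1 c1).resolve_left fun h1 => g.c3_ne n j ?_
    rw [hon.expand (c3 e1 e2 e3 n j), c0, h0, h1]; simp
  · intro h0
    rw [hon.inner_of h0, c0, mul_zero, zero_add] at c1
    refine (mul_eq_zero.1 c1).resolve_left fun h1 => hj ?_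
    rw [hon.inner_of h0, h1, inner_cc (g.ne3 n hnM)]; ring

lemma c3_const (g : Gen M e1 e2 e3 κ) (hnM : n ∈ M) (hon : ON n b a) {j : E3}
    (hbc : ⟪b, cc e2 e3 n⟫_ℝ ≠ 0)
    (hj : ⟪j, cc e2 e3 n⟫_ℝ ≠ 0) (h0 : ⟪a, j⟫_ℝ = 0) :
    c3 e1 e2 e3 n j = ⟪a, c3 e1 e2 e3 n b⟫_ℝ • a := by
  have e : ∀ x, ⟪n, x⟫_ℝ = 0 → ⟪j, x⟫_ℝ = ⟪b, j⟫_ℝ * ⟪b, x⟫_ℝ := fun x hx => by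
    rw [hon.inner_of h0, hx]; ring
  have hn3 := g.ne3 n hnM
  have hbj : ⟪b, j⟫_ℝ ≠ 0 := fun h1 => hj (by rw [e _ (inner_cc hn3), h1, zero_mul])
  have e4 : c3 e1 e2 e3 n j = c3 e1 e2 e3 n b := by
    rw [c3, c3, e _ (inner_cc hn3), e _ (inner_cc hn3), mul_div_mul_left _ _ hbj]
  rw [e4]
  conv_lhs => rw [hon.expand (c3 e1 e2 e3 n b), inner_c3_left hn3, inner_c3_right hbc]
  simp

noncomputable def Qn (e1 e2 e3 n b a : E3) : ℝ :=
  ⟪n, e3⟫_ℝ * ⟪b, cc e2 e3 n⟫_ℝ * ⟪a, c3 e1 e2 e3 n b⟫_ℝ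

lemma s_ne (g : Gen M e1 e2 e3 κ) (hnM : n ∈ M) (hon : ON n b a)
    (hbc : ⟪b, cc e2 e3 n⟫_ℝ ≠ 0) : ⟪a, c3 e1 e2 e3 n b⟫_ℝ ≠ 0 := fun h0 => by
  apply g.c3_ne n b
  rw [hon.expand (c3 e1 e2 e3 n b), inner_c3_left (g.ne3 n hnM), inner_c3_right hbc, h0]
  simp

open Polynomial in
lemma qq_lead (g : Gen M e1 e2 e3 κ) (hnM : n ∈ M) (hon : ON n b a)
    (hbc : ⟪b, cc e2 e3 n⟫_ℝ ≠ 0) {i j : E3} (hi : i ∈ M) (hj : ⟪j, cc e2 e3 i⟫_ℝ ≠ 0) :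
    ∃ (k : ℕ) (R : Polynomial ℝ), psi n b a (qq e1 e2 e3 (i, j)) = X ^ k * R ∧ R.coeff 0 ≠ 0 ∧
      (((i = n ∨ i = -n) ∧ ⟪a, j⟫_ℝ = 0 ∧ k = 3 ∧ R.coeff 0 = Qn e1 e2 e3 n b a) ∨
       (¬ ((i = n ∨ i = -n) ∧ ⟪a, j⟫_ℝ = 0) ∧ k ≤ 2)) := by
  obtain ⟨k1, r1, a1, a2, a3, a4, a5, a6⟩ := psi_lin_lead hon g.e3_ne
  obtain ⟨k2, r2, b1, b2, b3, b4, b5, b6⟩ := psi_lin_lead hon (g.cc_ne i)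
  obtain ⟨k3, r3, c1, c2, c3', c4, c5, c6⟩ := psi_lin_lead hon (g.c3_ne i j)
  have hn3 := g.ne3 n hnM
  have a4 := a4 hn3
  refine ⟨k1 + k2 + k3, r1 * r2 * r3, ?_, ?_, ?_⟩
  · rw [qq, map_mul, map_mul, a1, b1, c1]; ring
  · simp only [Polynomial.mul_coeff_zero]
    exact mul_ne_zero (mul_ne_zero a2 b2) c2
  by_cases hin : i = n ∨ i = -n
  · have ecc : cc e2 e3 i = cc e2 e3 n := by
      rcases hin with rfl | rfl
      · rfl
      · exact cc_neg _ _ _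
    have ec3 : c3 e1 e2 e3 i j = c3 e1 e2 e3 n j := by
      rcases hin with rfl | rfl
      · rfl
      · exact c3_neg _ _ _ _ _
    rw [ecc] at b4 b5 b6 hj
    rw [ec3] at c4 c5 c6
    have b5 := b5 (inner_cc hn3) hbc
    have c0 := inner_c3_left (e1 := e1) (e2 := e2) (j := j) hn3
    have hiff := b_c3_iff g hnM hon hj
    by_cases haj : ⟪a, j⟫_ℝ = 0
    · left
      have c6 := c6 c0 (hiff.2 haj)
      refine ⟨hin, haj, by omega, ?_⟩
      simp only [Polynomial.mul_coeff_zero]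
      rw [a4.2, b5.2, c6.2, Qn, c3_const g hnM hon hbc hj haj, real_inner_smul_right, hon.a1, mul_one]
    · right
      have c5 := c5 c0 fun h0 => haj (hiff.1 h0)
      exact ⟨fun h => haj h.2, by omega⟩
  · right
    refine ⟨fun h => hin h.1, ?_⟩
    push Not at hin
    rcases not_both g hi hnM hon hj hin.1 hin.2 with h0 | h0
    · have := b4 h0; omega
    · have := c4 h0; omega

lemma psi_lin_ne (hon : ON n b a) {c : E3} (hc : c ≠ 0) : psi n b a (lin c) ≠ 0 := by
  obtain ⟨k, r, h1, h2, -⟩ := psi_lin_lead hon hc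
  rw [h1]
  exact mul_ne_zero (pow_ne_zero _ Polynomial.X_ne_zero) (by rintro rfl; simp at h2)

lemma psi_qq_ne (g : Gen M e1 e2 e3 κ) (hon : ON n b a) (p : E3 × E3) :
    psi n b a (qq e1 e2 e3 p) ≠ 0 := by
  rw [qq, map_mul, map_mul]
  exact mul_ne_zero (mul_ne_zero (psi_lin_ne hon g.e3_ne) (psi_lin_ne hon (g.cc_ne _)))
    (psi_lin_ne hon (g.c3_ne _ _))

open Polynomial in
/-- leading behaviour of all coefficients -/
lemma co_lead (h : HPoly V P N) (g : Gen M e1 e2 e3 κ) (hN : N ⊆ M) (hon : ON n b a)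
    (hb : 0 < wd b (fc V n)) (ha : 0 < wd a (fc (fc V n) b)) :
    ∃ (m : ℕ) (E : Polynomial ℝ), psi n b a (DD M e1 e2 e3) = X ^ (m + 3) * E ∧ E.coeff 0 ≠ 0 ∧
      ∀ i ∈ N, ∀ j ∈ N, ∃ T : Polynomial ℝ,
        psi n b a (MvPolynomial.C (sg e2 e3 i j) * co M e1 e2 e3 (i, j)) = X ^ m * T ∧
        (((i = n ∨ i = -n) ∧ ⟪a, j⟫_ℝ = 0) →
          T.coeff 0 = sg e2 e3 i j * (E.coeff 0 / Qn e1 e2 e3 n b a)) ∧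
        (¬((i = n ∨ i = -n) ∧ ⟪a, j⟫_ℝ = 0) → T.coeff 0 = 0) := by
  obtain ⟨hbc, j0, hj0, haj0, hbj0⟩ := b_cc h g hN hon hb ha
  have hnN := h.flag n b a hon hb ha
  have hnM := hN hnN
  have hD : psi n b a (DD M e1 e2 e3) ≠ 0 := by
    rw [DD, map_mul, map_prod]
    exact mul_ne_zero (psi_lin_ne hon g.e3_ne) (Finset.prod_ne_zero_iff.2 fun p _ => psi_qq_ne g hon p)
  obtain ⟨m0, E, hE, hE0⟩ := exists_lead hD
  have pair : ∀ i ∈ N, ∀ j ∈ N, ⟪j, cc e2 e3 i⟫_ℝ ≠ 0 → ∃ (k l : ℕ) (R S : Polynomial ℝ),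
      psi n b a (co M e1 e2 e3 (i, j)) = X ^ l * S ∧ l + k = m0 ∧ S * R = E ∧
      (((i = n ∨ i = -n) ∧ ⟪a, j⟫_ℝ = 0 ∧ k = 3 ∧ R.coeff 0 = Qn e1 e2 e3 n b a) ∨
       (¬ ((i = n ∨ i = -n) ∧ ⟪a, j⟫_ℝ = 0) ∧ k ≤ 2)) := by
    intro i hi j hj hij
    obtain ⟨k, R, h1, h2, h3⟩ := qq_lead g hnM hon hbc (hN hi) hij
    have hDc := congrArg (psi n b a) (co_mul (e1 := e1) (e2 := e2) (e3 := e3) (hN hi) (hN hj))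
    rw [map_mul] at hDc
    have hco : psi n b a (co M e1 e2 e3 (i, j)) ≠ 0 := fun h0 => hD (by rw [hDc, h0, zero_mul])
    obtain ⟨l, S, hS, hS0⟩ := exists_lead hco
    have := X_cancel (p := l + k) (q := m0) (f := S * R) (g := E)
      (by rw [Polynomial.mul_coeff_zero]; exact mul_ne_zero hS0 h2) hE0
      (by rw [← hE, hDc, hS, h1]; ring)
    exact ⟨k, l, R, S, hS, this.1, this.2, h3⟩
  have hm : 3 ≤ m0 := by
    have : ⟪j0, cc e2 e3 n⟫_ℝ ≠ 0 := by
      rw [hon.inner_of haj0, inner_cc (g.ne3 n hnM), mul_zero, zero_add]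
      exact mul_ne_zero hbj0.ne' hbc
    obtain ⟨k, l, R, S, -, h1, -, h2⟩ := pair n hnN j0 hj0 this
    rcases h2 with h2 | h2
    · omega
    · exact absurd ⟨Or.inl rfl, haj0⟩ h2.1
  refine ⟨m0 - 3, E, by rw [Nat.sub_add_cancel hm]; exact hE, hE0, fun i hi j hj => ?_⟩
  by_cases hij : ⟪j, cc e2 e3 i⟫_ℝ = 0
  · have : sg e2 e3 i j = 0 := by rw [sg, hij, Real.sign_zero, mul_zero]
    rw [this]
    exact ⟨0, by simp, by simp, by simp⟩
  obtain ⟨k, l, R, S, hS, h1, h2, h3⟩ := pair i hi j hj hij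
  have hk : k ≤ 3 := by rcases h3 with h3 | h3 <;> omega
  refine ⟨C (sg e2 e3 i j) * (X ^ (3 - k) * S), ?_, ?_, ?_⟩
  · have e : l = (m0 - 3) + (3 - k) := by omega
    rw [map_mul, hS, e, pow_add]
    have : psi n b a (MvPolynomial.C (sg e2 e3 i j)) = C (sg e2 e3 i j) := by simp [psi]
    rw [this]; ring
  · intro hc
    rcases h3 with ⟨-, -, h4, h5⟩ | h3
    · rw [h4, Nat.sub_self, pow_zero, one_mul, Polynomial.coeff_C_mul, ← h2, Polynomial.mul_coeff_zero,
        ← h5, mul_div_cancel_right₀]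
      intro h6
      rw [← h2, Polynomial.mul_coeff_zero, h6, mul_zero] at hE0
      exact hE0 rfl
    · exact absurd hc h3.1
  · intro hc
    rcases h3 with h3 | h3
    · exact absurd ⟨h3.1, h3.2.1⟩ hc
    · have : 3 - k ≠ 0 := by omega
      rw [Polynomial.coeff_C_mul, Polynomial.mul_coeff_zero, Polynomial.coeff_X_pow]
      simp [this.symm]
end

end

section

lemma sign_pos_mul {x y : ℝ} (hx : 0 < x) : Real.sign (x * y) = Real.sign y := by
  rcases lt_trichotomy y 0 with h | h | h
  · rw [Real.sign_of_neg h, Real.sign_of_neg (mul_neg_of_pos_of_neg hx h)]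
  · rw [h, mul_zero]
  · rw [Real.sign_of_pos h, Real.sign_of_pos (mul_pos hx h)]

lemma rmom_sum (n : E3) (k : ℕ) {ι : Type*} (S : Finset ι) (f : ι → GE3) :
    rmom n k (∑ i ∈ S, f i) = ∑ i ∈ S, rmom n k (f i) := by
  simp only [rmom_eq, map_sum]

lemma rmom_smul_sub (n : E3) (r : ℝ) (p q : E3) : rmom n 0 (r • (mo p - mo q : GE3)) = 0 := by
  have : (r • (mo p - mo q : GE3)) = AddMonoidAlgebra.single p r + AddMonoidAlgebra.single q (-r) := by
    rw [smul_sub, mo, mo, AddMonoidAlgebra.smul_single, AddMonoidAlgebra.smul_single, smul_eq_mul,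
      mul_one, AddMonoidAlgebra.single_neg, sub_eq_add_neg]
  rw [this, rmom_add, rmom_single, rmom_single]; simp

section
variable {V : Finset E3} {P : Set E3} {N M : Finset E3} {e1 e2 e3 : E3} {κ : ℝ} {n b a : E3}

open Classical in
lemma n_part (h : HPoly V P N) (g : Gen M e1 e2 e3 κ) (hN : N ⊆ M) (hon : ON n b a)
    (hnN : n ∈ N) (hbc : ⟪b, cc e2 e3 n⟫_ℝ ≠ 0) {c : ℝ} {f : E3 → ℝ}
    (hf1 : ∀ j ∈ N, ⟪a, j⟫_ℝ = 0 → f j = sg e2 e3 n j * c) (hf0 : ∀ j ∈ N, ⟪a, j⟫_ℝ ≠ 0 → f j = 0)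
    {p1 p2 p3 p4 : E3}
    (h1 : p1 ∈ fc (fc (fc V n) b) a) (h2 : p2 ∈ fc (fc (fc V n) b) (-a))
    (h3 : p3 ∈ fc (fc (fc V n) (-b)) a) (h4 : p4 ∈ fc (fc (fc V n) (-b)) (-a)) :
    ∑ j ∈ N, f j • ((mo (hi3 V P e1 e2 e3 n j) : GE3) - mo (lo3 V P e1 e2 e3 n j)) =
      (Real.sign ⟪n, e3⟫_ℝ * Real.sign ⟪b, cc e2 e3 n⟫_ℝ * c *
        Real.sign ⟪a, c3 e1 e2 e3 n b⟫_ℝ) • (mo p1 - mo p2 - mo p3 + mo p4) := by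
  have hnM := hN hnN
  have hn3 := g.ne3 n hnM
  have hjj : ∀ j, ⟪a, j⟫_ℝ = 0 → ⟪j, cc e2 e3 n⟫_ℝ = ⟪b, j⟫_ℝ * ⟪b, cc e2 e3 n⟫_ℝ := fun j hj => by
    rw [hon.inner_of hj, inner_cc hn3]; ring
  have hjc : ∀ j, ⟪a, j⟫_ℝ = 0 → ⟪b, j⟫_ℝ ≠ 0 → ⟪j, cc e2 e3 n⟫_ℝ ≠ 0 := fun j hj hb => by
    rw [hjj j hj]; exact mul_ne_zero hb hbc
  have s0 := s_ne g hnM hon hbc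
  have E1 := edge_sum h hon hnN hn3 (fun j _ h1 h2 => hjc j h1 h2.ne')
    (fun j _ h1 h2 => c3_const g hnM hon hbc (hjc j h1 h2.ne') h1) s0 h1 h2
  have E2 := edge_sum h hon.negb hnN hn3
    (fun j _ h1 h2 => hjc j h1 (by rw [inner_neg_left] at h2; intro h0; rw [h0] at h2; simp at h2))
    (fun j _ h1 h2 => c3_const g hnM hon hbc
      (hjc j h1 (by rw [inner_neg_left] at h2; intro h0; rw [h0] at h2; simp at h2)) h1) s0 h3 h4
  set d := Real.sign ⟪n, e3⟫_ℝ * Real.sign ⟪b, cc e2 e3 n⟫_ℝ * c with hd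
  have key : ∀ j ∈ N, f j • ((mo (hi3 V P e1 e2 e3 n j) : GE3) - mo (lo3 V P e1 e2 e3 n j)) =
      d • (if ⟪a, j⟫_ℝ = 0 ∧ 0 < ⟪b, j⟫_ℝ then
        (mo (hi3 V P e1 e2 e3 n j) : GE3) - mo (lo3 V P e1 e2 e3 n j) else 0) -
      d • (if ⟪a, j⟫_ℝ = 0 ∧ 0 < ⟪-b, j⟫_ℝ then
        (mo (hi3 V P e1 e2 e3 n j) : GE3) - mo (lo3 V P e1 e2 e3 n j) else 0) := by
    intro j hj
    by_cases haj : ⟪a, j⟫_ℝ = 0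
    · rw [hf1 j hj haj, inner_neg_left, sg, hjj j haj]
      rcases lt_trichotomy ⟪b, j⟫_ℝ 0 with hb | hb | hb
      · have e : Real.sign (⟪b, j⟫_ℝ * ⟪b, cc e2 e3 n⟫_ℝ) = -Real.sign ⟪b, cc e2 e3 n⟫_ℝ := by
          rw [← sign_pos_mul (x := -⟪b, j⟫_ℝ) (y := ⟪b, cc e2 e3 n⟫_ℝ) (by linarith), ← Real.sign_neg,
            neg_mul, neg_neg]
        rw [if_neg (by intro h; linarith [h.2]), if_pos ⟨haj, by linarith⟩, e, hd]
        module
      · rw [if_neg (by intro h; linarith [h.2]), if_neg (by intro h; linarith [h.2]), hb]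
        simp
      · rw [if_pos ⟨haj, hb⟩, if_neg (by intro h; linarith [h.2]), sign_pos_mul hb, hd]
        module
    · rw [hf0 j hj haj, if_neg (fun h => haj h.1), if_neg (fun h => haj h.1)]; simp
  rw [Finset.sum_congr rfl key, Finset.sum_sub_distrib, ← Finset.smul_sum, ← Finset.smul_sum, E1, E2]
  module

open Polynomial in
lemma flag_lead (h : HPoly V P N) (g : Gen M e1 e2 e3 κ) (hN : N ⊆ M) (hon : ON n b a)
    (hb : 0 < wd b (fc V n)) (ha : 0 < wd a (fc (fc V n) b)) {p1 p2 p3 p4 : E3}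
    (h1 : p1 ∈ fc (fc (fc V n) b) a) (h2 : p2 ∈ fc (fc (fc V n) b) (-a))
    (h3 : p3 ∈ fc (fc (fc V n) (-b)) a) (h4 : p4 ∈ fc (fc (fc V n) (-b)) (-a)) :
    ∃ (m : ℕ) (E : Polynomial ℝ) (y : Polynomial GE3) (κ' : ℝ) (W : GE3),
      psi n b a (DD M e1 e2 e3) = X ^ (m + 3) * E ∧ E.coeff 0 ≠ 0 ∧ κ' ≠ 0 ∧
      Psi n b a (AA V P N M e1 e2 e3) = X ^ m * y ∧
      y.coeff 0 = κ' • (mo p1 - mo p2 - mo p3 + mo p4) + W ∧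
      (∀ v ∈ sp W, ⟪n, v⟫_ℝ = -hs V (-n)) ∧ rmom n 0 W = 0 := by
  classical
  obtain ⟨hbc, -⟩ := b_cc h g hN hon hb ha
  have hnN := h.flag n b a hon hb ha
  have hnM := hN hnN
  have hn3 := g.ne3 n hnM
  have s0 := s_ne g hnM hon hbc
  obtain ⟨m, E, hE, hE0, hT⟩ := co_lead h g hN hon hb ha
  have hT' : ∀ i j, ∃ T : Polynomial ℝ, i ∈ N → j ∈ N →
        psi n b a (MvPolynomial.C (sg e2 e3 i j) * co M e1 e2 e3 (i, j)) = X ^ m * T ∧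
        (((i = n ∨ i = -n) ∧ ⟪a, j⟫_ℝ = 0) →
          T.coeff 0 = sg e2 e3 i j * (E.coeff 0 / Qn e1 e2 e3 n b a)) ∧
        (¬((i = n ∨ i = -n) ∧ ⟪a, j⟫_ℝ = 0) → T.coeff 0 = 0) := by
    intro i j
    by_cases hi : i ∈ N
    · by_cases hj : j ∈ N
      · obtain ⟨T, hT⟩ := hT i hi j hj
        exact ⟨T, fun _ _ => hT⟩
      · exact ⟨0, fun _ h => absurd h hj⟩
    · exact ⟨0, fun h => absurd h hi⟩
  choose T hT using hT'
  set f : E3 → GE3 := fun i => ∑ j ∈ N, (T i j).coeff 0 •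
    ((mo (hi3 V P e1 e2 e3 i j) : GE3) - mo (lo3 V P e1 e2 e3 i j)) with hf
  set y : Polynomial GE3 := ∑ i ∈ N, ∑ j ∈ N, (T i j).map (algebraMap ℝ GE3) *
    C ((mo (hi3 V P e1 e2 e3 i j) : GE3) - mo (lo3 V P e1 e2 e3 i j)) with hy
  have hy0 : y.coeff 0 = ∑ i ∈ N, f i := by
    rw [hy, Polynomial.finset_sum_coeff]
    refine Finset.sum_congr rfl fun i _ => ?_
    rw [Polynomial.finset_sum_coeff]
    refine Finset.sum_congr rfl fun j _ => ?_
    rw [Polynomial.coeff_mul_C, Polynomial.coeff_map, Algebra.smul_def]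
  have Q0 : Qn e1 e2 e3 n b a ≠ 0 := mul_ne_zero (mul_ne_zero hn3 hbc) s0
  have sg0 : ∀ x : ℝ, x ≠ 0 → Real.sign x ≠ 0 := fun x hx h0 => hx (Real.sign_eq_zero_iff.1 h0)
  have np := n_part h g hN hon hnN hbc (c := E.coeff 0 / Qn e1 e2 e3 n b a)
    (f := fun j => (T n j).coeff 0)
    (fun j hj haj => (hT n j hnN hj).2.1 ⟨Or.inl rfl, haj⟩)
    (fun j hj haj => (hT n j hnN hj).2.2 fun h => haj h.2) h1 h2 h3 h4
  have Gl : ∀ i ∈ N, ∀ j, ⟪i, hi3 V P e1 e2 e3 i j⟫_ℝ = hs V i ∧ ⟪i, lo3 V P e1 e2 e3 i j⟫_ℝ = hs V i := by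
    intro i hi j
    have hi3' := g.ne3 i (hN hi)
    rw [hi3, lo3, hiP, loP]
    constructor
    · rw [inner_add_right, real_inner_smul_right, inner_g3_left hi3', inner_c3_left hi3']; ring
    · rw [inner_add_right, real_inner_smul_right, inner_g3_left hi3', inner_c3_left hi3']; ring
  refine ⟨m, E, y, Real.sign ⟪n, e3⟫_ℝ * Real.sign ⟪b, cc e2 e3 n⟫_ℝ *
    (E.coeff 0 / Qn e1 e2 e3 n b a) * Real.sign ⟪a, c3 e1 e2 e3 n b⟫_ℝ,
    ∑ i ∈ N.erase n, f i, hE, hE0, ?_, ?_, ?_, ?_, ?_⟩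
  · exact mul_ne_zero (mul_ne_zero (mul_ne_zero (sg0 _ hn3) (sg0 _ hbc)) (div_ne_zero hE0 Q0)) (sg0 _ s0)
  · rw [AA, hy, map_sum, Finset.mul_sum]
    refine Finset.sum_congr rfl fun i hi => ?_
    rw [map_sum, Finset.mul_sum]
    refine Finset.sum_congr rfl fun j hj => ?_
    rw [map_sub, Psi_single, Psi_single, (hT i j hi hj).1, Polynomial.map_mul, Polynomial.map_pow,
      Polynomial.map_X, map_sub]
    ring
  · rw [hy0, ← Finset.add_sum_erase _ _ hnN]
    congr 1
  · intro v hv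
    by_contra hne
    apply Finsupp.mem_support_iff.1 hv
    rw [AddMonoidAlgebra.coeff_sum, Finsupp.finset_sum_apply]
    refine Finset.sum_eq_zero fun i hi => ?_
    have hiN := Finset.mem_of_mem_erase hi
    have hin := Finset.ne_of_mem_erase hi
    rw [hf, AddMonoidAlgebra.coeff_sum, Finsupp.finset_sum_apply]
    refine Finset.sum_eq_zero fun j hj => ?_
    by_cases hi' : i = -n
    · have hG := Gl i hiN j
      rw [AddMonoidAlgebra.coeff_smul, AddMonoidAlgebra.coeff_sub, Finsupp.smul_apply,
        Finsupp.sub_apply, mo_coeff, mo_coeff, if_neg, if_neg, sub_self, smul_zero]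
      · rintro rfl
        apply hne
        have := hG.2
        rw [hi', inner_neg_left] at this
        rw [hi']; linarith
      · rintro rfl
        apply hne
        have := hG.1
        rw [hi', inner_neg_left] at this
        rw [hi']; linarith
    · rw [(hT i j hiN hj).2.2 (fun h => h.1.elim hin hi')]; simp
  · rw [rmom_sum]
    refine Finset.sum_eq_zero fun i hi => ?_
    rw [hf, rmom_sum]
    exact Finset.sum_eq_zero fun j hj => rmom_smul_sub _ _ _ _
end

end

section

noncomputable def boxL (d : Fin 3 → E3) : E3 →ₗ[ℝ] E3 where
  toFun x := ∑ i, x i • d i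
  map_add' x y := by simp [add_smul, Finset.sum_add_distrib]
  map_smul' r x := by simp [mul_smul, Finset.smul_sum]

lemma box_vol (τ : Fin 3 → ℝ) (h : ∀ i, 0 ≤ τ i) :
    volume {x : E3 | ∀ i, 0 ≤ x i ∧ x i ≤ τ i} = ENNReal.ofReal (∏ i, τ i) := by
  have e : {x : E3 | ∀ i, 0 ≤ x i ∧ x i ≤ τ i} =
      (MeasurableEquiv.toLp 2 (Fin 3 → ℝ)).symm ⁻¹' (Set.Icc 0 τ) := by
    ext x
    simp only [Set.mem_setOf_eq, Set.mem_preimage, Set.mem_Icc, Pi.le_def]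
    exact ⟨fun h => ⟨fun i => (h i).1, fun i => (h i).2⟩, fun h i => ⟨h.1 i, h.2 i⟩⟩
  rw [e, (EuclideanSpace.volume_preserving_symm_measurableEquiv_toLp (Fin 3)).measure_preimage
    measurableSet_Icc.nullMeasurableSet, Real.volume_Icc_pi, ENNReal.ofReal_prod_of_nonneg fun i _ => h i]
  simp

lemma cone_lower {P : Set E3} (hP : IsCompact P) (hcv : Convex ℝ P) {v : E3} {d : Fin 3 → E3}
    (hv : v ∈ P) (hd : ∀ i, v + d i ∈ P) (hinj : ∀ x : E3, ∑ i, x i • d i = 0 → x = 0) :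
    ∃ c : ℝ, 0 < c ∧ ∀ (u : E3) (M : Fin 3 → ℝ), (∀ i, 0 < M i) → (∀ i, -⟪u, d i⟫_ℝ ≤ M i) →
      ∀ t : ℝ, 0 < t → (∀ i, 1 ≤ t * M i) →
        c * Real.exp (t * ⟪u, v⟫_ℝ) ≤ t ^ 3 * (∏ i, M i) * ∫ x, pt P (t • u) x := by
  have hdet : LinearMap.det (boxL d) ≠ 0 := by
    have hi : Function.Injective (boxL d) := by
      rw [injective_iff_map_eq_zero]
      exact fun x hx => hinj x hx
    have := LinearEquiv.isUnit_det' (LinearEquiv.ofInjectiveEndo (boxL d) hi)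
    rw [show ((LinearEquiv.ofInjectiveEndo (boxL d) hi : E3 ≃ₗ[ℝ] E3) : E3 →ₗ[ℝ] E3) = boxL d from
      LinearMap.ext fun x => rfl] at this
    exact this.ne_zero
  refine ⟨|LinearMap.det (boxL d)| / 27 * Real.exp (-1), by positivity, fun u M hM hu t ht htM => ?_⟩
  set τ : Fin 3 → ℝ := fun i => 1 / (3 * (t * M i)) with hτ
  have htMp : ∀ i, 0 < t * M i := fun i => mul_pos ht (hM i)
  have hτ0 : ∀ i, 0 < τ i := fun i => by have := htMp i; simp only [hτ]; positivity
  have hτ3 : ∀ i, τ i ≤ 1 / 3 := fun i => by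
    simp only [hτ]
    apply one_div_le_one_div_of_le (by norm_num)
    linarith [htM i]
  have hτM : ∀ i, τ i * (t * M i) = 1 / 3 := fun i => by
    simp only [hτ]; have h3 := (hM i).ne'; have h4 := ht.ne'; field_simp
  set B : Set E3 := {x : E3 | ∀ i, 0 ≤ x i ∧ x i ≤ τ i} with hB
  set K : Set E3 := (fun x => v + x) '' (boxL d '' B) with hK
  have hBc : IsCompact B := by
    have : B = (MeasurableEquiv.toLp 2 (Fin 3 → ℝ)) '' (Set.Icc 0 τ) := by
      ext x
      constructor
      · intro hx
        exact ⟨fun i => x i, ⟨fun i => (hx i).1, fun i => (hx i).2⟩, rfl⟩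
      · rintro ⟨y, hy, rfl⟩
        exact fun i => ⟨hy.1 i, hy.2 i⟩
    rw [this]
    exact isCompact_Icc.image (PiLp.continuous_toLp 2 _)
  have hKc : IsCompact K := (hBc.image (boxL d).continuous_of_finiteDimensional).image (by fun_prop)
  have hKv : volume.real K = |LinearMap.det (boxL d)| * ∏ i, τ i := by
    rw [Measure.real, hK, Set.image_add_left, measure_preimage_add, Measure.addHaar_image_linearMap,
      box_vol τ fun i => (hτ0 i).le, ENNReal.toReal_mul, ENNReal.toReal_ofReal (abs_nonneg _),
      ENNReal.toReal_ofReal (Finset.prod_nonneg fun i _ => (hτ0 i).le)]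
  have hKP : K ⊆ P := by
    rintro _ ⟨_, ⟨x, hx, rfl⟩, rfl⟩
    have e : v + boxL d x = (1 - x 0 - x 1 - x 2) • v + x 0 • (v + d 0) + x 1 • (v + d 1) +
        x 2 • (v + d 2) := by
      change v + ∑ i, x i • d i = _
      rw [Fin.sum_univ_three]; module
    have hle : x 0 + x 1 + x 2 ≤ 1 := by
      have := (hx 0).2.trans (hτ3 0)
      have := (hx 1).2.trans (hτ3 1)
      have := (hx 2).2.trans (hτ3 2)
      linarith
    have := hcv.sum_mem (t := Finset.univ) (w := ![1 - x 0 - x 1 - x 2, x 0, x 1, x 2])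
      (z := ![v, v + d 0, v + d 1, v + d 2])
      (by
        intro i _
        fin_cases i
        · simp; linarith
        · exact (hx 0).1
        · exact (hx 1).1
        · exact (hx 2).1)
      (by simp [Fin.sum_univ_four]; ring) (by
        intro i _
        fin_cases i
        · exact hv
        · exact hd 0
        · exact hd 1
        · exact hd 2)
    simp only [Fin.sum_univ_four] at this
    change v + boxL d x ∈ P
    rw [e]
    exact this
  have := F_lower hP hKc.measurableSet hKP (u := t • u) (m := t * ⟪u, v⟫_ℝ - 1) (by
    rintro _ ⟨_, ⟨x, hx, rfl⟩, rfl⟩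
    have e : ⟪t • u, v + boxL d x⟫_ℝ = t * ⟪u, v⟫_ℝ + ∑ i, x i * (t * ⟪u, d i⟫_ℝ) := by
      change ⟪t • u, v + ∑ i, x i • d i⟫_ℝ = _
      rw [real_inner_smul_left, inner_add_right, inner_sum, mul_add, Finset.mul_sum]
      simp only [real_inner_smul_right]
      congr 1
      exact Finset.sum_congr rfl fun i _ => by ring
    have hi : ∀ i, -(1 / 3 : ℝ) ≤ x i * (t * ⟪u, d i⟫_ℝ) := by
      intro i
      have h1 : -(t * M i) ≤ t * ⟪u, d i⟫_ℝ := by nlinarith [hu i]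
      have h2 := mul_le_mul_of_nonneg_left h1 (hx i).1
      have h3 : x i * (t * M i) ≤ τ i * (t * M i) := mul_le_mul_of_nonneg_right (hx i).2 (htMp i).le
      rw [hτM] at h3
      linarith
    rw [e, Fin.sum_univ_three]
    linarith [hi 0, hi 1, hi 2])
  rw [hKv, sub_eq_add_neg, Real.exp_add] at this
  have hp : 0 < t ^ 3 * ∏ i, M i := mul_pos (by positivity) (Finset.prod_pos fun i _ => hM i)
  have h2 := mul_le_mul_of_nonneg_left this hp.le
  refine le_trans (le_of_eq ?_) h2
  have e3 : t ^ 3 * (∏ i, M i) * ∏ i, τ i = 1 / 27 := by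
    rw [Fin.prod_univ_three, Fin.prod_univ_three]
    calc t ^ 3 * (M 0 * M 1 * M 2) * (τ 0 * τ 1 * τ 2) =
      (τ 0 * (t * M 0)) * (τ 1 * (t * M 1)) * (τ 2 * (t * M 2)) := by ring
      _ = _ := by rw [hτM, hτM, hτM]; norm_num
  calc _ = (1 / 27) * (|LinearMap.det (boxL d)| * (Real.exp (t * ⟪u, v⟫_ℝ) * Real.exp (-1))) := by ring
    _ = _ := by rw [← e3]; ring

section
variable {V : Finset E3} {P : Set E3} {N M : Finset E3} {e1 e2 e3 : E3} {κ : ℝ}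

/-- coefficient lower bound at an exposed vertex -/
lemma coeff_lower (h : HPoly V P N) (g : Gen M e1 e2 e3 κ) (hN : N ⊆ M) {u v : E3} {c p : ℝ}
    (hp : 0 < p) (hu : evc u (DD M e1 e2 e3) ≠ 0) (hfc : fc V u = {v})
    {t0 : ℝ} (hc : ∀ t ≥ t0, c * Real.exp (t * ⟪u, v⟫_ℝ) ≤ t ^ 3 * p * ∫ x, pt P (t • u) x) :
    |evc u (DD M e1 e2 e3)| * c ≤ p * κ * |evc u ((AA V P N M e1 e2 e3).coeff v)| := by
  classical
  set A := AA V P N M e1 e2 e3 with hA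
  have hvm := mem_fc.1 (hfc ▸ Finset.mem_singleton_self v : v ∈ fc V u)
  have hlt : ∀ w ∈ sp A, w ≠ v → ⟪u, w⟫_ℝ < ⟪u, v⟫_ℝ := by
    intro w hw hne
    have hwP := spAA_subset h.cpt g w hw
    rw [hvm.2]
    refine lt_of_le_of_ne (h.le w hwP u) fun he => hne ?_
    have := mem_face (h.hull ▸ hwP) he
    rw [hfc, Finset.coe_singleton, convexHull_singleton] at this
    exact this
  have lim : Filter.Tendsto (fun t : ℝ => ∑ w ∈ sp A, evc u (A.coeff w) *
      Real.exp (t * (⟪u, w⟫_ℝ - ⟪u, v⟫_ℝ))) Filter.atTop (nhds (evc u (A.coeff v))) := by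
    have : evc u (A.coeff v) = ∑ w ∈ sp A, if w = v then evc u (A.coeff v) else 0 := by
      rw [Finset.sum_ite_eq']
      split_ifs with hv
      · rfl
      · rw [Finsupp.notMem_support_iff.1 hv, map_zero]
    rw [this]
    refine tendsto_finset_sum _ fun w hw => ?_
    split_ifs with hwv
    · subst hwv; simp
    · have h1 : Filter.Tendsto (fun t : ℝ => t * (⟪u, w⟫_ℝ - ⟪u, v⟫_ℝ)) Filter.atTop Filter.atBot :=
        Filter.tendsto_id.atTop_mul_const_of_neg (by linarith [hlt w hw hwv])
      have := (Real.tendsto_exp_atBot.comp h1).const_mul (evc u (A.coeff w))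
      simpa using this
  have lim2 := (lim.abs).const_mul (p * κ)
  refine ge_of_tendsto lim2 ?_
  filter_upwards [Filter.eventually_ge_atTop t0, Filter.eventually_gt_atTop 0] with t ht ht0
  have hst := star h g hN hu t
  rw [← hA, Ex_sum] at hst
  have e : ∑ w ∈ sp A, evc u (A.coeff w) * Real.exp (t * (⟪u, w⟫_ℝ - ⟪u, v⟫_ℝ)) =
      (∑ w ∈ sp A, evc u (A.coeff w) * Real.exp (t * ⟪u, w⟫_ℝ)) * Real.exp (-(t * ⟪u, v⟫_ℝ)) := by
    rw [Finset.sum_mul]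
    refine Finset.sum_congr rfl fun w _ => ?_
    rw [mul_assoc, ← Real.exp_add]; ring_nf
  have h1 := hc t ht
  rw [e, abs_mul, abs_of_pos (Real.exp_pos _), mul_assoc p, ← mul_assoc κ, ← abs_of_pos g.κ0, ← abs_mul,
    ← hst, abs_mul, abs_mul, abs_of_pos (pow_pos ht0 3),
    abs_of_nonneg (integral_nonneg (pt_nonneg _ _))]
  have h2 := mul_le_mul_of_nonneg_right h1 (Real.exp_pos (-(t * ⟪u, v⟫_ℝ))).le
  rw [mul_assoc, ← Real.exp_add, add_neg_cancel, Real.exp_zero, mul_one] at h2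
  have h3 := mul_le_mul_of_nonneg_left h2 (abs_nonneg (evc u (DD M e1 e2 e3)))
  refine h3.trans (le_of_eq ?_)
  ring
end

end

section

section
variable {V : Finset E3} {P : Set E3} {N M : Finset E3} {e1 e2 e3 : E3} {κ : ℝ} {n b a : E3}

lemma fc_flag_singleton {V : Finset E3} (hV : V.Nonempty) {n b a v : E3}
    (hS : fc (fc V n) (-b) = {v}) :
    ∃ δ0 > 0, ∀ δ : ℝ, 0 < δ → δ < δ0 → fc V (n + (-δ) • b + (-δ) ^ 2 • a) = {v} := by
  obtain ⟨r1, hr1, H1⟩ := hs_local hV n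
  obtain ⟨r2, hr2, H2⟩ := hs_local (fc_nonempty hV n) (-b)
  have c1 : Filter.Tendsto (fun δ : ℝ => ‖δ • (-b + δ • a)‖) (nhds 0) (nhds 0) := by
    have : Continuous fun δ : ℝ => ‖δ • (-b + δ • a)‖ := by fun_prop
    simpa using this.tendsto 0
  have c2 : Filter.Tendsto (fun δ : ℝ => ‖δ • a‖) (nhds 0) (nhds 0) := by
    have : Continuous fun δ : ℝ => ‖δ • a‖ := by fun_prop
    simpa using this.tendsto 0
  obtain ⟨δ0, h0, H⟩ := Metric.eventually_nhds_iff.1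
    ((c1.eventually_lt_const hr1).and (c2.eventually_lt_const hr2))
  refine ⟨δ0, h0, fun δ hδ hlt => ?_⟩
  obtain ⟨k1, k2⟩ := H (y := δ) (by rwa [Real.dist_eq, sub_zero, abs_of_pos hδ])
  have e : n + (-δ) • b + (-δ) ^ 2 • a = n + δ • (-b + δ • a) := by module
  rw [e, (H1 _ k1).2, fc_smul (fc_nonempty hV n) hδ, (H2 _ k2).2, hS]
  have hne := fc_nonempty (Finset.singleton_nonempty v) (δ • a)
  exact (Finset.subset_singleton_iff.1 (fc_subset _ _)).resolve_left hne.ne_empty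

lemma flag_hv (h : HPoly V P N) (g : Gen M e1 e2 e3 κ) (hN : N ⊆ M) (hon : ON n b a)
    (hb : 0 < wd b (fc V n)) (ha : 0 < wd a (fc (fc V n) b)) {p1 p2 v : E3}
    (h1 : p1 ∈ fc (fc (fc V n) b) a) (h2 : p2 ∈ fc (fc (fc V n) b) (-a))
    (h3 : v ∈ fc (fc (fc V n) (-b)) a) (h4 : v ∈ fc (fc (fc V n) (-b)) (-a))
    {m : ℕ} {E : Polynomial ℝ} (hE : psi n b a (DD M e1 e2 e3) = Polynomial.X ^ (m + 3) * E)
    (hE0 : E.coeff 0 ≠ 0) :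
    ¬ Polynomial.X ^ (m + 2) ∣ psi n b a ((AA V P N M e1 e2 e3).coeff v) := by
  rintro ⟨r, hr⟩
  have hvb := fc_subset _ _ h3
  have hvn := fc_subset _ _ hvb
  have hvV := fc_subset _ _ hvn
  have hS : fc (fc V n) (-b) = {v} := by
    apply fc3_singleton h.ne hon.negb ?_ hvb
    have k1 := (mem_fc.1 h3).2
    have k2 := (mem_fc.1 h4).2
    rw [wd, ← k1, ← k2, inner_neg_left]; ring
  obtain ⟨δ0, hδ0, hfc⟩ := fc_flag_singleton (a := a) h.ne hS
  obtain ⟨x3, hx3⟩ := fc_nonempty h.ne (-n)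
  have p1b := fc_subset _ _ h1
  have p1n := fc_subset _ _ p1b
  have p2b := fc_subset _ _ h2
  have p2n := fc_subset _ _ p2b
  -- coordinates
  have n1 : ⟪n, p1 - v⟫_ℝ = 0 := by
    rw [inner_sub_right, (mem_fc.1 p1n).2, (mem_fc.1 hvn).2, sub_self]
  have n2 : ⟪n, p2 - v⟫_ℝ = 0 := by
    rw [inner_sub_right, (mem_fc.1 p2n).2, (mem_fc.1 hvn).2, sub_self]
  have b1 : ⟪b, p1 - v⟫_ℝ = wd b (fc V n) := by
    have k := (mem_fc.1 hvb).2
    rw [inner_neg_left] at k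
    rw [inner_sub_right, (mem_fc.1 p1b).2, wd, ← k]; ring
  have b2 : ⟪b, p2 - v⟫_ℝ = wd b (fc V n) := by
    have k := (mem_fc.1 hvb).2
    rw [inner_neg_left] at k
    rw [inner_sub_right, (mem_fc.1 p2b).2, wd, ← k]; ring
  have a12 : ⟪a, p1 - v⟫_ℝ - ⟪a, p2 - v⟫_ℝ = wd a (fc (fc V n) b) := by
    have k := (mem_fc.1 h2).2
    rw [inner_neg_left] at k
    rw [inner_sub_right, inner_sub_right, (mem_fc.1 h1).2, wd, ← k]; ring
  have n3 : ⟪n, x3 - v⟫_ℝ < 0 := by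
    have k := (mem_fc.1 hx3).2
    rw [inner_neg_left] at k
    have := h.pos n hon.n1
    rw [wd] at this
    rw [inner_sub_right, (mem_fc.1 hvn).2]; linarith
  set d : Fin 3 → E3 := ![p1 - v, p2 - v, x3 - v] with hd
  obtain ⟨c, hc, hlow⟩ := cone_lower h.cpt h.cvx (v := v) (d := d) (h.VP hvV)
    (by
      intro i
      fin_cases i
      · simpa [hd] using h.VP (fc_subset _ _ p1n)
      · simpa [hd] using h.VP (fc_subset _ _ p2n)
      · simpa [hd] using h.VP (fc_subset _ _ hx3))
    (by
      intro x hx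
      rw [Fin.sum_univ_three] at hx
      simp only [hd, Matrix.cons_val_zero, Matrix.cons_val_one, Matrix.cons_val] at hx
      have q1 := congrArg (fun z => ⟪n, z⟫_ℝ) hx
      have q2 := congrArg (fun z => ⟪b, z⟫_ℝ) hx
      have q3 := congrArg (fun z => ⟪a, z⟫_ℝ) hx
      simp only [inner_add_right, real_inner_smul_right, inner_zero_right, n1, n2, b1, b2] at q1 q2 q3
      have z2 : x 2 = 0 := by
        have : x 2 * ⟪n, x3 - v⟫_ℝ = 0 := by linarith
        exact (mul_eq_zero.1 this).resolve_right n3.ne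
      rw [z2] at q2 q3
      have z01 : x 0 + x 1 = 0 := by
        have : (x 0 + x 1) * wd b (fc V n) = 0 := by linarith
        exact (mul_eq_zero.1 this).resolve_right hb.ne'
      have z0 : x 0 = 0 := by
        have : x 0 * wd a (fc (fc V n) b) = 0 := by
          rw [← a12]
          have : x 1 = - x 0 := by linarith
          rw [this] at q3; linarith
        exact (mul_eq_zero.1 this).resolve_right ha.ne'
      ext i
      fin_cases i
      · exact z0
      · change x 1 = 0
        linarith
      · exact z2)
  set C : Fin 3 → ℝ := fun i => 1 + |⟪n, d i⟫_ℝ| + |⟪b, d i⟫_ℝ| + |⟪a, d i⟫_ℝ| with hC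
  have hC1 : ∀ i, 1 ≤ C i := fun i => by
    have := abs_nonneg ⟪n, d i⟫_ℝ
    have := abs_nonneg ⟪b, d i⟫_ℝ
    have := abs_nonneg ⟪a, d i⟫_ℝ
    simp only [hC]; linarith
  have hCp : ∀ i, 0 < C i := fun i => by linarith [hC1 i]
  -- nonvanishing of E near zero
  have hEc : Filter.Tendsto (fun δ : ℝ => E.eval (-δ)) (nhds 0) (nhds (E.coeff 0)) := by
    have : Continuous fun δ : ℝ => E.eval (-δ) := by fun_prop
    have := this.tendsto 0
    simpa [Polynomial.coeff_zero_eq_eval_zero] using this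
  have main : ∀ᶠ δ : ℝ in nhdsWithin 0 (Set.Ioi 0),
      |E.eval (-δ)| * c ≤ C 0 * C 1 * C 2 * κ * δ * |r.eval (-δ)| := by
    have ev1 : ∀ᶠ δ : ℝ in nhdsWithin 0 (Set.Ioi 0), E.eval (-δ) ≠ 0 :=
      (hEc.eventually_ne hE0).filter_mono nhdsWithin_le_nhds
    have ev2 : ∀ᶠ δ : ℝ in nhdsWithin 0 (Set.Ioi 0), δ < δ0 :=
      (eventually_lt_nhds hδ0).filter_mono nhdsWithin_le_nhds
    have ev3 : ∀ᶠ δ : ℝ in nhdsWithin 0 (Set.Ioi 0), δ < 1 :=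
      (eventually_lt_nhds one_pos).filter_mono nhdsWithin_le_nhds
    filter_upwards [ev1, ev2, ev3, self_mem_nhdsWithin] with δ k1 k2 k3 k4
    have hδ : 0 < δ := k4
    set u := n + (-δ) • b + (-δ) ^ 2 • a with hu
    have eD : evc u (DD M e1 e2 e3) = (-δ) ^ (m + 3) * E.eval (-δ) := by
      have := psi_eval n b a (DD M e1 e2 e3) (-δ)
      rw [hE, Polynomial.eval_mul, Polynomial.eval_pow, Polynomial.eval_X] at this
      exact this.symm
    have eA : evc u ((AA V P N M e1 e2 e3).coeff v) = (-δ) ^ (m + 2) * r.eval (-δ) := by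
      have := psi_eval n b a ((AA V P N M e1 e2 e3).coeff v) (-δ)
      rw [hr, Polynomial.eval_mul, Polynomial.eval_pow, Polynomial.eval_X] at this
      exact this.symm
    have hud : ∀ i, -⟪u, d i⟫_ℝ = -⟪n, d i⟫_ℝ + δ * ⟪b, d i⟫_ℝ - δ ^ 2 * ⟪a, d i⟫_ℝ := by
      intro i
      rw [hu, inner_add_left, inner_add_left, real_inner_smul_left, real_inner_smul_left]; ring
    have hδ2 : δ ^ 2 ≤ δ := by nlinarith
    have bb : ∀ i, δ * ⟪b, d i⟫_ℝ ≤ δ * |⟪b, d i⟫_ℝ| := fun i =>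
      mul_le_mul_of_nonneg_left (le_abs_self _) hδ.le
    have aa : ∀ i, -(δ ^ 2 * ⟪a, d i⟫_ℝ) ≤ δ * |⟪a, d i⟫_ℝ| := fun i => by
      have q1 : δ ^ 2 * (-⟪a, d i⟫_ℝ) ≤ δ ^ 2 * |⟪a, d i⟫_ℝ| :=
        mul_le_mul_of_nonneg_left (neg_le_abs _) (by positivity)
      have q2 := mul_le_mul_of_nonneg_right hδ2 (abs_nonneg ⟪a, d i⟫_ℝ)
      linarith
    have gen : ∀ i, δ * |⟪b, d i⟫_ℝ| + δ * |⟪a, d i⟫_ℝ| ≤ C i * δ - δ - δ * |⟪n, d i⟫_ℝ| := fun i => by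
      simp only [hC]; nlinarith
    set Mv : Fin 3 → ℝ := ![C 0 * δ, C 1 * δ, C 2] with hMv
    have hMp : ∀ i, 0 < Mv i := by
      intro i
      fin_cases i
      · exact mul_pos (hCp 0) hδ
      · exact mul_pos (hCp 1) hδ
      · exact hCp 2
    have hMu : ∀ i, -⟪u, d i⟫_ℝ ≤ Mv i := by
      intro i
      rw [hud]
      fin_cases i
      · change -⟪n, d 0⟫_ℝ + δ * ⟪b, d 0⟫_ℝ - δ ^ 2 * ⟪a, d 0⟫_ℝ ≤ C 0 * δ
        have q : ⟪n, d 0⟫_ℝ = 0 := n1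
        have g0 := gen 0
        rw [q, abs_zero] at g0
        rw [q]
        linarith [bb 0, aa 0]
      · change -⟪n, d 1⟫_ℝ + δ * ⟪b, d 1⟫_ℝ - δ ^ 2 * ⟪a, d 1⟫_ℝ ≤ C 1 * δ
        have q : ⟪n, d 1⟫_ℝ = 0 := n2
        have g0 := gen 1
        rw [q, abs_zero] at g0
        rw [q]
        linarith [bb 1, aa 1]
      · change -⟪n, d 2⟫_ℝ + δ * ⟪b, d 2⟫_ℝ - δ ^ 2 * ⟪a, d 2⟫_ℝ ≤ C 2
        have q1 := mul_le_mul_of_nonneg_right k3.le (abs_nonneg ⟪b, d 2⟫_ℝ)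
        have q2 := mul_le_mul_of_nonneg_right k3.le (abs_nonneg ⟪a, d 2⟫_ℝ)
        have q3 := neg_le_abs ⟪n, d 2⟫_ℝ
        have := bb 2
        have := aa 2
        have q5 : C 2 = 1 + |⟪n, d 2⟫_ℝ| + |⟪b, d 2⟫_ℝ| + |⟪a, d 2⟫_ℝ| := rfl
        linarith
    have hMd : ∀ i, δ ≤ Mv i := by
      intro i
      fin_cases i
      · change δ ≤ C 0 * δ
        nlinarith [hC1 0]
      · change δ ≤ C 1 * δ
        nlinarith [hC1 1]
      · change δ ≤ C 2
        linarith [hC1 2]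
    have hu0 : evc u (DD M e1 e2 e3) ≠ 0 := by
      rw [eD]; exact mul_ne_zero (pow_ne_zero _ (by linarith)) k1
    have hprod : ∏ i, Mv i = C 0 * C 1 * C 2 * δ ^ 2 := by
      rw [Fin.prod_univ_three]
      simp only [hMv, Matrix.cons_val_zero, Matrix.cons_val_one, Matrix.cons_val]
      ring
    have res := coeff_lower h g hN (p := ∏ i, Mv i) (c := c) (t0 := 1 / δ)
      (Finset.prod_pos fun i _ => hMp i) hu0 (hfc δ hδ k2) (by
        intro t ht
        have ht0 : 0 < t := lt_of_lt_of_le (by positivity) ht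
        refine hlow u Mv hMp hMu t ht0 fun i => ?_
        have q1 : 1 ≤ t * δ := by rwa [ge_iff_le, div_le_iff₀ hδ] at ht
        exact q1.trans (mul_le_mul_of_nonneg_left (hMd i) ht0.le))
    rw [eD, eA, hprod, abs_mul, abs_mul, abs_pow, abs_pow, abs_neg, abs_of_pos hδ] at res
    have hpw : 0 < δ ^ (m + 3) := pow_pos hδ _
    refine le_of_mul_le_mul_left ?_ hpw
    calc δ ^ (m + 3) * (|E.eval (-δ)| * c) = δ ^ (m + 3) * |E.eval (-δ)| * c := by ring
      _ ≤ _ := res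
      _ = _ := by ring
  have l1 : Filter.Tendsto (fun δ : ℝ => |E.eval (-δ)| * c) (nhdsWithin 0 (Set.Ioi 0))
      (nhds (|E.coeff 0| * c)) := (hEc.abs.mul_const c).mono_left nhdsWithin_le_nhds
  have l2 : Filter.Tendsto (fun δ : ℝ => C 0 * C 1 * C 2 * κ * δ * |r.eval (-δ)|)
      (nhdsWithin 0 (Set.Ioi 0)) (nhds 0) := by
    have : Continuous fun δ : ℝ => C 0 * C 1 * C 2 * κ * δ * |r.eval (-δ)| := by fun_prop
    have := this.tendsto 0
    simp only [mul_zero, zero_mul] at this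
    exact this.mono_left nhdsWithin_le_nhds
  have := le_of_tendsto_of_tendsto l1 l2 main
  have : 0 < |E.coeff 0| * c := mul_pos (abs_pos.2 hE0) hc
  linarith

lemma flag_data (h : HPoly V P N) (g : Gen M e1 e2 e3 κ) (hN : N ⊆ M) (hon : ON n b a)
    (hb : 0 < wd b (fc V n)) (ha : 0 < wd a (fc (fc V n) b)) :
    ∃ m y κ W p1 p2 p3 p4, FlagData V (AA V P N M e1 e2 e3) n b a m y κ W p1 p2 p3 p4 := by
  have hn := fc_nonempty h.ne n
  obtain ⟨p1, h1⟩ := fc_nonempty (fc_nonempty hn b) a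
  obtain ⟨p2, h2⟩ := fc_nonempty (fc_nonempty hn b) (-a)
  obtain ⟨p3, h3⟩ := fc_nonempty (fc_nonempty hn (-b)) a
  obtain ⟨p4, h4⟩ := fc_nonempty (fc_nonempty hn (-b)) (-a)
  obtain ⟨m, E, y, κ', W, hE, hE0, hκ, hA, hT, hW, hW0⟩ := flag_lead h g hN hon hb ha h1 h2 h3 h4
  refine ⟨m, y, κ', W, p1, p2, p3, p4, hκ, hA, hT, h1, h2, h3, h4, hW, hW0, ?_⟩
  rintro rfl
  exact flag_hv h g hN hon hb ha h1 h2 h3 h4 hE hE0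
end

end

section
lemma exposedFace_tr (t : E3) (P : Set E3) (w : E3) :
    exposedFace ((t + ·) '' P) w = (t + ·) '' exposedFace P w := by
  ext x
  constructor
  · rintro ⟨⟨y, hy, rfl⟩, h⟩
    refine ⟨y, ⟨hy, fun z hz => ?_⟩, rfl⟩
    have := h (t + z) ⟨z, hz, rfl⟩
    simp only [inner_add_right] at this
    linarith
  · rintro ⟨y, ⟨hy, h⟩, rfl⟩
    refine ⟨⟨y, hy, rfl⟩, ?_⟩
    rintro _ ⟨z, hz, rfl⟩
    simp only [inner_add_right]
    linarith [h z hz]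

lemma intrinsicInterior_tr (t : E3) (F : Set E3) :
    intrinsicInterior ℝ ((t + ·) '' F) = (t + ·) '' intrinsicInterior ℝ F :=
  (AffineIsometryEquiv.constVAdd ℝ E3 t).toAffineIsometry.image_intrinsicInterior F

lemma supportCone_tr (t : E3) (P F : Set E3) :
    supportCone ((t + ·) '' P) ((t + ·) '' F) = supportCone P F := by
  ext v
  constructor
  · rintro ⟨x, hx, _, ⟨y, hy, rfl⟩, μ, hμ, rfl⟩
    rw [intrinsicInterior_tr] at hx
    obtain ⟨x, hx, rfl⟩ := hx
    exact ⟨x, hx, y, hy, μ, hμ, by simp⟩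
  · rintro ⟨x, hx, y, hy, μ, hμ, rfl⟩
    refine ⟨t + x, ?_, t + y, ⟨y, hy, rfl⟩, μ, hμ, by simp⟩
    rw [intrinsicInterior_tr]
    exact ⟨x, hx, rfl⟩

lemma iso_tr {P Q F : Set E3} {t : E3} (hQ : Q = (t + ·) '' P) (hF : IsProperFace P F) :
    ∃ G, IsProperFace Q G ∧ Isothetic P F Q G := by
  obtain ⟨w, hw, rfl⟩ := hF
  refine ⟨(t + ·) '' exposedFace P w, ⟨w, hw, ?_⟩, ⟨t, rfl⟩, ?_⟩
  · rw [hQ, exposedFace_tr]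
  · rw [hQ, supportCone_tr]

lemma tr_symm {P Q : Set E3} {t : E3} (hQ : Q = (t + ·) '' P) : P = (-t + ·) '' Q := by
  rw [hQ, Set.image_image]; simp

lemma tr_neg {P Q : Set E3} {t : E3} (hQ : Q = (t + ·) '' P) : -Q = (-t + ·) '' (-P) := by
  rw [hQ]
  ext x
  simp only [Set.mem_neg, Set.mem_image]
  constructor
  · rintro ⟨y, hy, e⟩
    exact ⟨-y, by simpa using hy, by rw [← neg_add, e, neg_neg]⟩
  · rintro ⟨y, hy, rfl⟩
    exact ⟨-y, hy, by abel⟩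

lemma syn_same {P Q : Set E3} {t : E3} (hQ : Q = (t + ·) '' P) : Synisothetic P (-P) Q (-Q) := by
  have h1 := tr_symm hQ
  have h2 := tr_neg hQ
  have h3 := tr_symm h2
  refine ⟨fun F hF => ?_, fun F hF => ?_, fun F hF => ?_, fun F hF => ?_⟩
  · exact (iso_tr hQ hF).imp fun G h => Or.inl h
  · exact (iso_tr h2 hF).imp fun G h => Or.inr h
  · exact (iso_tr h1 hF).imp fun G h => Or.inl h
  · exact (iso_tr h3 hF).imp fun G h => Or.inr h

lemma syn_refl {P Q : Set E3} {t : E3} (hQ : Q = (t + ·) '' (-P)) : Synisothetic P (-P) Q (-Q) := by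
  have h1 := tr_symm hQ
  have h2 := tr_neg hQ
  rw [neg_neg] at h2
  have h3 := tr_symm h2
  refine ⟨fun F hF => ?_, fun F hF => ?_, fun F hF => ?_, fun F hF => ?_⟩
  · exact (iso_tr h2 hF).imp fun G h => Or.inr h
  · exact (iso_tr hQ hF).imp fun G h => Or.inl h
  · exact (iso_tr h1 hF).imp fun G h => Or.inr h
  · exact (iso_tr h3 hF).imp fun G h => Or.inl h

lemma HPoly.mem {V : Finset E3} {P : Set E3} {N : Finset E3} (h : HPoly V P N) (x : E3) :
    x ∈ P ↔ ∀ w, ⟪w, x⟫_ℝ ≤ hs V w :=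
  ⟨h.le x, fun H => (h.rep x).2 fun i _ => H i⟩

lemma tr_of_hs {V V' : Finset E3} {P P' : Set E3} {N N' : Finset E3} (h : HPoly V P N)
    (h' : HPoly V' P' N') {t : E3} (H : ∀ w, hs V' w = hs V w + ⟪w, t⟫_ℝ) : P' = (t + ·) '' P := by
  ext x
  rw [h'.mem]
  constructor
  · intro hx
    refine ⟨x - t, (h.mem _).2 fun w => ?_, by simp⟩
    have := hx w
    rw [H] at this
    rw [inner_sub_right]; linarith
  · rintro ⟨y, hy, rfl⟩ w
    have := (h.mem y).1 hy w
    rw [H, inner_add_right]; linarith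

lemma tr_of_hs_neg {V V' : Finset E3} {P P' : Set E3} {N N' : Finset E3} (h : HPoly V P N)
    (h' : HPoly V' P' N') {t : E3} (H : ∀ w, hs V' w = hs V (-w) + ⟪w, t⟫_ℝ) :
    P' = (t + ·) '' (-P) := by
  ext x
  rw [h'.mem]
  constructor
  · intro hx
    refine ⟨x - t, (h.mem _).2 fun w => ?_, by simp⟩
    have := hx (-w)
    rw [H, neg_neg, inner_neg_left, inner_neg_left] at this
    rw [inner_neg_right, inner_sub_right]; linarith
  · rintro ⟨y, hy, rfl⟩ w
    have := (h.mem (-y)).1 hy (-w)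
    rw [inner_neg_neg] at this
    rw [H, inner_add_right]; linarith

lemma hs_dag (C : RE) (hC : C ≠ 0) (w : E3) : hs (sp (dag sgm C)) w = hs (sp C) (-w) := by
  obtain ⟨v, hv, e⟩ := exists_hs (supp_nonempty hC) (-w)
  refine hs_eq (v := -v) (fun x hx => ?_) ((sp_dag sgm_sgm C _).2 (by rwa [neg_neg])) ?_
  · have := le_hs ((sp_dag sgm_sgm C x).1 hx) (-w)
    rwa [inner_neg_neg] at this
  · rw [← e, inner_neg_right, inner_neg_left]

end

/-- If convex polytopes `P, P' ⊆ ℝ³` with non-empty interior have equal covariograms, then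
the pairs `(P, −P)` and `(P', −P')` are synisothetic. -/
theorem covariogram_implies_synisothetic
    (P P' : Set (EuclideanSpace ℝ (Fin 3)))
    (hP : IsPolytope P) (hP' : IsPolytope P')
    (hPint : (interior P).Nonempty) (hP'int : (interior P').Nonempty)
    (hcov : covariogram P = covariogram P') :
    Synisothetic P (-P) P' (-P') := by
  classical
  obtain ⟨V, hV⟩ := hP
  obtain ⟨V', hV'⟩ := hP'
  obtain ⟨N, h⟩ := exists_hpoly hV hPint
  obtain ⟨N', h'⟩ := exists_hpoly hV' hP'int
  obtain ⟨e1, e2, e3, κ, g⟩ := exists_gen (N ∪ N') (fun i hi =>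
    (Finset.mem_union.1 hi).elim (h.unit i) (h'.unit i))
  have hN : N ⊆ N ∪ N' := Finset.subset_union_left
  have hN' : N' ⊆ N ∪ N' := Finset.subset_union_right
  have hF : ∀ u, (∫ x, pt P u x) * ∫ x, pt P (-u) x = (∫ x, pt P' u x) * ∫ x, pt P' (-u) x := by
    intro u
    rw [F_cov h.cpt, F_cov h'.cpt]
    refine integral_congr_ae (Filter.Eventually.of_forall fun x => ?_)
    have := congrFun hcov x
    rw [covariogram, covariogram] at this
    change _ * _ = _ * _
    rw [this]
  have hdag := AA_dag h h' g hN hN' hF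
  have hA0 := AA_ne h g hN
  have hA0' := AA_ne h' g hN'
  have hsA := hs_spAA h g hN
  have hsA' := hs_spAA h' g hN'
  obtain ⟨m0, m1, m2⟩ := moms h g hN
  have hfl := fun n b a (hon : ON n b a) hb ha => flag_data h g hN (n := n) (b := b) (a := a) hon hb ha
  generalize AA V P N (N ∪ N') e1 e2 e3 = A at *
  generalize AA V' P' N' (N ∪ N') e1 e2 e3 = A' at *
  obtain ⟨B, C, w, w', hB, hC, hw⟩ := factor_pair sgm_sgm hA0 hA0' hdag
  have hBC := hA0
  rw [hB] at hBC
  have hB0 := left_ne_zero_of_mul hBC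
  have hC0 := right_ne_zero_of_mul hBC
  have hBC' := hA0'
  rw [hC] at hBC'
  have hw0 := right_ne_zero_of_mul (left_ne_zero_of_mul hBC')
  have hd0 := right_ne_zero_of_mul hBC'
  obtain ⟨τ, hτ⟩ := hs_unit hw
  have E1 : ∀ x, hs V x = hs (sp B) x + hs (sp C) x := fun x => by
    rw [← hsA, hB, hs_mul hB0 hC0]
  have E2 : ∀ x, hs V' x = hs (sp B) x + ⟪x, τ⟫_ℝ + hs (sp C) (-x) := fun x => by
    rw [← hsA', hC, hs_mul (mul_ne_zero hB0 hw0) hd0, hs_mul hB0 hw0, hτ, hs_singleton, hs_dag C hC0]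
  have alg : AlgHyp V A B C :=
    ⟨hB, ⟨h.ne, supp_nonempty hB0, supp_nonempty hC0, E1⟩, h.pos, hfl⟩
  rcases alg_main alg m0 m1 m2 with ⟨c, hc⟩ | ⟨c, hc⟩
  · refine syn_refl (tr_of_hs_neg h h' (t := τ + c) fun x => ?_)
    have := hc x
    rw [E1, E2, inner_add_right, real_inner_comm c x]; linarith
  · refine syn_same (tr_of_hs h h' (t := τ - c) fun x => ?_)
    have := hc x
    rw [E1, E2, inner_sub_right, real_inner_comm c x]; linarith
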